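/- Let K be a number field and Ω⁰ a finite set of finite places of K not dividing 2. Then there exist elements a, b, c, d of the ring of integers O_K such that: (i) each of the principal ideals (a), (b), (c), (d) is a prime ideal of O_K, these four prime ideals are pairwise distinct, none divides (2), and none corresponds to a place in Ω⁰; (ii) a and b are squares in the completion K_π for every π ∈ Ω⁰ and every finite place π dividing 2, and σ(a) > 0 and σ(b) > 0 for every real embedding σ : K → ℝ; (iii) 2 and −1 are squares in K_(a) and in K_(b); (iv) b divides a − 1 and a divides b·c²·d − 1; (v) c is not a square in K_(a) nor in K_(b), d is not a square in K_(b), and d is a square in K_(c); (vi) a is a square in K_(b) but not in K_(c), b is a square in K_(a) but not in K_(c), and d is a square in K_(a); (vii) a does not divide b·c·d + 2. -/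

import Mathlib

open NumberField IsDedekindDomain

/-- The image of `x ∈ 𝓞 K` in the completion of the number field `K`
at the finite place `π`. -/
noncomputable def intToAdicCompletion {K : Type*} [Field K] [NumberField K]
    (π : HeightOneSpectrum (𝓞 K)) (x : 𝓞 K) : π.adicCompletion K :=
  algebraMap K (π.adicCompletion K) (algebraMap (𝓞 K) K x)

section GaussianSums

open Real MeasureTheory
open scoped ENNReal

theorem summable_exp_neg_int_sq {a : ℝ} (ha : 0 < a) (x : ℝ) :
    Summable fun n : ℤ ↦ rexp (-π * a * (n + x) ^ 2) := by
  have h := (summable_jacobiTheta₂_term_iff (Complex.I * (a * x)) (Complex.I * a)).mpr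
    (by simpa using ha)
  have h' := (h.norm).mul_left (rexp (-π * a * x ^ 2))
  refine h'.congr fun n ↦ ?_
  rw [norm_jacobiTheta₂_term, ← Real.exp_add]
  congr 1
  simp
  ring

theorem tsum_exp_neg_int_add_sq {a : ℝ} (ha : 0 < a) (x : ℝ) :
    ((∑' n : ℤ, rexp (-π * a * (n + x) ^ 2) : ℝ) : ℂ) =
      ((1 / √a : ℝ) : ℂ) * ∑' n : ℤ, (rexp (-π / a * n ^ 2) : ℂ) *
        Complex.exp (2 * π * Complex.I * x * n) := by
  have h := Complex.tsum_exp_neg_quadratic (a := a) (by simpa using ha) (-(a * x))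
  have hl : ∀ n : ℤ, Complex.exp (-π * a * n ^ 2 + 2 * π * (-(a * x)) * n) =
      Complex.exp (π * a * x ^ 2) * ((rexp (-π * a * (n + x) ^ 2) : ℝ) : ℂ) := fun n ↦ by
    push_cast
    rw [← Complex.exp_add]
    congr 1
    ring
  have ha' : (a : ℂ) ≠ 0 := by exact_mod_cast ha.ne'
  have hr : ∀ n : ℤ, Complex.exp (-π / a * (n + Complex.I * (-(a * x))) ^ 2) =
      Complex.exp (π * a * x ^ 2) * ((rexp (-π / a * n ^ 2) : ℂ) *
        Complex.exp (2 * π * Complex.I * x * n)) := fun n ↦ by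
    push_cast
    rw [← Complex.exp_add, ← Complex.exp_add]
    congr 1
    have := Complex.I_sq
    field_simp
    linear_combination (-(a : ℂ) ^ 2 * x ^ 2) * this
  simp_rw [hl, hr, tsum_mul_left] at h
  rw [mul_left_comm] at h
  have h2 := mul_left_cancel₀ (Complex.exp_ne_zero _) h
  rw [Complex.ofReal_tsum, h2]
  congr 1
  rw [Real.sqrt_eq_rpow, Complex.ofReal_div, Complex.ofReal_cpow ha.le]
  simp

theorem exp_neg_le_factorial_div {z : ℝ} (hz : 0 < z) (k : ℕ) :
    rexp (-z) ≤ k.factorial / z ^ k := by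
  have := Real.pow_div_factorial_le_exp z hz.le k
  rw [Real.exp_neg, inv_le_comm₀ (Real.exp_pos _) (by positivity), inv_div]
  exact this

/-- One-dimensional Gaussian sums are nearly independent of the shift. -/
theorem exists_abs_tsum_exp_sub_le (k : ℕ) (hk : 1 ≤ k) :
    ∃ C > 0, ∀ a > 0, ∀ x : ℝ,
      |∑' n : ℤ, rexp (-π * a * (n + x) ^ 2) - 1 / √a| ≤ 1 / √a * (C * a ^ k) := by
  have hs : Summable fun n : ℤ ↦ 1 / (n : ℝ) ^ 2 := Real.summable_one_div_int_pow.mpr (by norm_num)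
  refine ⟨k.factorial * (∑' n : ℤ, 1 / (n : ℝ) ^ 2 + 1), ?_, fun a ha x ↦ ?_⟩
  · have : 0 ≤ ∑' n : ℤ, 1 / (n : ℝ) ^ 2 := tsum_nonneg fun n ↦ by positivity
    positivity
  have hb : ∀ n : ℤ, n ≠ 0 → rexp (-π / a * n ^ 2) ≤ k.factorial * a ^ k * (1 / (n : ℝ) ^ 2) := by
    intro n hn
    have hn1 : (1 : ℝ) ≤ (n : ℝ) ^ 2 := by
      exact_mod_cast Int.one_le_abs (by positivity : n ^ 2 ≠ 0) |>.trans_eq (abs_of_nonneg (by positivity))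
    have h1 := exp_neg_le_factorial_div (z := π / a * n ^ 2) (by positivity) k
    rw [neg_div, neg_mul]
    refine h1.trans ?_
    rw [div_le_iff₀ (by positivity)]
    have h2 : (n : ℝ) ^ 2 / a ^ k ≤ (π / a * n ^ 2) ^ k := by
      rw [mul_pow, div_pow, div_mul_eq_mul_div, div_le_div_iff_of_pos_right (by positivity)]
      have h3 : (1 : ℝ) ≤ π ^ k := one_le_pow₀ (by linarith [Real.pi_gt_three])
      have h4 : (n : ℝ) ^ 2 ≤ ((n : ℝ) ^ 2) ^ k := le_self_pow₀ hn1 (by omega)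
      nlinarith
    calc (k.factorial : ℝ) = k.factorial * a ^ k * (1 / (n : ℝ) ^ 2) * ((n : ℝ) ^ 2 / a ^ k) := by
          field_simp
      _ ≤ _ := by gcongr
  have hsum : Summable fun n : ℤ ↦ rexp (-π / a * n ^ 2) := by
    have := summable_exp_neg_int_sq (a := 1 / a) (by positivity) 0
    refine this.congr fun n ↦ ?_
    congr 1
    simp
    ring
  set g : ℤ → ℂ := fun n ↦ (rexp (-π / a * n ^ 2) : ℂ) * Complex.exp (2 * π * Complex.I * x * n)
    with hg
  have hgn : ∀ n, ‖g n‖ = rexp (-π / a * n ^ 2) := fun n ↦ by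
    rw [hg]
    simp only [norm_mul, Complex.norm_real, Real.norm_eq_abs, Real.abs_exp]
    rw [show 2 * (π : ℂ) * Complex.I * x * n = ((2 * π * x * n : ℝ) : ℂ) * Complex.I by
      push_cast; ring, Complex.norm_exp_ofReal_mul_I, mul_one]
  have hgs : Summable g := by
    apply Summable.of_norm
    simpa [hgn] using hsum
  have hg0 : g 0 = 1 := by simp [hg]
  have key : ‖∑' n, g n - 1‖ ≤ k.factorial * (∑' n : ℤ, 1 / (n : ℝ) ^ 2 + 1) * a ^ k := by
    have h1 : ∑' n, g n - 1 = ∑' n, (if n = 0 then 0 else g n) := by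
      rw [hgs.tsum_eq_add_tsum_ite 0, hg0, add_sub_cancel_left]
    rw [h1]
    have h2 : ∀ n : ℤ, ‖(if n = 0 then 0 else g n)‖ ≤ k.factorial * a ^ k * (1 / (n : ℝ) ^ 2) := by
      intro n
      split_ifs with h
      · simp [h]
      · rw [hgn]
        exact hb n h
    refine (tsum_of_norm_bounded (hs.mul_left _).hasSum h2).trans ?_
    rw [tsum_mul_left]
    have : 0 ≤ (k.factorial : ℝ) * a ^ k := by positivity
    nlinarith
  rw [← Real.norm_eq_abs, ← Complex.norm_real, Complex.ofReal_sub, tsum_exp_neg_int_add_sq ha x]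
  rw [← mul_sub_one, norm_mul, Complex.norm_real, Real.norm_of_nonneg (by positivity)]
  gcongr

theorem exists_tsum_exp_le_mul (k : ℕ) (hk : 1 ≤ k) :
    ∃ C > 0, ∀ a > 0, C * a ^ k ≤ 1 → ∀ x y : ℝ,
      ∑' n : ℤ, rexp (-π * a * (n + x) ^ 2) ≤
        (1 + C * a ^ k) * ∑' n : ℤ, rexp (-π * a * (n + y) ^ 2) := by
  obtain ⟨C, hC, h⟩ := exists_abs_tsum_exp_sub_le k hk
  refine ⟨4 * C, by positivity, fun a ha hCa x y ↦ ?_⟩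
  have hx := (abs_le.mp (h a ha x)).2
  have hy := (abs_le.mp (h a ha y)).1
  set δ := C * a ^ k with hδ
  have hδ0 : 0 ≤ δ := by positivity
  have h4 : 4 * C * a ^ k = 4 * δ := by rw [hδ]; ring
  rw [h4] at hCa ⊢
  have ha' : 0 < 1 / √a := by positivity
  have hy' : 1 / √a * (1 - δ) ≤ ∑' n : ℤ, rexp (-π * a * (n + y) ^ 2) := by linarith
  calc _ ≤ 1 / √a * (1 + δ) := by linarith
    _ ≤ 1 / √a * ((1 + 4 * δ) * (1 - δ)) := by gcongr; nlinarith
    _ = (1 + 4 * δ) * (1 / √a * (1 - δ)) := by ring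
    _ ≤ _ := by gcongr

variable {ι H : Type*} [Fintype ι] [DecidableEq ι] [NormedAddCommGroup H] [InnerProductSpace ℝ H]

/-- The Gaussian weight `exp (-π‖x‖²)` with values in `ℝ≥0∞`. -/
noncomputable def gaussWeight (x : H) : ℝ≥0∞ := .ofReal (rexp (-π * ‖x‖ ^ 2))

theorem tsum_gaussWeight_line {e : H} (he : e ≠ 0) (p : H) (s : ℝ) :
    ∑' n : ℤ, gaussWeight (p + ((n : ℝ) + s) • e) =
      .ofReal (rexp (-π * (‖p‖ ^ 2 - ‖e‖ ^ 2 * (inner ℝ p e / ‖e‖ ^ 2) ^ 2)) *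
        ∑' n : ℤ, rexp (-π * ‖e‖ ^ 2 * (n + (s + inner ℝ p e / ‖e‖ ^ 2)) ^ 2)) := by
  have he' : 0 < ‖e‖ := norm_pos_iff.mpr he
  have hn : ∀ n : ℤ, gaussWeight (p + ((n : ℝ) + s) • e) =
      .ofReal (rexp (-π * (‖p‖ ^ 2 - ‖e‖ ^ 2 * (inner ℝ p e / ‖e‖ ^ 2) ^ 2)) *
        rexp (-π * ‖e‖ ^ 2 * (n + (s + inner ℝ p e / ‖e‖ ^ 2)) ^ 2)) := by
    intro n
    rw [gaussWeight, ← Real.exp_add, norm_add_sq_real, norm_smul, inner_smul_right, mul_pow,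
      Real.norm_eq_abs, sq_abs]
    congr 2
    field_simp
    ring
  simp_rw [hn]
  rw [← ENNReal.ofReal_tsum_of_nonneg (fun n ↦ by positivity), tsum_mul_left]
  exact (summable_exp_neg_int_sq (by positivity) _).mul_left _

/-- The Gaussian sum over a shifted lattice, in coordinates. -/
noncomputable def latticeGaussSum (T : (ι → ℝ) →ₗ[ℝ] H) (y : ι → ℝ) : ℝ≥0∞ :=
  ∑' k : ι → ℤ, gaussWeight (T fun i ↦ (k i : ℝ) + y i)

omit [Fintype ι] in
theorem latticeGaussSum_eq_line (T : (ι → ℝ) →ₗ[ℝ] H) (y : ι → ℝ) (i : ι) (s : ℝ) :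
    latticeGaussSum T (Function.update y i s) = ∑' k : {j // j ≠ i} → ℤ, ∑' n : ℤ,
      gaussWeight (T (fun j ↦ if h : j = i then 0 else (k ⟨j, h⟩ : ℝ) + y j) +
        ((n : ℝ) + s) • T (Pi.single i 1)) := by
  rw [latticeGaussSum, ← (Equiv.funSplitAt i ℤ).symm.tsum_eq, ENNReal.tsum_prod', ENNReal.tsum_comm]
  refine tsum_congr fun k ↦ tsum_congr fun n ↦ ?_
  rw [← map_smul, ← map_add]
  congr 2
  ext j
  by_cases h : j = i
  · subst h
    simp [Equiv.funSplitAt, Equiv.piSplitAt]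
  · simp [Equiv.funSplitAt, Equiv.piSplitAt, h]

end GaussianSums

section LatticeGaussian

open Real MeasureTheory
open scoped ENNReal

theorem ZSpan.lintegral_eq_tsum_fundamentalDomain {ι E : Type*} [Fintype ι] [NormedAddCommGroup E]
    [NormedSpace ℝ E] [MeasurableSpace E] [BorelSpace E] (b : Module.Basis ι ℝ E) (μ : Measure E)
    [μ.IsAddHaarMeasure] (f : E → ℝ≥0∞) :
    ∫⁻ x, f x ∂μ = ∑' k : ι → ℤ, ∫⁻ x in ZSpan.fundamentalDomain b, f (∑ i, k i • b i + x) ∂μ := by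
  have := b.finiteDimensional_of_finite
  have : VAddInvariantMeasure (Submodule.span ℤ (Set.range b)) E μ :=
    inferInstanceAs <| VAddInvariantMeasure (Submodule.span ℤ (Set.range b)).toAddSubgroup E μ
  rw [(ZSpan.isAddFundamentalDomain b μ).lintegral_eq_tsum'', 
    ← (b.restrictScalars ℤ).equivFun.symm.toEquiv.tsum_eq]
  refine tsum_congr fun k ↦ ?_
  congr 1
  ext x
  congr 1
  simp [Submodule.vadd_def, Module.Basis.equivFun_symm_apply]

variable {ι H : Type*} [Fintype ι] [DecidableEq ι] [NormedAddCommGroup H] [InnerProductSpace ℝ H]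

omit [Fintype ι] in
theorem latticeGaussSum_update_le {k : ℕ} {C : ℝ} (hC : 0 < C) (h : ∀ a > 0, C * a ^ k ≤ 1 → ∀ x y : ℝ,
      ∑' n : ℤ, rexp (-π * a * (n + x) ^ 2) ≤
        (1 + C * a ^ k) * ∑' n : ℤ, rexp (-π * a * (n + y) ^ 2))
    {T : (ι → ℝ) →ₗ[ℝ] H} {i : ι} {δ : ℝ} (hδ : δ ≤ 1) (hT : T (Pi.single i 1) ≠ 0)
    (hi : C * (‖T (Pi.single i 1)‖ ^ 2) ^ k ≤ δ) (y : ι → ℝ) (s s' : ℝ) :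
    latticeGaussSum T (Function.update y i s) ≤
      .ofReal (1 + δ) * latticeGaussSum T (Function.update y i s') := by
  have hδ0 : 0 ≤ δ := le_trans (by positivity) hi
  rw [latticeGaussSum_eq_line, latticeGaussSum_eq_line, ← ENNReal.tsum_mul_left]
  refine ENNReal.tsum_le_tsum fun l ↦ ?_
  rw [tsum_gaussWeight_line hT, tsum_gaussWeight_line hT, ← ENNReal.ofReal_mul (by positivity)]
  refine ENNReal.ofReal_le_ofReal ?_
  rw [mul_left_comm]
  refine mul_le_mul_of_nonneg_left ?_ (by positivity)
  refine (h _ (by positivity) (hi.trans hδ) _ (s' + inner ℝ (T fun j ↦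
    if h : j = i then 0 else (l ⟨j, h⟩ : ℝ) + y j) (T (Pi.single i 1)) /
      ‖T (Pi.single i 1)‖ ^ 2)).trans ?_
  refine mul_le_mul_of_nonneg_right ?_ (tsum_nonneg fun n ↦ by positivity)
  linarith

theorem latticeGaussSum_le {k : ℕ} {C : ℝ} (hC : 0 < C) (h : ∀ a > 0, C * a ^ k ≤ 1 → ∀ x y : ℝ,
      ∑' n : ℤ, rexp (-π * a * (n + x) ^ 2) ≤
        (1 + C * a ^ k) * ∑' n : ℤ, rexp (-π * a * (n + y) ^ 2))
    {T : (ι → ℝ) →ₗ[ℝ] H} {δ : ℝ} (hδ : δ ≤ 1) (hT : ∀ i, T (Pi.single i 1) ≠ 0)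
    (hi : ∀ i, C * (‖T (Pi.single i 1)‖ ^ 2) ^ k ≤ δ) (y y' : ι → ℝ) :
    latticeGaussSum T y ≤ .ofReal (1 + δ) ^ Fintype.card ι * latticeGaussSum T y' := by
  suffices ∀ s : Finset ι, latticeGaussSum T y ≤
      .ofReal (1 + δ) ^ s.card * latticeGaussSum T (fun i ↦ if i ∈ s then y' i else y i) by
    simpa using this Finset.univ
  intro s
  induction s using Finset.induction_on with
  | empty => simp
  | insert a s ha ih =>
    rw [Finset.card_insert_of_notMem ha, pow_succ, mul_assoc]
    refine ih.trans ?_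
    gcongr
    set z : ι → ℝ := fun i ↦ if i ∈ s then y' i else y i
    have h1 : (fun i ↦ if i ∈ insert a s then y' i else y i) = Function.update z a (y' a) := by
      ext i
      by_cases hi : i = a
      · subst hi; simp
      · simp [z, hi]
    rw [h1]
    conv_lhs => rw [← Function.update_eq_self a z]
    exact latticeGaussSum_update_le hC h hδ (hT a) (hi a) z _ _

/-- The integral of the Gaussian weight along a linear map. -/
noncomputable def gaussIntegral (T : (ι → ℝ) →ₗ[ℝ] H) : ℝ≥0∞ := ∫⁻ x, gaussWeight (T x)

omit [DecidableEq ι] in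
theorem continuous_gaussWeight (T : (ι → ℝ) →ₗ[ℝ] H) : Continuous fun x ↦ gaussWeight (T x) := by
  have := T.continuous_of_finiteDimensional
  exact ENNReal.continuous_ofReal.comp (by fun_prop)

omit [DecidableEq ι] in
theorem gaussIntegral_eq_lintegral_latticeGaussSum (T : (ι → ℝ) →ₗ[ℝ] H) :
    gaussIntegral T = ∫⁻ y in ZSpan.fundamentalDomain (Pi.basisFun ℝ ι), latticeGaussSum T y := by
  rw [gaussIntegral, ZSpan.lintegral_eq_tsum_fundamentalDomain (Pi.basisFun ℝ ι), ← lintegral_tsum]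
  · refine lintegral_congr fun y ↦ ?_
    unfold latticeGaussSum
    refine tsum_congr fun k ↦ ?_
    congr 2
    ext i
    classical
    simp [Finset.sum_apply, Pi.single_apply]
  · intro k
    exact ((continuous_gaussWeight T).comp (continuous_const_add _)).measurable.aemeasurable

omit [DecidableEq ι] in
theorem volume_fundamentalDomain_basisFun :
    volume (ZSpan.fundamentalDomain (Pi.basisFun ℝ ι)) = 1 := by
  rw [ZSpan.fundamentalDomain_pi_basisFun, volume_pi, Measure.pi_pi]
  simp

omit [DecidableEq ι] in
/-- Poisson-type comparison between a lattice Gaussian sum and the Gaussian integral. -/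
theorem latticeGaussSum_le_gaussIntegral {T : (ι → ℝ) →ₗ[ℝ] H} {R : ℝ≥0∞}
    (h : ∀ y y', latticeGaussSum T y ≤ R * latticeGaussSum T y') (y : ι → ℝ) :
    latticeGaussSum T y ≤ R * gaussIntegral T ∧ gaussIntegral T ≤ R * latticeGaussSum T y := by
  have hv := volume_fundamentalDomain_basisFun (ι := ι)
  have hc (c : ℝ≥0∞) : ∫⁻ _ in ZSpan.fundamentalDomain (Pi.basisFun ℝ ι), c = c := by
    rw [setLIntegral_const, hv, mul_one]
  have hm : Measurable (latticeGaussSum T) := by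
    unfold latticeGaussSum
    refine Measurable.tsum fun k ↦ ?_
    have : (fun y : ι → ℝ ↦ gaussWeight (T fun i ↦ (k i : ℝ) + y i)) =
      (fun x ↦ gaussWeight (T x)) ∘ fun y ↦ (fun i ↦ (k i : ℝ)) + y := rfl
    rw [this]
    exact ((continuous_gaussWeight T).comp (continuous_const_add _)).measurable
  rw [gaussIntegral_eq_lintegral_latticeGaussSum]
  constructor
  · rw [← lintegral_const_mul _ hm]
    conv_lhs => rw [← hc (latticeGaussSum T y)]
    exact lintegral_mono fun y' ↦ h y y'
  · conv_rhs => rw [← hc (R * latticeGaussSum T y)]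
    exact lintegral_mono fun y' ↦ h y' y

omit [DecidableEq ι] in
theorem gaussIntegral_comp (T : (ι → ℝ) →ₗ[ℝ] H) (A : (ι → ℝ) →ₗ[ℝ] (ι → ℝ))
    (hA : LinearMap.det A ≠ 0) :
    gaussIntegral (T ∘ₗ A) = .ofReal |(LinearMap.det A)⁻¹| * gaussIntegral T := by
  have h := Measure.map_linearMap_addHaar_eq_smul_addHaar (volume : Measure (ι → ℝ)) hA
  unfold gaussIntegral
  rw [← smul_eq_mul, ← lintegral_smul_measure, ← h, lintegral_map]
  · rfl
  · exact (continuous_gaussWeight T).measurable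
  · exact A.continuous_of_finiteDimensional.measurable

omit [DecidableEq ι] in
theorem gaussIntegral_smul (T : (ι → ℝ) →ₗ[ℝ] H) {c : ℝ} (hc : 0 < c) :
    gaussIntegral (c • T) = .ofReal (c ^ Fintype.card ι)⁻¹ * gaussIntegral T := by
  have h := gaussIntegral_comp T (c • LinearMap.id) (by simp [hc.ne'])
  rw [LinearMap.comp_smul, LinearMap.comp_id] at h
  rw [h]
  congr 2
  simp [abs_of_pos hc]

end LatticeGaussian

noncomputable section TwistedNorm

open Real MeasureTheory NumberField.InfinitePlace NumberField.Units
  NumberField.Units.dirichletUnitTheorem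
open scoped ENNReal Classical

variable {K : Type*} [Field K] [NumberField K]

/-- The point of the trace-zero hyperplane of `ℝ^{places}` with logarithmic coordinates `v`. -/
def traceZero (v : logSpace K) (w : InfinitePlace K) : ℝ :=
  if h : w = w₀ then -(∑ i, v i) / mult w else v ⟨w, h⟩ / mult w

theorem traceZero_add (v v' : logSpace K) (w : InfinitePlace K) :
    traceZero (v + v') w = traceZero v w + traceZero v' w := by
  unfold traceZero
  split_ifs <;> simp [Finset.sum_add_distrib] <;> ring

theorem sum_mult_mul_traceZero (v : logSpace K) : ∑ w, mult w * traceZero v w = 0 := by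
  have hm : ∀ w : InfinitePlace K, (mult w : ℝ) ≠ 0 := fun w ↦ by simp [mult_ne_zero]
  rw [Fintype.sum_eq_add_sum_subtype_ne _ (w₀ : InfinitePlace K)]
  have : ∀ i : {w : InfinitePlace K // w ≠ w₀}, mult i.1 * traceZero v i.1 = v i := fun i ↦ by
    rw [traceZero, dif_neg i.2, mul_div_cancel₀ _ (hm _)]
  simp_rw [this]
  rw [traceZero, dif_pos rfl, mul_div_cancel₀ _ (hm _)]
  ring

theorem traceZero_eq {x : InfinitePlace K → ℝ} (hx : ∑ w, mult w * x w = 0) :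
    traceZero (fun w : {w : InfinitePlace K // w ≠ w₀} ↦ mult w.1 * x w.1) = x := by
  have hm : ∀ w : InfinitePlace K, (mult w : ℝ) ≠ 0 := fun w ↦ by simp [mult_ne_zero]
  ext w
  unfold traceZero
  split_ifs with h
  · subst h
    rw [Fintype.sum_eq_add_sum_subtype_ne _ (w₀ : InfinitePlace K)] at hx
    rw [div_eq_iff (hm _)]
    linarith
  · rw [mul_div_cancel_left₀ _ (hm _)]

/-- The quadratic form `∑ |exp (v_φ) φ(α)|²`. -/
def twistedNorm (v : logSpace K) (α : K) : ℝ :=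
  ∑ φ : K →+* ℂ, (rexp (traceZero v (mk φ)) * ‖φ α‖) ^ 2

/-- The Gaussian attached to `twistedNorm`. -/
def twistedGauss (τ : ℝ) (v : logSpace K) (α : K) : ℝ≥0∞ :=
  .ofReal (rexp (-π * (τ ^ 2 * twistedNorm v α)))

variable (K) in
/-- The radial test function obtained by integrating a Gaussian over the trace-zero directions. -/
def radialGauss (y : ℝ) : ℝ≥0∞ :=
  ∫⁻ v : logSpace K, twistedGauss (y ^ (1 / (Module.finrank ℚ K : ℝ))) v 1

theorem continuous_twistedNorm (α : K) : Continuous fun v : logSpace K ↦ twistedNorm v α := by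
  unfold twistedNorm
  refine continuous_finsetSum _ fun φ _ ↦ ?_
  have : Continuous fun v : logSpace K ↦ traceZero v (mk φ) := by
    unfold traceZero
    split_ifs <;> fun_prop
  fun_prop

theorem continuous_twistedGauss (τ : ℝ) (α : K) :
    Continuous fun v : logSpace K ↦ twistedGauss τ v α := by
  have := continuous_twistedNorm α
  exact ENNReal.continuous_ofReal.comp (by fun_prop)

/-- The logarithmic vector of `α`, normalised to have trace zero. -/
def normalizedLog (α : K) : logSpace K := fun w ↦
  mult w.1 * (Real.log (w.1 α) - Real.log |Algebra.norm ℚ α| / Module.finrank ℚ K)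

theorem traceZero_normalizedLog {α : K} (hα : α ≠ 0) (w : InfinitePlace K) :
    traceZero (normalizedLog α) w =
      Real.log (w α) - Real.log |Algebra.norm ℚ α| / Module.finrank ℚ K := by
  have h : ∑ w : InfinitePlace K,
      mult w * (Real.log (w α) - Real.log |Algebra.norm ℚ α| / Module.finrank ℚ K) = 0 := by
    have h1 : ∑ w : InfinitePlace K, mult w * Real.log (w α) = Real.log |Algebra.norm ℚ α| := by
      rw [← Rat.cast_abs, ← prod_eq_abs_norm, Real.log_prod fun w _ ↦ pow_ne_zero _ (by simpa using hα)]
      simp [Real.log_pow]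
    have h2 : ((∑ w : InfinitePlace K, mult w : ℕ) : ℝ) = Module.finrank ℚ K := by
      rw [sum_mult_eq]
    have h3 : (Module.finrank ℚ K : ℝ) ≠ 0 := by
      exact_mod_cast Module.finrank_pos.ne'
    simp_rw [mul_sub]
    rw [Finset.sum_sub_distrib, h1, ← Finset.sum_mul, ← Nat.cast_sum, h2]
    field_simp
    simp
  exact congrFun (traceZero_eq h) w

theorem twistedNorm_eq_mul {α β : K} (hβ : β ≠ 0) (v : logSpace K) :
    twistedNorm v (α * β) = (((|Algebra.norm ℚ β| : ℚ) : ℝ) ^ (1 / (Module.finrank ℚ K : ℝ))) ^ 2 *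
      twistedNorm (v + normalizedLog β) α := by
  unfold twistedNorm
  rw [Finset.mul_sum]
  refine Finset.sum_congr rfl fun φ _ ↦ ?_
  rw [← mul_pow]
  congr 1
  rw [traceZero_add, traceZero_normalizedLog hβ, Real.exp_add, Real.exp_sub, InfinitePlace.apply,
    Real.exp_log (by simpa using hβ), map_mul, norm_mul]
  have hN : (0 : ℝ) < |Algebra.norm ℚ β| := by simpa using hβ
  rw [Real.rpow_def_of_pos (by exact_mod_cast hN), mul_one_div, Rat.cast_abs]
  field_simp

theorem lintegral_twistedGauss {α : K} (hα : α ≠ 0) {τ : ℝ} (hτ : 0 < τ) :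
    ∫⁻ v, twistedGauss τ v α =
      radialGauss K (τ ^ Module.finrank ℚ K * ((|Algebra.norm ℚ α| : ℚ) : ℝ)) := by
  have hn : Module.finrank ℚ K ≠ 0 := Module.finrank_pos.ne'
  rw [radialGauss, ← lintegral_add_right_eq_self (fun v ↦ twistedGauss (_ ^ _) v 1)
    (normalizedLog α)]
  refine lintegral_congr fun v ↦ ?_
  unfold twistedGauss
  conv_lhs => rw [← one_mul α]
  rw [twistedNorm_eq_mul hα, Real.mul_rpow (by positivity) (by simp), one_div,
    Real.pow_rpow_inv_natCast hτ.le hn]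
  ring_nf

theorem twistedGauss_unit_mul (u : (𝓞 K)ˣ) (τ : ℝ) (v : logSpace K) (α : K) :
    twistedGauss τ v (u * α) = twistedGauss τ (logEmbedding K (Additive.ofMul u) + v) α := by
  have hu : ((u : 𝓞 K) : K) ≠ 0 := by simp
  have h1 : |Algebra.norm ℚ ((u : 𝓞 K) : K)| = 1 := by
    have := Units.norm (K := K) u
    exact this
  have h2 : normalizedLog ((u : 𝓞 K) : K) = logEmbedding K (Additive.ofMul u) := by
    ext w
    have h3 : |((Algebra.norm ℚ ((u : 𝓞 K) : K) : ℚ) : ℝ)| = 1 := by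
      rw [← Rat.cast_abs, h1, Rat.cast_one]
    simp [normalizedLog, h3]
  unfold twistedGauss
  rw [mul_comm (_ : K) α, twistedNorm_eq_mul hu, h1, h2, add_comm]
  simp

variable (K) in
/-- A fundamental domain for the unit lattice. -/
def unitDomain : Set (logSpace K) :=
  ZSpan.fundamentalDomain ((basisUnitLattice K).ofZLatticeBasis ℝ (unitLattice K))

theorem tsum_units_lintegral_twistedGauss {α : K} (hα : α ≠ 0) {τ : ℝ} (hτ : 0 < τ) :
    ∑' u : (𝓞 K)ˣ, ∫⁻ v in unitDomain K, twistedGauss τ v (u * α) =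
      torsionOrder K * radialGauss K (τ ^ Module.finrank ℚ K * ((|Algebra.norm ℚ α| : ℚ) : ℝ)) := by
  rw [← lintegral_twistedGauss hα hτ, ZSpan.lintegral_eq_tsum_fundamentalDomain
    ((basisUnitLattice K).ofZLatticeBasis ℝ (unitLattice K))]
  let e : torsion K × (Fin (rank K) → ℤ) ≃ (𝓞 K)ˣ := Equiv.ofBijective
    (fun ζe ↦ ζe.1 * ∏ i, (fundSystem K i) ^ (ζe.2 i))
    (Function.bijective_iff_existsUnique _ |>.mpr fun x ↦ by
      simpa [eq_comm] using! exist_unique_eq_mul_prod K x)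
  rw [← e.tsum_eq, ENNReal.tsum_prod']
  have h : ∀ (ζ : torsion K) (k : Fin (rank K) → ℤ),
      logEmbedding K (Additive.ofMul (e (ζ, k))) =
        ∑ i, k i • ((basisUnitLattice K).ofZLatticeBasis ℝ (unitLattice K)) i := by
    intro ζ k
    have : e (ζ, k) = ζ.1 * ∏ i, (fundSystem K i) ^ (k i) := rfl
    rw [this, ofMul_mul, map_add, logEmbedding_eq_zero_iff.mpr ζ.2, zero_add, ofMul_prod, map_sum]
    refine Finset.sum_congr rfl fun i _ ↦ ?_
    rw [ofMul_zpow, map_zsmul, logEmbedding_fundSystem, Module.Basis.ofZLatticeBasis_apply]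
  simp_rw [twistedGauss_unit_mul, h]
  have := Fintype.ofFinite (torsion K)
  rw [tsum_fintype, Finset.sum_const, Finset.card_univ, nsmul_eq_mul, torsionOrder,
    Nat.card_eq_fintype_card]
  rfl

end TwistedNorm

noncomputable section RayGauss

open Real MeasureTheory NumberField.InfinitePlace NumberField.Units
  NumberField.Units.dirichletUnitTheorem
open scoped ENNReal Classical

variable {K : Type*} [Field K] [NumberField K]

/-- Ideals `𝔞` such that `𝔞 * J` has a generator congruent to `1` modulo `m`. -/
def rayIdeals (m : ℕ) (J : Ideal (𝓞 K)) : Set (Ideal (𝓞 K)) :=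
  {𝔞 | ∃ α : 𝓞 K, α ≠ 0 ∧ (m : 𝓞 K) ∣ α - 1 ∧ 𝔞 * J = Ideal.span {α}}

/-- The sum of `radialGauss` over `rayIdeals`. -/
def rayGauss (m : ℕ) (J : Ideal (𝓞 K)) (t : ℝ) : ℝ≥0∞ :=
  ∑' 𝔞 : rayIdeals m J, radialGauss K (t * Ideal.absNorm 𝔞.1)

/-- Elements of `J` congruent to a unit modulo `m`. -/
def unitResidues (m : ℕ) (J : Ideal (𝓞 K)) : Set (𝓞 K) :=
  {α | α ∈ J ∧ ∃ u : (𝓞 K)ˣ, (m : 𝓞 K) ∣ α - u}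

theorem not_isUnit_natCast {m : ℕ} (hm : 2 ≤ m) : ¬ IsUnit (m : 𝓞 K) := by
  intro h
  have h1 := Ideal.absNorm_span_singleton (m : 𝓞 K)
  rw [Ideal.span_singleton_eq_top.mpr h, Ideal.absNorm_top] at h1
  have h2 : Algebra.norm ℤ (m : 𝓞 K) = (m : ℤ) ^ Module.finrank ℤ (𝓞 K) := by
    have := Algebra.norm_algebraMap_of_basis (RingOfIntegers.basis K) (m : ℤ)
    rw [Module.finrank_eq_card_basis (RingOfIntegers.basis K), ← this]
    simp
  rw [h2, Int.natAbs_pow, Int.natAbs_natCast] at h1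
  have h3 : Module.finrank ℤ (𝓞 K) ≠ 0 := by
    rw [RingOfIntegers.rank]; exact Module.finrank_pos.ne'
  have := Nat.one_lt_pow h3 (show 1 < m by omega)
  omega

theorem ne_zero_of_dvd_sub_unit {m : ℕ} (hm : 2 ≤ m) {α : 𝓞 K} {u : (𝓞 K)ˣ}
    (h : (m : 𝓞 K) ∣ α - u) : α ≠ 0 := by
  rintro rfl
  rw [zero_sub, dvd_neg] at h
  exact not_isUnit_natCast hm (isUnit_of_dvd_unit h u.isUnit)

theorem coe_absNorm_span (α : 𝓞 K) :
    ((|Algebra.norm ℚ (α : K)| : ℚ) : ℝ) = Ideal.absNorm (Ideal.span {α}) := by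
  rw [Ideal.absNorm_span_singleton, ← Algebra.coe_norm_int, Nat.cast_natAbs]
  push_cast
  rfl

omit [NumberField K] in
theorem exists_rayGenerator {m : ℕ} {J : Ideal (𝓞 K)} (𝔞 : rayIdeals m J) :
    ∃ α : 𝓞 K, α ≠ 0 ∧ (m : 𝓞 K) ∣ α - 1 ∧ 𝔞.1 * J = Ideal.span {α} := 𝔞.2

/-- The generator congruent to `1` chosen for an element of `rayIdeals`. -/
def rayGenerator {m : ℕ} {J : Ideal (𝓞 K)} (𝔞 : rayIdeals m J) : 𝓞 K := (exists_rayGenerator 𝔞).choose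

omit [NumberField K] in
theorem rayGenerator_spec {m : ℕ} {J : Ideal (𝓞 K)} (𝔞 : rayIdeals m J) :
    rayGenerator 𝔞 ≠ 0 ∧ (m : 𝓞 K) ∣ rayGenerator 𝔞 - 1 ∧
      𝔞.1 * J = Ideal.span {rayGenerator 𝔞} := (exists_rayGenerator 𝔞).choose_spec

omit [NumberField K] in
theorem unit_mul_rayGenerator_mem {m : ℕ} {J : Ideal (𝓞 K)} (𝔞 : rayIdeals m J) (u : (𝓞 K)ˣ) :
    (u : 𝓞 K) * rayGenerator 𝔞 ∈ unitResidues m J := by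
  obtain ⟨h0, h1, h2⟩ := rayGenerator_spec 𝔞
  refine ⟨Ideal.mul_mem_left _ _ ?_, u, ?_⟩
  · have h3 : rayGenerator 𝔞 ∈ 𝔞.1 * J := h2 ▸ Ideal.mem_span_singleton_self _
    have h4 : 𝔞.1 * J ≤ J := Ideal.mul_le_right
    exact h4 h3
  · rw [show (u : 𝓞 K) * rayGenerator 𝔞 - u = u * (rayGenerator 𝔞 - 1) by ring]
    exact Dvd.dvd.mul_left h1 _

theorem unit_mul_rayGenerator_bijective {m : ℕ} (hm : 2 ≤ m) {J : Ideal (𝓞 K)} (hJ : J ≠ ⊥) :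
    Function.Bijective fun x : rayIdeals m J × (𝓞 K)ˣ ↦
      (⟨x.2 * rayGenerator x.1, unit_mul_rayGenerator_mem x.1 x.2⟩ : unitResidues m J) := by
  constructor
  · rintro ⟨𝔞, u⟩ ⟨𝔟, u'⟩ heq
    replace heq : (u : 𝓞 K) * rayGenerator 𝔞 = u' * rayGenerator 𝔟 := congrArg Subtype.val heq
    obtain ⟨h0, h1, h2⟩ := rayGenerator_spec 𝔞
    obtain ⟨h0', h1', h2'⟩ := rayGenerator_spec 𝔟
    have e1 : (Ideal.span {rayGenerator 𝔞} : Ideal (𝓞 K)) = Ideal.span {rayGenerator 𝔟} := by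
      rw [← Ideal.span_singleton_mul_left_unit u.isUnit, heq,
        Ideal.span_singleton_mul_left_unit u'.isUnit]
    have : 𝔞 = 𝔟 := by
      ext1
      rw [← h2, ← h2'] at e1
      exact mul_right_cancel₀ hJ e1
    subst this
    have := mul_right_cancel₀ h0 heq
    rw [Units.ext this]
  · rintro ⟨α, hα, u, hu⟩
    have hα0 := ne_zero_of_dvd_sub_unit hm hu
    obtain ⟨𝔞, h𝔞⟩ : J ∣ Ideal.span {α} := by
      rw [Ideal.dvd_span_singleton]; exact hα
    have h : 𝔞 ∈ rayIdeals m J := by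
      refine ⟨(u⁻¹ : (𝓞 K)ˣ) * α, mul_ne_zero (Units.ne_zero _) hα0, ?_, ?_⟩
      · have : ((u⁻¹ : (𝓞 K)ˣ) : 𝓞 K) * α - 1 = (u⁻¹ : (𝓞 K)ˣ) * (α - u) := by
          rw [mul_sub, Units.inv_mul]
        rw [this]
        exact Dvd.dvd.mul_left hu _
      · rw [mul_comm, ← h𝔞, Ideal.span_singleton_mul_left_unit (Units.isUnit _)]
    obtain ⟨h0, h1, h2⟩ := rayGenerator_spec ⟨𝔞, h⟩
    have e1 : Associated (rayGenerator ⟨𝔞, h⟩) α := by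
      rw [← Ideal.span_singleton_eq_span_singleton, h𝔞, mul_comm J, ← h2]
    obtain ⟨u', hu'⟩ := e1
    refine ⟨⟨⟨𝔞, h⟩, u'⟩, Subtype.ext ?_⟩
    exact (mul_comm _ _).trans hu'

/-- Elements of `J` congruent to a unit are products of a unit and a generator of `𝔞 * J`. -/
def rayIdealsProdUnitsEquiv {m : ℕ} (hm : 2 ≤ m) {J : Ideal (𝓞 K)} (hJ : J ≠ ⊥) :
    rayIdeals m J × (𝓞 K)ˣ ≃ unitResidues m J :=
  Equiv.ofBijective _ (unit_mul_rayGenerator_bijective hm hJ)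

theorem tsum_unitResidues {m : ℕ} (hm : 2 ≤ m) {J : Ideal (𝓞 K)} (hJ : J ≠ ⊥) {τ : ℝ} (hτ : 0 < τ) :
    ∑' α : unitResidues m J, ∫⁻ v in unitDomain K, twistedGauss τ v (α : 𝓞 K) =
      torsionOrder K * rayGauss m J (τ ^ Module.finrank ℚ K * Ideal.absNorm J) := by
  rw [← (rayIdealsProdUnitsEquiv hm hJ).tsum_eq, ENNReal.tsum_prod', rayGauss,
    ← ENNReal.tsum_mul_left]
  refine tsum_congr fun 𝔞 ↦ ?_
  obtain ⟨h0, h1, h2⟩ := rayGenerator_spec 𝔞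
  have h3 : ((rayGenerator 𝔞 : 𝓞 K) : K) ≠ 0 := by
    simpa using h0
  have := tsum_units_lintegral_twistedGauss h3 hτ
  rw [coe_absNorm_span] at this
  have h4 : Ideal.absNorm (Ideal.span {rayGenerator 𝔞}) = Ideal.absNorm 𝔞.1 * Ideal.absNorm J := by
    rw [← map_mul, h2]
  rw [h4] at this
  have e : τ ^ Module.finrank ℚ K * Ideal.absNorm J * Ideal.absNorm 𝔞.1 =
    τ ^ Module.finrank ℚ K * ((Ideal.absNorm 𝔞.1 * Ideal.absNorm J : ℕ) : ℝ) := by push_cast; ring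
  rw [e, ← this]
  refine tsum_congr fun u ↦ ?_
  refine lintegral_congr fun v ↦ ?_
  simp [rayIdealsProdUnitsEquiv]

/-- The twisted Minkowski embedding in coordinates. -/
def twistedMap {ι : Type*} [Fintype ι] (v : logSpace K) (ω : ι → K) :
    (ι → ℝ) →ₗ[ℝ] EuclideanSpace ℂ (K →+* ℂ) where
  toFun x := WithLp.toLp 2 fun φ ↦ (rexp (traceZero v (mk φ)) : ℂ) * ∑ i, (x i : ℂ) * φ (ω i)
  map_add' x y := by
    ext φ
    simp [add_mul, Finset.sum_add_distrib, mul_add]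
  map_smul' c x := by
    ext φ
    simp [mul_assoc, Finset.mul_sum, mul_left_comm]

theorem norm_twistedMap_sq {ι : Type*} [Fintype ι] (v : logSpace K) (ω : ι → K) (x : ι → ℚ) :
    ‖twistedMap v ω (fun i ↦ (x i : ℝ))‖ ^ 2 = twistedNorm v (∑ i, x i • ω i) := by
  rw [EuclideanSpace.norm_sq_eq, twistedNorm]
  refine Finset.sum_congr rfl fun φ _ ↦ ?_
  have : ∑ i, (((x i : ℝ) : ℝ) : ℂ) * φ (ω i) = φ (∑ i, x i • ω i) := by
    rw [map_sum]
    refine Finset.sum_congr rfl fun i _ ↦ ?_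
    rw [Rat.smul_def, map_mul, map_ratCast]
    simp
  simp only [twistedMap, LinearMap.coe_mk, AddHom.coe_mk]
  rw [this, norm_mul, Complex.norm_real, Real.norm_eq_abs, Real.abs_exp]

theorem twistedMap_single_ne_zero {ι : Type*} [Fintype ι] (v : logSpace K) (ω : ι → K) {i : ι}
    (h : ω i ≠ 0) : twistedMap v ω (Pi.single i 1) ≠ 0 := by
  intro h0
  have := congrArg (fun x ↦ x.ofLp (Classical.arbitrary (K →+* ℂ))) h0
  simp [twistedMap, Pi.single_apply, apply_ite, h] at this

end RayGauss

noncomputable section RayGaussAsymptotic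

open Real MeasureTheory NumberField.InfinitePlace NumberField.Units
  NumberField.Units.dirichletUnitTheorem
open scoped ENNReal Classical

variable {K : Type*} [Field K] [NumberField K]

variable (K) in
/-- Residues of units modulo `m`. -/
def unitResidueClasses (m : ℕ) : Set (𝓞 K ⧸ Ideal.span {(m : 𝓞 K)}) :=
  Set.range fun u : (𝓞 K)ˣ ↦ Ideal.Quotient.mk _ (u : 𝓞 K)

theorem finite_quotient_span_natCast {m : ℕ} (hm : m ≠ 0) :
    Finite (𝓞 K ⧸ Ideal.span {(m : 𝓞 K)}) :=
  Ideal.finiteQuotientOfFreeOfNeBot _ (by simpa using hm)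

omit [NumberField K] in
theorem mk_eq_mk_iff_dvd {m : ℕ} {α β : 𝓞 K} :
    Ideal.Quotient.mk (Ideal.span {(m : 𝓞 K)}) α = Ideal.Quotient.mk _ β ↔ (m : 𝓞 K) ∣ α - β := by
  rw [Ideal.Quotient.eq, Ideal.mem_span_singleton]

omit [NumberField K] in
theorem exists_mem_mk_eq {m : ℕ} {J : Ideal (𝓞 K)} (hJ : IsCoprime J (Ideal.span {(m : 𝓞 K)}))
    (ε : 𝓞 K ⧸ Ideal.span {(m : 𝓞 K)}) : ∃ α ∈ J, Ideal.Quotient.mk _ α = ε := by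
  obtain ⟨x, rfl⟩ := Ideal.Quotient.mk_surjective ε
  obtain ⟨i, hi, j, hj, h⟩ := Ideal.isCoprime_iff_exists.mp hJ
  refine ⟨x * i, Ideal.mul_mem_left _ _ hi, ?_⟩
  rw [Ideal.Quotient.eq, show x * i - x = -(x * j) by linear_combination x * h, neg_mem_iff]
  exact Ideal.mul_mem_left _ _ hj

theorem exists_tsum_unitResidues_eq {m : ℕ} (hm : 2 ≤ m) {J : Ideal (𝓞 K)}
    (hJ : IsCoprime J (Ideal.span {(m : 𝓞 K)})) {ι : Type*} [Fintype ι] (ω : Module.Basis ι ℤ J) :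
    ∃ y : unitResidueClasses K m → ι → ℝ, ∀ (τ : ℝ) (v : logSpace K),
      ∑' α : unitResidues m J, twistedGauss τ v (α : 𝓞 K) =
        ∑' ε, latticeGaussSum ((τ * m) • twistedMap v fun i ↦ ((ω i : 𝓞 K) : K)) (y ε) := by
  have hm0 : (m : 𝓞 K) ≠ 0 := by
    have : m ≠ 0 := by omega
    exact_mod_cast this
  choose a haJ ha using fun ε : unitResidueClasses K m ↦ exists_mem_mk_eq hJ ε.1
  have hsum (k : ι → ℤ) : ((∑ i, k i • ω i : J) : 𝓞 K) = ∑ i, k i • (ω i : 𝓞 K) := by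
    simp
  have hmem (ε : unitResidueClasses K m) (l : J) : a ε + m * (l : 𝓞 K) ∈ unitResidues m J := by
    refine ⟨J.add_mem (haJ ε) (Ideal.mul_mem_left _ _ l.2), ?_⟩
    obtain ⟨u, hu⟩ := ε.2
    refine ⟨u, ?_⟩
    have : (m : 𝓞 K) ∣ a ε - u := by rw [← mk_eq_mk_iff_dvd, ha ε]; exact hu.symm
    rw [add_sub_right_comm]
    exact dvd_add this (dvd_mul_right _ _)
  let F : unitResidueClasses K m × J → unitResidues m J := fun x ↦ ⟨_, hmem x.1 x.2⟩
  have hF : Function.Bijective F := by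
    constructor
    · rintro ⟨ε, l⟩ ⟨ε', l'⟩ h
      replace h : a ε + m * (l : 𝓞 K) = a ε' + m * (l' : 𝓞 K) := congrArg Subtype.val h
      have h1 : ε = ε' := by
        ext
        rw [← ha ε, ← ha ε', mk_eq_mk_iff_dvd]
        exact ⟨l' - l, by linear_combination h⟩
      subst h1
      have h2 := mul_left_cancel₀ hm0 (add_left_cancel h)
      rw [Subtype.ext h2]
    · rintro ⟨α, hα, u, hu⟩
      let ε : unitResidueClasses K m := ⟨Ideal.Quotient.mk _ α, u, (mk_eq_mk_iff_dvd.mpr hu).symm⟩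
      have h1 : α - a ε ∈ J * Ideal.span {(m : 𝓞 K)} := by
        rw [Ideal.mul_eq_inf_of_isCoprime hJ]
        refine ⟨J.sub_mem hα (haJ ε), ?_⟩
        exact Ideal.mem_span_singleton.mpr (mk_eq_mk_iff_dvd.mp (ha ε).symm)
      rw [mul_comm, Ideal.mem_span_singleton_mul] at h1
      obtain ⟨l, hl, h2⟩ := h1
      refine ⟨⟨ε, l, hl⟩, Subtype.ext ?_⟩
      change a ε + m * l = α
      rw [h2]
      ring
  refine ⟨fun ε i ↦ (ω.repr ⟨a ε, haJ ε⟩ i : ℝ) / m, fun τ v ↦ ?_⟩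
  rw [← (Equiv.ofBijective F hF).tsum_eq, ENNReal.tsum_prod']
  refine tsum_congr fun ε ↦ ?_
  rw [← ω.equivFun.symm.toEquiv.tsum_eq, latticeGaussSum]
  refine tsum_congr fun k ↦ ?_
  have hQ : (fun i ↦ (k i : ℝ) + (ω.repr ⟨a ε, haJ ε⟩ i : ℝ) / m) =
      fun i ↦ ((k i + (ω.repr ⟨a ε, haJ ε⟩ i : ℚ) / m : ℚ) : ℝ) := by
    ext i; push_cast; rfl
  have hm0' : (m : K) ≠ 0 := by
    have : m ≠ 0 := by omega
    exact_mod_cast this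
  have hα : ((a ε + m * ((ω.equivFun.symm k : J) : 𝓞 K) : 𝓞 K) : K) =
      m * ∑ i, (k i + (ω.repr ⟨a ε, haJ ε⟩ i : ℚ) / m) • ((ω i : 𝓞 K) : K) := by
    have h3 : ((a ε : 𝓞 K) : K) = ∑ i, (ω.repr ⟨a ε, haJ ε⟩ i : ℤ) • ((ω i : 𝓞 K) : K) := by
      have := congrArg (fun x : J ↦ ((x : 𝓞 K) : K)) (ω.sum_repr ⟨a ε, haJ ε⟩)
      simp only [hsum, map_sum, map_zsmul] at this
      exact this.symm
    rw [Module.Basis.equivFun_symm_apply, hsum]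
    change algebraMap (𝓞 K) K _ = _
    rw [map_add, map_mul, map_sum, map_natCast,
      show algebraMap (𝓞 K) K (a ε) = _ from h3, Finset.mul_sum, Finset.mul_sum, ← Finset.sum_add_distrib]
    refine Finset.sum_congr rfl fun i _ ↦ ?_
    rw [map_zsmul, zsmul_eq_mul, zsmul_eq_mul, Rat.smul_def,
      show algebraMap (𝓞 K) K (ω i) = ((ω i : 𝓞 K) : K) from rfl]
    push_cast
    field_simp
    ring
  have hmn (v : logSpace K) (x : K) : twistedNorm v (m * x) = (m : ℝ) ^ 2 * twistedNorm v x := by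
    unfold twistedNorm
    rw [Finset.mul_sum]
    refine Finset.sum_congr rfl fun φ _ ↦ ?_
    simp
    ring
  have e : ((Equiv.ofBijective F hF (ε, ω.equivFun.symm.toEquiv k) : unitResidues m J) : 𝓞 K) =
    a ε + m * ((ω.equivFun.symm k : J) : 𝓞 K) := rfl
  rw [e, hα, twistedGauss, gaussWeight, hmn, hQ, LinearMap.smul_apply, norm_smul, mul_pow,
    norm_twistedMap_sq, Real.norm_eq_abs, sq_abs]
  congr 3
  ring

theorem twistedMap_eq_comp {ι : Type*} [Fintype ι] (v : logSpace K) (b : Module.Basis ι ℤ (𝓞 K))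
    (x : ι → 𝓞 K) : twistedMap v (fun i ↦ (x i : K)) = twistedMap v (fun i ↦ (b i : K)) ∘ₗ
      Matrix.toLin' ((b.toMatrix x).map (Int.cast : ℤ → ℝ)) := by
  refine LinearMap.ext fun z ↦ ?_
  ext φ
  simp only [twistedMap, LinearMap.coe_mk, AddHom.coe_mk, LinearMap.comp_apply, Matrix.toLin'_apply,
    Matrix.mulVec, dotProduct, Matrix.map_apply, Module.Basis.toMatrix_apply]
  congr 1
  simp_rw [Complex.ofReal_sum, Finset.sum_mul]
  rw [Finset.sum_comm]
  refine Finset.sum_congr rfl fun i _ ↦ ?_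
  have : φ (x i : K) = ∑ j, ((b.repr (x i) j : ℤ) : ℂ) * φ (b j : K) := by
    conv_lhs => rw [← b.sum_repr (x i)]
    simp
  rw [this, Finset.mul_sum]
  refine Finset.sum_congr rfl fun j _ ↦ ?_
  push_cast
  ring

theorem gaussIntegral_twistedMap_ideal {ι : Type*} [Fintype ι] (v : logSpace K)
    (b : Module.Basis ι ℤ (𝓞 K)) {J : Ideal (𝓞 K)} (hJ : J ≠ ⊥) (ω : Module.Basis ι ℤ J) :
    gaussIntegral (twistedMap v fun i ↦ ((ω i : 𝓞 K) : K)) =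
      .ofReal (Ideal.absNorm J : ℝ)⁻¹ * gaussIntegral (twistedMap v fun i ↦ (b i : K)) := by
  have hd : |LinearMap.det (Matrix.toLin' ((b.toMatrix fun i ↦ (ω i : 𝓞 K)).map
      (Int.cast : ℤ → ℝ)))| = Ideal.absNorm J := by
    rw [LinearMap.det_toLin', ← Ideal.natAbs_det_basis_change b J ω, Module.Basis.det_apply,
      Nat.cast_natAbs]
    have := (Int.castRingHom ℝ).map_det (b.toMatrix fun i ↦ (ω i : 𝓞 K))
    simp only [Int.coe_castRingHom, RingHom.mapMatrix_apply] at this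
    rw [← this, Int.cast_abs]
    rfl
  have hN : (Ideal.absNorm J : ℝ) ≠ 0 := by
    simpa [Ideal.absNorm_eq_zero_iff] using hJ
  rw [twistedMap_eq_comp v b, gaussIntegral_comp, abs_inv, hd]
  intro h
  rw [h, abs_zero] at hd
  exact hN hd.symm

theorem exists_norm_twistedMap_single_le {ι : Type*} [Fintype ι] (ω : ι → K) :
    ∃ B > 0, ∀ v ∈ unitDomain K, ∀ i, ‖twistedMap v ω (Pi.single i 1)‖ ^ 2 ≤ B := by
  have hb : Bornology.IsBounded (unitDomain K) := ZSpan.fundamentalDomain_isBounded _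
  have hc : Continuous fun v ↦ ∑ i, twistedNorm v (ω i) :=
    continuous_finsetSum _ fun i _ ↦ continuous_twistedNorm (ω i)
  obtain ⟨B, hB⟩ := (hb.isCompact_closure.image hc).bddAbove
  refine ⟨max B 1, by positivity, fun v hv i ↦ le_max_of_le_left ?_⟩
  have h1 : ‖twistedMap v ω (Pi.single i 1)‖ ^ 2 = twistedNorm v (ω i) := by
    have := norm_twistedMap_sq v ω (Pi.single i 1)
    have e : (fun j ↦ (((Pi.single i 1 : ι → ℚ) j : ℚ) : ℝ)) = Pi.single i 1 := by
      ext j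
      simp [Pi.single_apply, apply_ite]
    rw [e] at this
    simpa [Pi.single_apply, ite_smul] using this
  rw [h1]
  refine le_trans ?_ (hB ⟨v, subset_closure hv, rfl⟩)
  refine Finset.single_le_sum (f := fun i ↦ twistedNorm v (ω i)) (fun j _ ↦ ?_) (Finset.mem_univ i)
  exact Finset.sum_nonneg fun φ _ ↦ by positivity

theorem one_add_pow_le {δ : ℝ} (h0 : 0 ≤ δ) (h1 : δ ≤ 1) (n : ℕ) :
    (1 + δ) ^ n ≤ 1 + 2 ^ n * δ := by
  suffices (1 + δ) ^ n ≤ 1 + (2 ^ n - 1) * δ by nlinarith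
  induction n with
  | zero => simp
  | succ n ih =>
    have : (1 : ℝ) ≤ 2 ^ n := one_le_pow₀ (by norm_num)
    calc (1 + δ) ^ (n + 1) ≤ (1 + (2 ^ n - 1) * δ) * (1 + δ) := by rw [pow_succ]; gcongr
      _ ≤ _ := by rw [pow_succ]; nlinarith [mul_nonneg (sub_nonneg.mpr this) h0]

end RayGaussAsymptotic

noncomputable section RayGaussMainTerm

open Real MeasureTheory NumberField.InfinitePlace NumberField.Units
  NumberField.Units.dirichletUnitTheorem
open scoped ENNReal Classical

variable {K : Type*} [Field K] [NumberField K]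

theorem lintegral_tsum_unitResidues {m : ℕ} (hm : 2 ≤ m) {J : Ideal (𝓞 K)} (hJ : J ≠ ⊥) {τ : ℝ}
    (hτ : 0 < τ) : ∫⁻ v in unitDomain K, ∑' α : unitResidues m J, twistedGauss τ v (α : 𝓞 K) =
      torsionOrder K * rayGauss m J (τ ^ Module.finrank ℚ K * Ideal.absNorm J) := by
  have : Countable (𝓞 K) := (RingOfIntegers.basis K).equivFun.toEquiv.countable_iff.mpr inferInstance
  rw [← tsum_unitResidues hm hJ hτ, lintegral_tsum]
  exact fun α ↦ (continuous_twistedGauss τ _).measurable.aemeasurable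

variable (K) in
/-- The main term of `rayGauss`. -/
def rayResidue (m : ℕ) : ℝ≥0∞ :=
  (torsionOrder K : ℝ≥0∞)⁻¹ * .ofReal (m ^ Module.finrank ℚ K : ℝ)⁻¹ *
    ∫⁻ v in unitDomain K, ∑' _ : unitResidueClasses K m,
      gaussIntegral (twistedMap v fun i ↦ ((RingOfIntegers.basis K i : 𝓞 K) : K))

theorem lintegral_unitDomain_le {m : ℕ} {R : ℝ≥0∞} (hR : R ≠ ⊤)
    {f g : logSpace K → unitResidueClasses K m → ℝ≥0∞} (h : ∀ v ∈ unitDomain K, ∀ ε, f v ε ≤ R * g v ε) :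
    ∫⁻ v in unitDomain K, ∑' ε, f v ε ≤ R * ∫⁻ v in unitDomain K, ∑' ε, g v ε := by
  rw [← lintegral_const_mul' _ _ hR]
  refine setLIntegral_mono' (ZSpan.fundamentalDomain_measurableSet _) fun v hv ↦ ?_
  rw [← ENNReal.tsum_mul_left]
  exact ENNReal.tsum_le_tsum fun ε ↦ h v hv ε

theorem rayGauss_mul_le {m : ℕ} (hm : 2 ≤ m) {J : Ideal (𝓞 K)} (hJ0 : J ≠ ⊥)
    (hJ : IsCoprime J (Ideal.span {(m : 𝓞 K)})) : ∃ B > 0, ∃ t₀ > 0, ∀ t, 0 < t → t ≤ t₀ →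
      rayGauss m J t * .ofReal t ≤ .ofReal (1 + B * t ^ 4) * rayResidue K m ∧
        rayResidue K m ≤ .ofReal (1 + B * t ^ 4) * (rayGauss m J t * .ofReal t) := by
  set n := Module.finrank ℚ K with hn
  have hn0 : n ≠ 0 := Module.finrank_pos.ne'
  have hcard : Fintype.card (Module.Free.ChooseBasisIndex ℤ (𝓞 K)) = n := by
    rw [← Module.finrank_eq_card_basis (RingOfIntegers.basis K), hn, RingOfIntegers.rank]
  set ω := Ideal.selfBasis (RingOfIntegers.basis K) J hJ0
  obtain ⟨y, hy⟩ := exists_tsum_unitResidues_eq hm hJ ω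
  obtain ⟨C, hC, hCk⟩ := exists_tsum_exp_le_mul (2 * n) (by omega)
  obtain ⟨B₀, hB₀, hB⟩ := exists_norm_twistedMap_single_le fun i ↦ ((ω i : 𝓞 K) : K)
  have hNJ : (0 : ℝ) < Ideal.absNorm J := by
    have : Ideal.absNorm J ≠ 0 := by simpa [Ideal.absNorm_eq_zero_iff] using hJ0
    positivity
  have hm0 : (0 : ℝ) < m := by positivity
  set A := C * (m ^ 2 * B₀) ^ (2 * n) / (Ideal.absNorm J : ℝ) ^ 4 with hA
  have hA0 : 0 < A := by positivity
  refine ⟨2 ^ n * A, by positivity, min 1 (1 / A), by positivity, fun t ht htt ↦ ?_⟩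
  have hδ1 : A * t ^ 4 ≤ 1 := by
    have h1 : t ^ 4 ≤ t := by
      have := pow_le_pow_of_le_one ht.le (htt.trans (min_le_left _ _)) (show 1 ≤ 4 by norm_num)
      simpa using this
    calc A * t ^ 4 ≤ A * (1 / A) := by gcongr; exact h1.trans (htt.trans (min_le_right _ _))
      _ = 1 := by field_simp
  set τ := (t / Ideal.absNorm J) ^ (1 / (n : ℝ)) with hτ
  have hτ0 : 0 < τ := by positivity
  have hτn : τ ^ n = t / Ideal.absNorm J := by
    rw [hτ, ← rpow_natCast, ← rpow_mul (by positivity), one_div, inv_mul_cancel₀ (by positivity),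
      rpow_one]
  have hδ : C * ((τ * m) ^ 2 * B₀) ^ (2 * n) = A * t ^ 4 := by
    have : ((τ * m) ^ 2 * B₀) ^ (2 * n) = (τ ^ n) ^ 4 * (m ^ 2 * B₀) ^ (2 * n) := by
      rw [mul_pow τ, mul_assoc, mul_pow (τ ^ 2), ← pow_mul, ← pow_mul]
      ring_nf
    rw [this, hτn, hA]
    field_simp
  set R : ℝ≥0∞ := .ofReal (1 + A * t ^ 4) ^ n with hR
  have hRle : R ≤ .ofReal (1 + 2 ^ n * A * t ^ 4) := by
    rw [hR, ← ENNReal.ofReal_pow (by positivity), mul_assoc]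
    exact ENNReal.ofReal_le_ofReal (one_add_pow_le (by positivity) hδ1 n)
  have hRtop : R ≠ ⊤ := by rw [hR]; exact ENNReal.pow_ne_top ENNReal.ofReal_ne_top
  have key (v) (hv : v ∈ unitDomain K) (ε) :
      latticeGaussSum ((τ * m) • twistedMap v fun i ↦ ((ω i : 𝓞 K) : K)) (y ε) ≤
        R * (gaussIntegral ((τ * m) • twistedMap v fun i ↦ ((ω i : 𝓞 K) : K))) ∧
      gaussIntegral ((τ * m) • twistedMap v fun i ↦ ((ω i : 𝓞 K) : K)) ≤
        R * latticeGaussSum ((τ * m) • twistedMap v fun i ↦ ((ω i : 𝓞 K) : K)) (y ε) := by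
    refine latticeGaussSum_le_gaussIntegral (fun z z' ↦ ?_) (y ε)
    rw [hR, ← hcard]
    refine latticeGaussSum_le hC hCk hδ1 (fun i ↦ ?_) (fun i ↦ ?_) z z'
    · rw [LinearMap.smul_apply]
      refine smul_ne_zero (by positivity) (twistedMap_single_ne_zero v _ ?_)
      simpa using ω.ne_zero i
    · rw [← hδ, LinearMap.smul_apply, norm_smul, mul_pow, Real.norm_eq_abs, sq_abs]
      gcongr
      exact hB v hv i
  have hgi (v : logSpace K) : gaussIntegral ((τ * m) • twistedMap v fun i ↦ ((ω i : 𝓞 K) : K)) =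
      .ofReal (m ^ n * t)⁻¹ *
        gaussIntegral (twistedMap v fun i ↦ ((RingOfIntegers.basis K i : 𝓞 K) : K)) := by
    rw [gaussIntegral_smul _ (by positivity), gaussIntegral_twistedMap_ideal v
      (RingOfIntegers.basis K) hJ0 ω, ← mul_assoc, ← ENNReal.ofReal_mul (by positivity), hcard,
      mul_pow, hτn]
    congr 2
    field_simp
  have hG : torsionOrder K * rayGauss m J t = ∫⁻ v in unitDomain K,
      ∑' ε, latticeGaussSum ((τ * m) • twistedMap v fun i ↦ ((ω i : 𝓞 K) : K)) (y ε) := by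
    have := lintegral_tsum_unitResidues hm hJ0 hτ0
    rw [← hn, hτn, div_mul_cancel₀ _ hNJ.ne'] at this
    rw [← this]
    exact lintegral_congr fun v ↦ hy τ v
  set I := ∫⁻ v in unitDomain K, ∑' _ : unitResidueClasses K m,
      gaussIntegral (twistedMap v fun i ↦ ((RingOfIntegers.basis K i : 𝓞 K) : K)) with hI
  have hGI : ∫⁻ v in unitDomain K, ∑' _ : unitResidueClasses K m,
      gaussIntegral ((τ * m) • twistedMap v fun i ↦ ((ω i : 𝓞 K) : K)) =
        .ofReal (m ^ n * t)⁻¹ * I := by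
    rw [hI, ← lintegral_const_mul' _ _ ENNReal.ofReal_ne_top]
    refine lintegral_congr fun v ↦ ?_
    simp_rw [hgi, ENNReal.tsum_mul_left]
  have hw : (torsionOrder K : ℝ≥0∞) ≠ 0 := by
    exact_mod_cast torsionOrder_ne_zero K
  have hw' : (torsionOrder K : ℝ≥0∞) ≠ ⊤ := ENNReal.natCast_ne_top _
  have hGt : rayGauss m J t * .ofReal t =
      (torsionOrder K : ℝ≥0∞)⁻¹ * .ofReal t * (torsionOrder K * rayGauss m J t) := by
    rw [mul_mul_mul_comm, ENNReal.inv_mul_cancel hw hw', one_mul, mul_comm]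
  have hκ : rayResidue K m =
      (torsionOrder K : ℝ≥0∞)⁻¹ * .ofReal t * (.ofReal (m ^ n * t)⁻¹ * I) := by
    rw [rayResidue, ← mul_assoc, mul_assoc _ (ENNReal.ofReal t), ← ENNReal.ofReal_mul ht.le]
    congr 3
    field_simp
    rfl
  constructor
  · rw [hGt, hκ, mul_left_comm (ENNReal.ofReal (1 + _))]
    gcongr _ * ?_
    rw [hG, ← hGI]
    refine (lintegral_unitDomain_le hRtop fun v hv ε ↦ (key v hv ε).1).trans ?_
    gcongr
  · rw [hGt, hκ, mul_left_comm (ENNReal.ofReal (1 + _))]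
    gcongr _ * ?_
    rw [hG, ← hGI]
    refine (lintegral_unitDomain_le hRtop fun v hv ε ↦ (key v hv ε).2).trans ?_
    gcongr

end RayGaussMainTerm

noncomputable section AbsNormSummable

open Filter Ideal Asymptotics Topology nonZeroDivisors

variable (K : Type*) [Field K] [NumberField K]

theorem sum_card_absNorm_isBigO :
    (fun n : ℕ ↦ ∑ k ∈ Finset.Icc 1 n, (Nat.card {I : Ideal (𝓞 K) // absNorm I = k} : ℝ))
      =O[atTop] fun n ↦ (n : ℝ) ^ (1 : ℝ) := by
  have h := ((Ideal.tendsto_norm_le_div_atTop₀ K).comp tendsto_natCast_atTop_atTop).isBigO_one ℝ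
  have h2 := h.mul (isBigO_refl (fun n : ℕ ↦ (n : ℝ)) atTop)
  refine (h2.congr' ?_ ?_)
  · filter_upwards [eventually_gt_atTop 0] with n hn
    have hn' : (n : ℝ) ≠ 0 := by positivity
    simp only [Function.comp_apply, Nat.cast_le, ← Nat.cast_sum]
    rw [div_mul_cancel₀ _ hn']
    congr
    rw [← add_left_inj 1, ← card_norm_le_eq_card_norm_le_add_one,
      show Finset.Icc 1 n = Finset.Ioc 0 n from Finset.Icc_succ_left_eq_Ioc _ _,
      show 1 = Nat.card {I : Ideal (𝓞 K) // absNorm I = 0} by simp [Ideal.absNorm_eq_zero_iff],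
      Finset.sum_Ioc_add_eq_sum_Icc (n.zero_le),
      ← Finset.card_preimage_eq_sum_card_image_eq (fun k _ ↦ finite_setOfPred_absNorm_eq k)]
    simp [Set.coe_eq_subtype]
  · exact Eventually.of_forall fun n ↦ by simp

variable {K} in
theorem summable_absNorm_rpow {s : ℝ} (hs : 1 < s) :
    Summable fun 𝔞 : Ideal (𝓞 K) ↦ (absNorm 𝔞 : ℝ) ^ (-s) := by
  have h := LSeriesSummable_of_sum_norm_bigO_and_nonneg (sum_card_absNorm_isBigO K)
    (fun _ ↦ by positivity) zero_le_one (s := s) (by simpa using hs)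
  have h0 : ∀ 𝔞 : Ideal (𝓞 K), 0 ≤ (absNorm 𝔞 : ℝ) ^ (-s) := fun 𝔞 ↦ by positivity
  rw [← (Equiv.sigmaFiberEquiv (absNorm : Ideal (𝓞 K) → ℕ)).summable_iff]
  refine (summable_sigma_of_nonneg fun x ↦ h0 _).mpr ⟨fun n ↦ ?_, ?_⟩
  · have : Finite {𝔞 : Ideal (𝓞 K) // absNorm 𝔞 = n} := finite_setOfPred_absNorm_eq n
    exact Summable.of_finite
  · refine (summable_norm_iff.mpr h).congr fun n ↦ ?_
    have : Finite {𝔞 : Ideal (𝓞 K) // absNorm 𝔞 = n} := finite_setOfPred_absNorm_eq n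
    have e : ∀ y : {𝔞 : Ideal (𝓞 K) // absNorm 𝔞 = n},
        (absNorm (Equiv.sigmaFiberEquiv (absNorm : Ideal (𝓞 K) → ℕ) ⟨n, y⟩) : ℝ) ^ (-s) =
          (n : ℝ) ^ (-s) := fun y ↦ by
      simp [Equiv.sigmaFiberEquiv, y.2]
    rw [tsum_congr e, tsum_const, nsmul_eq_mul]
    rcases eq_or_ne n 0 with rfl | hn
    · simp [Real.zero_rpow (show -s ≠ 0 by linarith)]
    · rw [LSeries.norm_term_eq, if_neg hn]
      simp [Real.rpow_neg, div_eq_mul_inv]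

end AbsNormSummable

noncomputable section RadialGauss

open Real MeasureTheory NumberField.InfinitePlace NumberField.Units
  NumberField.Units.dirichletUnitTheorem
open scoped ENNReal Classical

variable {K : Type*} [Field K] [NumberField K]

theorem exp_norm_div_le_twistedNorm (v : logSpace K) :
    rexp (‖v‖ / Module.finrank ℚ K) ≤ twistedNorm v 1 := by
  set n := Module.finrank ℚ K with hn
  have hn0 : (0 : ℝ) < n := by exact_mod_cast Module.finrank_pos
  obtain ⟨w₁, -, hw₁⟩ := Finset.exists_max_image Finset.univ (fun w : InfinitePlace K ↦ traceZero v w)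
    Finset.univ_nonempty
  set M := traceZero v w₁
  replace hw₁ (w) : traceZero v w ≤ M := hw₁ w (Finset.mem_univ _)
  have hmn : ∑ w : InfinitePlace K, (mult w : ℝ) = n := by
    exact_mod_cast sum_mult_eq
  have hle (w : InfinitePlace K) : (mult w : ℝ) ≤ n := by
    rw [← hmn]
    exact Finset.single_le_sum (f := fun w : InfinitePlace K ↦ (mult w : ℝ))
      (fun _ _ ↦ by positivity) (Finset.mem_univ w)
  have hM : 0 ≤ M := by
    have h := sum_mult_mul_traceZero v
    by_contra! hlt
    have : ∑ w : InfinitePlace K, mult w * traceZero v w < 0 :=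
      Finset.sum_neg (fun w _ ↦ mul_neg_of_pos_of_neg
        (by exact_mod_cast mult_pos) ((hw₁ w).trans_lt hlt)) Finset.univ_nonempty
    linarith
  have key : ‖v‖ ≤ n * M := by
    refine (pi_norm_le_iff_of_nonneg (by positivity)).mpr fun i ↦ ?_
    have hv : v i = mult i.1 * traceZero v i.1 := by
      rw [traceZero, dif_neg i.2, mul_div_cancel₀]
      exact_mod_cast mult_ne_zero
    rw [Real.norm_eq_abs, abs_le]
    constructor
    · have h := sum_mult_mul_traceZero v
      rw [← Finset.add_sum_erase _ _ (Finset.mem_univ i.1), ← hv] at h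
      have h2 : ∑ w ∈ Finset.univ.erase i.1, mult w * traceZero v w ≤
          ∑ w ∈ Finset.univ.erase i.1, mult w * M := by
        gcongr with w
        exact hw₁ w
      have h3 : ∑ w ∈ Finset.univ.erase i.1, mult w * M ≤ n * M := by
        rw [← hmn, Finset.sum_mul]
        exact Finset.sum_le_sum_of_subset_of_nonneg (Finset.erase_subset _ _)
          fun _ _ _ ↦ by positivity
      linarith
    · rw [hv]
      calc (mult i.1 : ℝ) * traceZero v i.1 ≤ mult i.1 * M := by gcongr; exact hw₁ _
        _ ≤ n * M := by gcongr; exact_mod_cast hle _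
  calc rexp (‖v‖ / n) ≤ rexp M := by
        gcongr
        rw [div_le_iff₀ hn0]
        linarith
    _ ≤ (rexp (traceZero v (mk w₁.embedding)) * ‖w₁.embedding 1‖) ^ 2 := by
        rw [mk_embedding, map_one, norm_one, mul_one, ← exp_nat_mul]
        gcongr
        push_cast
        linarith
    _ ≤ twistedNorm v 1 := Finset.single_le_sum
        (f := fun φ : K →+* ℂ ↦ (rexp (traceZero v (mk φ)) * ‖φ 1‖) ^ 2)
        (fun _ _ ↦ by positivity) (Finset.mem_univ _)

theorem radialGauss_antitone {y z : ℝ} (hy : 0 ≤ y) (h : y ≤ z) :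
    radialGauss K z ≤ radialGauss K y := by
  unfold radialGauss twistedGauss
  refine lintegral_mono fun v ↦ ENNReal.ofReal_le_ofReal (Real.exp_le_exp.mpr ?_)
  rw [neg_mul, neg_mul, neg_le_neg_iff]
  have : 0 ≤ twistedNorm v 1 := (Real.exp_pos _).le.trans (exp_norm_div_le_twistedNorm v)
  gcongr

theorem radialGauss_pos (y : ℝ) : 0 < radialGauss K y := by
  rw [radialGauss, pos_iff_ne_zero, Ne, lintegral_eq_zero_iff
    (continuous_twistedGauss _ _).measurable]
  intro h
  have : ∀ v : logSpace K, twistedGauss (y ^ (1 / (Module.finrank ℚ K : ℝ))) v 1 ≠ 0 := fun v ↦ by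
    simp [twistedGauss, Real.exp_pos]
  have h2 : ∀ᵐ v : logSpace K, False := by
    filter_upwards [h] with v hv using this v hv
  exact (Filter.Eventually.exists h2).elim fun _ ↦ id

theorem exp_neg_le_rpow {p : ℝ} (hp : 0 < p) : ∃ C > 0, ∀ z > 0, rexp (-z) ≤ C * z ^ (-p) := by
  obtain ⟨k, hk⟩ := exists_nat_ge p
  refine ⟨k.factorial, by positivity, fun z hz ↦ ?_⟩
  have h1 : (1 : ℝ) ≤ k.factorial := by exact_mod_cast Nat.factorial_pos k
  rcases le_total z 1 with h | h
  · calc rexp (-z) ≤ 1 * 1 := by simpa using hz.le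
      _ ≤ _ := by
        gcongr
        exact one_le_rpow_of_pos_of_le_one_of_nonpos hz h (by linarith)
  · refine (exp_neg_le_factorial_div hz k).trans ?_
    rw [div_eq_mul_inv, ← rpow_natCast, ← rpow_neg hz.le]
    gcongr

theorem radialGauss_le_rpow {p : ℝ} (hp : 0 < p) : ∃ C > 0, ∀ y > 0,
    radialGauss K y ≤ .ofReal (C * y ^ (-p)) := by
  set n := Module.finrank ℚ K with hn
  have hn0 : (0 : ℝ) < n := by exact_mod_cast Module.finrank_pos
  set q := p * n / 2 with hq
  have hq0 : 0 < q := by positivity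
  obtain ⟨C, hC, hCz⟩ := exp_neg_le_rpow hq0
  set d : ℝ := Module.finrank ℝ (logSpace K) + 1
  have hd : (0 : ℝ) < d := by positivity
  obtain ⟨D, hD, hDz⟩ := exp_neg_le_rpow hd
  set A := (q / n)
  have hA : 0 < A := by positivity
  -- pointwise bound on the inverse power of the norm
  have hS (v : logSpace K) : twistedNorm v 1 ^ (-q) ≤ D * rexp A * A ^ (-d) * (1 + ‖v‖) ^ (-d) := by
    have h1 : twistedNorm v 1 ^ (-q) ≤ rexp (‖v‖ / n) ^ (-q) :=
      rpow_le_rpow_of_nonpos (Real.exp_pos _) (exp_norm_div_le_twistedNorm v) (by linarith)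
    have h2 : rexp (‖v‖ / n) ^ (-q) = rexp A * rexp (-(A * (1 + ‖v‖))) := by
      rw [← exp_mul, ← exp_add]
      congr 1
      simp only [A]
      field_simp
      ring
    have h3 := hDz (A * (1 + ‖v‖)) (by positivity)
    rw [mul_rpow hA.le (by positivity)] at h3
    rw [h2] at h1
    refine h1.trans ?_
    calc _ ≤ rexp A * (D * (A ^ (-d) * (1 + ‖v‖) ^ (-d))) := by gcongr
      _ = _ := by ring
  have hint : Integrable (fun v : logSpace K ↦ (1 + ‖v‖) ^ (-d)) :=
    integrable_one_add_norm (by simp [d])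
  set I := ∫ v : logSpace K, (1 + ‖v‖) ^ (-d) with hI
  have hI0 : 0 ≤ I := integral_nonneg fun v ↦ by positivity
  refine ⟨C * π ^ (-q) * (D * rexp A * A ^ (-d)) * (I + 1), by positivity, fun y hy ↦ ?_⟩
  have hpt (v : logSpace K) : twistedGauss (y ^ (1 / (n : ℝ))) v 1 ≤
      .ofReal (C * π ^ (-q) * (D * rexp A * A ^ (-d)) * y ^ (-p) * (1 + ‖v‖) ^ (-d)) := by
    refine ENNReal.ofReal_le_ofReal ?_
    have hS0 : 0 < twistedNorm v 1 := (Real.exp_pos _).trans_le (exp_norm_div_le_twistedNorm v)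
    rw [neg_mul]
    refine (hCz _ (by positivity)).trans ?_
    have hy2 : ((y ^ (1 / (n : ℝ))) ^ 2) ^ (-q) = y ^ (-p) := by
      rw [← rpow_natCast, ← rpow_mul hy.le, ← rpow_mul hy.le]
      congr 1
      rw [hq]
      push_cast
      field_simp
    rw [mul_rpow (by positivity) (by positivity), mul_rpow (by positivity) hS0.le, hy2]
    calc _ ≤ C * (π ^ (-q) * (y ^ (-p) * (D * rexp A * A ^ (-d) * (1 + ‖v‖) ^ (-d)))) := by
          gcongr
          exact hS v
      _ = _ := by ring
  calc radialGauss K y ≤ ∫⁻ v : logSpace K,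
        .ofReal (C * π ^ (-q) * (D * rexp A * A ^ (-d)) * y ^ (-p) * (1 + ‖v‖) ^ (-d)) :=
        lintegral_mono hpt
    _ = .ofReal (∫ v : logSpace K,
        C * π ^ (-q) * (D * rexp A * A ^ (-d)) * y ^ (-p) * (1 + ‖v‖) ^ (-d)) :=
        (ofReal_integral_eq_lintegral_ofReal (hint.const_mul _)
          (Filter.Eventually.of_forall fun v ↦ by positivity)).symm
    _ ≤ _ := by
        refine ENNReal.ofReal_le_ofReal ?_
        rw [integral_const_mul, ← hI]
        have : C * π ^ (-q) * (D * rexp A * A ^ (-d)) * (I + 1) * y ^ (-p) =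
          C * π ^ (-q) * (D * rexp A * A ^ (-d)) * y ^ (-p) * (I + 1) := by ring
        rw [this]
        gcongr
        linarith

end RadialGauss

noncomputable section RayGaussBounds

open Real MeasureTheory NumberField.InfinitePlace NumberField.Units
  NumberField.Units.dirichletUnitTheorem
open scoped ENNReal Classical

variable {K : Type*} [Field K] [NumberField K]

theorem radialGauss_ne_top {y : ℝ} (hy : 0 < y) : radialGauss K y ≠ ⊤ := by
  obtain ⟨C, -, hC⟩ := radialGauss_le_rpow (K := K) one_pos
  exact ne_top_of_le_ne_top ENNReal.ofReal_ne_top (hC y hy)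

omit [NumberField K] in
theorem ne_bot_of_mem_rayIdeals {m : ℕ} {J 𝔞 : Ideal (𝓞 K)} (h : 𝔞 ∈ rayIdeals m J) : 𝔞 ≠ ⊥ := by
  rintro rfl
  obtain ⟨α, hα, -, h⟩ := h
  rw [Ideal.bot_mul, eq_comm, Ideal.span_singleton_eq_bot] at h
  exact hα h

theorem absNorm_pos_of_ne_bot {𝔞 : Ideal (𝓞 K)} (h : 𝔞 ≠ ⊥) : (0 : ℝ) < Ideal.absNorm 𝔞 := by
  have : Ideal.absNorm 𝔞 ≠ 0 := by simpa [Ideal.absNorm_eq_zero_iff] using h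
  positivity

theorem rayGauss_le_rpow (m : ℕ) (J : Ideal (𝓞 K)) : ∃ C > 0, ∀ t > 0,
    rayGauss m J t ≤ .ofReal (C * t ^ (-3 : ℝ)) := by
  obtain ⟨C, hC, h⟩ := radialGauss_le_rpow (K := K) (p := 3) (by norm_num)
  have hs := summable_absNorm_rpow (K := K) (s := 3) (by norm_num)
  set I := ∑' 𝔞 : Ideal (𝓞 K), (Ideal.absNorm 𝔞 : ℝ) ^ (-3 : ℝ) with hI
  have hI0 : 0 ≤ I := tsum_nonneg fun _ ↦ by positivity
  refine ⟨C * (I + 1), by positivity, fun t ht ↦ ?_⟩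
  calc rayGauss m J t ≤ ∑' 𝔞 : rayIdeals m J,
        .ofReal (C * t ^ (-3 : ℝ)) * .ofReal ((Ideal.absNorm 𝔞.1 : ℝ) ^ (-3 : ℝ)) := by
        refine ENNReal.tsum_le_tsum fun 𝔞 ↦ ?_
        have h0 := absNorm_pos_of_ne_bot (ne_bot_of_mem_rayIdeals 𝔞.2)
        refine (h _ (by positivity)).trans_eq ?_
        rw [← ENNReal.ofReal_mul (by positivity), mul_rpow ht.le h0.le, mul_assoc]
    _ ≤ ∑' 𝔞 : Ideal (𝓞 K),
        .ofReal (C * t ^ (-3 : ℝ)) * .ofReal ((Ideal.absNorm 𝔞 : ℝ) ^ (-3 : ℝ)) :=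
        ENNReal.tsum_comp_le_tsum_of_injective Subtype.val_injective _
    _ = .ofReal (C * t ^ (-3 : ℝ)) * .ofReal I := by
        rw [ENNReal.tsum_mul_left, hI, ENNReal.ofReal_tsum_of_nonneg (fun _ ↦ by positivity) hs]
    _ ≤ _ := by
        rw [← ENNReal.ofReal_mul (by positivity)]
        refine ENNReal.ofReal_le_ofReal ?_
        rw [mul_right_comm]
        gcongr
        linarith

theorem rayGauss_ne_top (m : ℕ) (J : Ideal (𝓞 K)) {t : ℝ} (ht : 0 < t) : rayGauss m J t ≠ ⊤ := by
  obtain ⟨C, -, hC⟩ := rayGauss_le_rpow m J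
  exact ne_top_of_le_ne_top ENNReal.ofReal_ne_top (hC t ht)

omit [NumberField K] in
theorem isCoprime_top_span (m : ℕ) : IsCoprime (⊤ : Ideal (𝓞 K)) (Ideal.span {(m : 𝓞 K)}) := by
  rw [← Ideal.one_eq_top]
  exact isCoprime_one_left

theorem rayResidue_ne_top {m : ℕ} (hm : 2 ≤ m) : rayResidue K m ≠ ⊤ := by
  obtain ⟨B, hB, t₀, ht₀, h⟩ := rayGauss_mul_le (K := K) hm top_ne_bot (isCoprime_top_span m)
  refine ne_top_of_le_ne_top ?_ (h t₀ ht₀ le_rfl).2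
  exact ENNReal.mul_ne_top ENNReal.ofReal_ne_top
    (ENNReal.mul_ne_top (rayGauss_ne_top _ _ ht₀) ENNReal.ofReal_ne_top)

theorem rayResidue_ne_zero {m : ℕ} (hm : 2 ≤ m) : rayResidue K m ≠ 0 := by
  obtain ⟨B, hB, t₀, ht₀, h⟩ := rayGauss_mul_le (K := K) hm top_ne_bot (isCoprime_top_span m)
  intro h0
  have h1 := (h t₀ ht₀ le_rfl).1
  rw [h0, mul_zero, nonpos_iff_eq_zero, mul_eq_zero, or_iff_left (by simpa using ht₀)] at h1
  have hmem : (⊤ : Ideal (𝓞 K)) ∈ rayIdeals m ⊤ := ⟨1, one_ne_zero, by simp, by simp⟩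
  have h2 : radialGauss K (t₀ * Ideal.absNorm (⊤ : Ideal (𝓞 K))) ≤ rayGauss m ⊤ t₀ :=
    ENNReal.le_tsum (f := fun 𝔞 : rayIdeals m (⊤ : Ideal (𝓞 K)) ↦
      radialGauss K (t₀ * Ideal.absNorm 𝔞.1)) ⟨⊤, hmem⟩
  rw [h1] at h2
  exact (radialGauss_pos _).not_ge h2

theorem rayResidue_toReal_pos {m : ℕ} (hm : 2 ≤ m) : 0 < (rayResidue K m).toReal :=
  ENNReal.toReal_pos (rayResidue_ne_zero hm) (rayResidue_ne_top hm)

theorem exists_rayGauss_toReal_le (m : ℕ) (J : Ideal (𝓞 K)) : ∃ C > 0, ∀ t > 0,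
    (rayGauss m J t).toReal ≤ C * t ^ (-3 : ℝ) := by
  obtain ⟨C, hC, h⟩ := rayGauss_le_rpow m J
  exact ⟨C, hC, fun t ht ↦ ENNReal.toReal_le_of_le_ofReal (by positivity) (h t ht)⟩

theorem exists_abs_rayGauss_toReal_sub_le {m : ℕ} (hm : 2 ≤ m) {J : Ideal (𝓞 K)} (hJ0 : J ≠ ⊥)
    (hJ : IsCoprime J (Ideal.span {(m : 𝓞 K)})) : ∃ C > 0, ∀ t > 0, t ≤ 1 →
      |(rayGauss m J t).toReal - (rayResidue K m).toReal / t| ≤ C * t ^ 2 := by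
  obtain ⟨B, hB, t₀, ht₀, h⟩ := rayGauss_mul_le (K := K) hm hJ0 hJ
  obtain ⟨D, hD, hDt⟩ := exists_rayGauss_toReal_le m J
  set κ := (rayResidue K m).toReal
  have hκ : 0 < κ := rayResidue_toReal_pos hm
  refine ⟨B * κ + (D * t₀ ^ (-3 : ℝ) + κ / t₀) * (t₀ ^ 2)⁻¹, by positivity, fun t ht ht1 ↦ ?_⟩
  set g := (rayGauss m J t).toReal with hg
  have hg0 : 0 ≤ g := ENNReal.toReal_nonneg
  rcases le_total t t₀ with htt | htt
  · have h1 : g * t ≤ (1 + B * t ^ 4) * κ := by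
      have := ENNReal.toReal_mono (ENNReal.mul_ne_top ENNReal.ofReal_ne_top (rayResidue_ne_top hm))
        (h t ht htt).1
      rwa [ENNReal.toReal_mul, ENNReal.toReal_mul, ENNReal.toReal_ofReal ht.le,
        ENNReal.toReal_ofReal (by positivity)] at this
    have h2 : κ ≤ (1 + B * t ^ 4) * (g * t) := by
      have := ENNReal.toReal_mono (ENNReal.mul_ne_top ENNReal.ofReal_ne_top
        (ENNReal.mul_ne_top (rayGauss_ne_top _ _ ht) ENNReal.ofReal_ne_top)) (h t ht htt).2
      rwa [ENNReal.toReal_mul, ENNReal.toReal_mul, ENNReal.toReal_ofReal ht.le,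
        ENNReal.toReal_ofReal (by positivity)] at this
    have h3 : |g * t - κ| ≤ B * κ * t ^ 4 := by
      rw [abs_le]
      constructor
      · by_contra! hlt
        have hx : 0 ≤ B * t ^ 4 := by positivity
        nlinarith [mul_nonneg hx hx, mul_nonneg (mul_nonneg hx hx) hκ.le]
      · linarith
    have h4 : g - κ / t = (g * t - κ) / t := by field_simp
    rw [h4, abs_div, abs_of_pos ht, div_le_iff₀ ht]
    have h5 : B * κ * t ^ 4 ≤ B * κ * t ^ 3 := by
      gcongr B * κ * ?_
      exact pow_le_pow_of_le_one ht.le ht1 (by norm_num)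
    have h6 : 0 ≤ (D * t₀ ^ (-3 : ℝ) + κ / t₀) * (t₀ ^ 2)⁻¹ * t ^ 3 := by positivity
    nlinarith
  · have h1 : |g - κ / t| ≤ D * t₀ ^ (-3 : ℝ) + κ / t₀ := by
      have h2 : g ≤ D * t₀ ^ (-3 : ℝ) := (hDt t ht).trans (by
        gcongr ?_ * ?_
        exact rpow_le_rpow_of_nonpos ht₀ htt (by norm_num))
      have h3 : κ / t ≤ κ / t₀ := by gcongr
      have h4 : 0 ≤ κ / t := by positivity
      rw [abs_le]
      constructor <;> nlinarith [show 0 ≤ D * t₀ ^ (-3 : ℝ) by positivity]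
    refine h1.trans ?_
    have h5 : 1 ≤ (t₀ ^ 2)⁻¹ * t ^ 2 := by
      rw [inv_mul_eq_div, one_le_div (by positivity)]
      gcongr
    have h6 : 0 ≤ B * κ * t ^ 2 := by positivity
    calc D * t₀ ^ (-3 : ℝ) + κ / t₀ ≤ (D * t₀ ^ (-3 : ℝ) + κ / t₀) * ((t₀ ^ 2)⁻¹ * t ^ 2) :=
          le_mul_of_one_le_right (by positivity) h5
      _ ≤ _ := by linarith

end RayGaussBounds

noncomputable section MellinTransform

open Real MeasureTheory NumberField.InfinitePlace NumberField.Units NumberField.Units.dirichletUnitTheorem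
open scoped ENNReal Classical

/-- Change of variables for a multiplicative dilation in a Mellin integral. -/
theorem lintegral_comp_mul_mul_rpow {f : ℝ → ℝ≥0∞} (hf : Measurable f) {N : ℝ} (hN : 0 < N) (p : ℝ) :
    ∫⁻ t in Set.Ioi (0 : ℝ), f (t * N) * .ofReal (t ^ p) =
      .ofReal (N ^ (-(p + 1))) * ∫⁻ y in Set.Ioi (0 : ℝ), f y * .ofReal (y ^ p) := by
  have hg : Measurable fun y : ℝ ↦ f y * ENNReal.ofReal (y ^ p) := by fun_prop
  have hmap := Real.map_volume_mul_left hN.ne'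
  have hind : Measurable ((Set.Ioi (0 : ℝ)).indicator fun y : ℝ ↦ f y * ENNReal.ofReal (y ^ p)) :=
    hg.indicator measurableSet_Ioi
  have h1 : ∫⁻ y in Set.Ioi (0 : ℝ), f y * .ofReal (y ^ p) =
      .ofReal N * ∫⁻ t, (Set.Ioi (0 : ℝ)).indicator (fun y : ℝ ↦ f y * ENNReal.ofReal (y ^ p)) (N * t) := by
    rw [← lintegral_map (μ := volume) hind (measurable_const_mul N), hmap, lintegral_smul_measure,
      lintegral_indicator measurableSet_Ioi, smul_eq_mul, ← mul_assoc, abs_of_pos (inv_pos.mpr hN),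
      ← ENNReal.ofReal_mul hN.le, mul_inv_cancel₀ hN.ne', ENNReal.ofReal_one, one_mul]
  have h2 : ∀ t, (Set.Ioi (0 : ℝ)).indicator (fun y : ℝ ↦ f y * ENNReal.ofReal (y ^ p)) (N * t) =
      (Set.Ioi (0 : ℝ)).indicator (fun t : ℝ ↦ .ofReal (N ^ p) * (f (t * N) * ENNReal.ofReal (t ^ p))) t := by
    intro t
    by_cases ht : 0 < t
    · rw [Set.indicator_of_mem (by simpa using mul_pos hN ht), Set.indicator_of_mem (by simpa using ht),
        mul_rpow hN.le ht.le, ENNReal.ofReal_mul (by positivity), mul_comm N t]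
      ring
    · rw [Set.indicator_of_notMem (by simpa using mul_nonpos_of_nonneg_of_nonpos hN.le (not_lt.mp ht)),
        Set.indicator_of_notMem (by simpa using ht)]
  rw [h1, lintegral_congr h2, lintegral_indicator measurableSet_Ioi, lintegral_const_mul _ (by fun_prop),
    ← mul_assoc, ← mul_assoc, ← ENNReal.ofReal_mul (by positivity), ← ENNReal.ofReal_mul (by positivity),
    show N ^ (-(p + 1)) * N * N ^ p = 1 by
      nth_rw 2 [← rpow_one N]
      rw [← rpow_add hN, ← rpow_add hN, show -(p + 1) + 1 + p = 0 by ring, rpow_zero],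
    ENNReal.ofReal_one, one_mul]

/-- The integrable majorant used for Mellin transforms: `t` near `0` and `t⁻²` near `∞`. -/
def mellinMajorant (t : ℝ) : ℝ := if t ≤ 1 then t else t ^ (-2 : ℝ)

theorem integrableOn_mellinMajorant : IntegrableOn mellinMajorant (Set.Ioi 0) := by
  rw [← Set.Ioc_union_Ioi_eq_Ioi zero_le_one]
  refine IntegrableOn.union ?_ ?_
  · refine IntegrableOn.congr_fun (f := fun t ↦ t) ?_ (fun t ht ↦ ?_) measurableSet_Ioc
    · exact (continuous_id.integrableOn_Icc).mono_set Set.Ioc_subset_Icc_self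
    · simp [mellinMajorant, ht.2]
  · refine IntegrableOn.congr_fun (integrableOn_Ioi_rpow_of_lt (a := -2) (by norm_num) one_pos)
      (fun t ht ↦ ?_) measurableSet_Ioi
    simp [mellinMajorant, not_le.mpr (show 1 < t from ht)]

/-- The function `g` with the polar part `κ / t` removed near the origin. -/
def removePole (κ : ℝ) (g : ℝ → ℝ) (t : ℝ) : ℝ := g t - if t ≤ 1 then κ / t else 0

theorem abs_rpow_sub_one_le {t ε : ℝ} (ht : 0 < t) (h0 : 0 ≤ ε) (h1 : ε ≤ 1) :
    |t ^ ε - 1| ≤ ε * if t ≤ 1 then t⁻¹ else t := by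
  have key : ∀ u : ℝ, 1 ≤ u → u ^ ε ≤ 1 + ε * (u - 1) := fun u hu ↦ by
    simpa using rpow_one_add_le_one_add_mul_self (s := u - 1) (by linarith) h0 h1
  split_ifs with h
  · have hu : 1 ≤ t⁻¹ := (one_le_inv₀ ht).mpr h
    have h2 := key _ hu
    have h3 : t ^ ε ≤ 1 := rpow_le_one ht.le h h0
    rw [inv_rpow ht.le] at h2
    have h4 : 0 < t ^ ε := by positivity
    have h5 : t ^ ε * (t ^ ε)⁻¹ = 1 := mul_inv_cancel₀ h4.ne'
    rw [abs_of_nonpos (by linarith)]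
    nlinarith [sq_nonneg (t ^ ε - 1), inv_pos.mpr h4]
  · have h2 := key t (not_le.mp h).le
    have h3 : 1 ≤ t ^ ε := one_le_rpow (not_le.mp h).le h0
    rw [abs_of_nonneg (by linarith)]
    linarith

section removePole

variable {g : ℝ → ℝ} {κ C : ℝ} (hg : Measurable g)
  (h0 : ∀ t, 0 < t → t ≤ 1 → |g t - κ / t| ≤ C * t ^ 2) (h1 : ∀ t, 1 < t → |g t| ≤ C * t ^ (-3 : ℝ))
include hg h0 h1

omit hg in
theorem abs_removePole_mul_le {t : ℝ} (ht : 0 < t) :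
    |removePole κ g t| * (if t ≤ 1 then t⁻¹ else t) ≤ C * mellinMajorant t := by
  unfold removePole mellinMajorant
  split_ifs with h
  · calc _ ≤ C * t ^ 2 * t⁻¹ := by gcongr; exact h0 t ht h
      _ = _ := by field_simp
  · calc _ ≤ C * t ^ (-3 : ℝ) * t := by gcongr; simpa using h1 t (not_le.mp h)
      _ = _ := by
        rw [mul_assoc]
        nth_rw 2 [← rpow_one t]
        rw [← rpow_add ht]
        norm_num

omit h0 h1 in
theorem measurable_removePole : Measurable (removePole κ g) := by
  unfold removePole
  exact hg.sub (Measurable.ite measurableSet_Iic (by fun_prop) (by fun_prop))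

theorem integrableOn_removePole_mul_rpow {p : ℝ} (hp : |p| ≤ 1) :
    IntegrableOn (fun t ↦ removePole κ g t * t ^ p) (Set.Ioi 0) := by
  have hm := measurable_removePole (κ := κ) hg
  refine Integrable.mono' (integrableOn_mellinMajorant.const_mul C) (by fun_prop)
    ((ae_restrict_iff' measurableSet_Ioi).mpr (.of_forall fun t ht ↦ ?_))
  have ht : 0 < t := ht
  refine le_trans ?_ (abs_removePole_mul_le h0 h1 ht)
  rw [norm_mul, norm_eq_abs, norm_eq_abs, abs_of_nonneg (by positivity : 0 ≤ t ^ p)]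
  gcongr
  split_ifs with h
  · rw [← rpow_neg_one]
    exact rpow_le_rpow_of_exponent_ge ht h (abs_le.mp hp).1
  · nth_rw 2 [← rpow_one t]
    exact rpow_le_rpow_of_exponent_le (not_le.mp h).le (abs_le.mp hp).2

theorem integrableOn_removePole : IntegrableOn (removePole κ g) (Set.Ioi 0) := by
  simpa using integrableOn_removePole_mul_rpow (p := 0) hg h0 h1 (by simp)

/-- The Mellin transform of the function with its pole removed is Lipschitz at `s = 1`. -/
theorem abs_integral_removePole_mul_rpow_sub_le {ε : ℝ} (hε0 : 0 ≤ ε) (hε1 : ε ≤ 1) :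
    |(∫ t in Set.Ioi (0 : ℝ), removePole κ g t * t ^ ε) - ∫ t in Set.Ioi (0 : ℝ), removePole κ g t| ≤
      C * (∫ t in Set.Ioi (0 : ℝ), mellinMajorant t) * ε := by
  rw [← integral_sub (integrableOn_removePole_mul_rpow hg h0 h1 (by rwa [abs_of_nonneg hε0]))
    (integrableOn_removePole hg h0 h1), ← integral_const_mul, ← integral_mul_const]
  rw [← norm_eq_abs]
  refine norm_integral_le_of_norm_le ((integrableOn_mellinMajorant.const_mul C).mul_const ε)
    ((ae_restrict_iff' measurableSet_Ioi).mpr (.of_forall fun t ht ↦ ?_))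
  have ht : 0 < t := ht
  calc ‖removePole κ g t * t ^ ε - removePole κ g t‖ = |removePole κ g t| * |t ^ ε - 1| := by
        rw [← abs_mul, norm_eq_abs]; ring_nf
    _ ≤ |removePole κ g t| * (ε * if t ≤ 1 then t⁻¹ else t) := by
        gcongr; exact abs_rpow_sub_one_le ht hε0 hε1
    _ = |removePole κ g t| * (if t ≤ 1 then t⁻¹ else t) * ε := by ring
    _ ≤ _ := mul_le_mul_of_nonneg_right (abs_removePole_mul_le h0 h1 ht) hε0

theorem integrableOn_mul_rpow_and_integral_eq {ε : ℝ} (hε0 : 0 < ε) (hε1 : ε ≤ 1) :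
    IntegrableOn (fun t ↦ g t * t ^ ε) (Set.Ioi 0) ∧ ∫ t in Set.Ioi (0 : ℝ), g t * t ^ ε =
      κ / ε + ∫ t in Set.Ioi (0 : ℝ), removePole κ g t * t ^ ε := by
  have hi := integrableOn_removePole_mul_rpow (κ := κ) (p := ε) hg h0 h1 (by rwa [abs_of_pos hε0])
  have hII : IntervalIntegrable (fun t : ℝ ↦ κ * t ^ (ε - 1)) volume 0 1 :=
    (intervalIntegral.intervalIntegrable_rpow' (by linarith)).const_mul κ
  have hpole : IntegrableOn (fun t : ℝ ↦ (if t ≤ 1 then κ / t else 0) * t ^ ε) (Set.Ioi 0) ∧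
      ∫ t in Set.Ioi (0 : ℝ), (if t ≤ 1 then κ / t else 0) * t ^ ε = κ / ε := by
    have e : ∀ t ∈ Set.Ioi (0 : ℝ), (Set.Ioc (0 : ℝ) 1).indicator (fun t ↦ κ * t ^ (ε - 1)) t =
        (if t ≤ 1 then κ / t else 0) * t ^ ε := fun t ht ↦ by
      have ht : 0 < t := ht
      rw [Set.indicator_apply]
      by_cases h : t ≤ 1
      · rw [if_pos ⟨ht, h⟩, if_pos h, rpow_sub_one ht.ne']; ring
      · rw [if_neg (fun h' ↦ h h'.2), if_neg h, zero_mul]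
    have hind : IntegrableOn ((Set.Ioc (0 : ℝ) 1).indicator (fun t ↦ κ * t ^ (ε - 1))) (Set.Ioi 0) :=
      ((integrable_indicator_iff measurableSet_Ioc).mpr
        ((intervalIntegrable_iff_integrableOn_Ioc_of_le zero_le_one).mp hII)).integrableOn
    refine ⟨hind.congr_fun e measurableSet_Ioi, ?_⟩
    rw [← setIntegral_congr_fun measurableSet_Ioi e, setIntegral_indicator measurableSet_Ioc,
      Set.inter_eq_right.mpr Set.Ioc_subset_Ioi_self, ← intervalIntegral.integral_of_le zero_le_one,
      intervalIntegral.integral_const_mul, integral_rpow (Or.inl (by linarith))]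
    simp [hε0.ne', div_eq_mul_inv]
  have hsum : (fun t ↦ g t * t ^ ε) = fun t ↦ (if t ≤ 1 then κ / t else 0) * t ^ ε +
      removePole κ g t * t ^ ε := by
    ext t; unfold removePole; ring
  rw [hsum]
  exact ⟨hpole.1.add hi, by rw [integral_add hpole.1 hi, hpole.2]⟩

end removePole

variable {K : Type*} [Field K] [NumberField K]

variable (K) in
theorem countable_ideal : Countable (Ideal (𝓞 K)) := by
  rw [← Set.countable_univ_iff]
  have : (Set.univ : Set (Ideal (𝓞 K))) = ⋃ n : ℕ, {I | Ideal.absNorm I = n} := by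
    ext; simp
  rw [this]
  exact Set.countable_iUnion fun n ↦ (Ideal.finite_setOfPred_absNorm_eq n).countable

variable (K) in
theorem measurable_radialGauss : Measurable (radialGauss K) := by
  unfold radialGauss
  refine Measurable.lintegral_prod_right' (f := fun p : ℝ × logSpace K ↦
    twistedGauss (p.1 ^ (1 / (Module.finrank ℚ K : ℝ))) p.2 1) ?_
  unfold twistedGauss
  have := (continuous_twistedNorm (K := K) 1).measurable
  have h2 : Measurable fun p : ℝ × logSpace K ↦ twistedNorm p.2 (1 : K) := this.comp measurable_snd
  have h1 : Measurable fun p : ℝ × logSpace K ↦ p.1 ^ (1 / (Module.finrank ℚ K : ℝ)) :=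
    measurable_fst.pow_const _
  exact ENNReal.measurable_ofReal.comp (by fun_prop)

theorem measurable_rayGauss (m : ℕ) (J : Ideal (𝓞 K)) : Measurable (rayGauss m J) := by
  unfold rayGauss
  have := countable_ideal K
  have := measurable_radialGauss K
  exact Measurable.tsum fun 𝔞 ↦ by fun_prop

variable (K) in
/-- The Mellin transform of the radial test function. -/
def radialMellin (s : ℝ) : ℝ≥0∞ := ∫⁻ y in Set.Ioi (0 : ℝ), radialGauss K y * .ofReal (y ^ (s - 1))

theorem lintegral_rayGauss_mul_rpow (m : ℕ) (J : Ideal (𝓞 K)) (s : ℝ) :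
    ∫⁻ t in Set.Ioi (0 : ℝ), rayGauss m J t * .ofReal (t ^ (s - 1)) =
      radialMellin K s * ∑' 𝔞 : rayIdeals m J, .ofReal ((Ideal.absNorm 𝔞.1 : ℝ) ^ (-s)) := by
  have := countable_ideal K
  have hmeas := measurable_radialGauss K
  unfold rayGauss
  simp_rw [← ENNReal.tsum_mul_right]
  rw [lintegral_tsum fun 𝔞 ↦ (by fun_prop), ← ENNReal.tsum_mul_left]
  refine tsum_congr fun 𝔞 ↦ ?_
  rw [lintegral_comp_mul_mul_rpow hmeas (absNorm_pos_of_ne_bot (ne_bot_of_mem_rayIdeals 𝔞.2)),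
    radialMellin, mul_comm, sub_add_cancel]

theorem radialMellin_ne_top {s : ℝ} (hs : 1 ≤ s) : radialMellin K s ≠ ⊤ := by
  obtain ⟨C, hC0, hC⟩ := radialGauss_le_rpow (K := K) (p := 1 / 2) (by norm_num)
  obtain ⟨D, hD0, hD⟩ := radialGauss_le_rpow (K := K) (p := s + 1) (by linarith)
  unfold radialMellin
  rw [← Set.Ioc_union_Ioi_eq_Ioi zero_le_one, lintegral_union measurableSet_Ioi
    (Set.disjoint_left.mpr fun x hx hx' ↦ not_lt.mpr hx.2 hx')]
  refine ENNReal.add_ne_top.mpr ⟨?_, ?_⟩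
  · refine ne_top_of_le_ne_top ?_ (setLIntegral_mono' (g := fun y ↦ .ofReal (C * y ^ (-(1 / 2) : ℝ)))
      measurableSet_Ioc fun y hy ↦ ?_)
    · have h := ((intervalIntegral.intervalIntegrable_rpow' (a := 0) (b := 1) (r := -(1 / 2))
        (by norm_num)).const_mul C)
      exact ((intervalIntegrable_iff_integrableOn_Ioc_of_le zero_le_one).mp h).lintegral_lt_top.ne
    · calc _ ≤ ENNReal.ofReal (C * y ^ (-(1 / 2) : ℝ)) * 1 := by
            gcongr
            · exact hC y hy.1
            · rw [← ENNReal.ofReal_one]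
              exact ENNReal.ofReal_le_ofReal (rpow_le_one hy.1.le hy.2 (by linarith))
        _ = _ := mul_one _
  · refine ne_top_of_le_ne_top ?_ (setLIntegral_mono' (g := fun y ↦ .ofReal (D * y ^ (-2 : ℝ)))
      measurableSet_Ioi fun y hy ↦ ?_)
    · exact ((integrableOn_Ioi_rpow_of_lt (a := -2) (by norm_num) one_pos).const_mul D).lintegral_lt_top.ne
    · have hy : 0 < y := one_pos.trans hy
      calc _ ≤ ENNReal.ofReal (D * y ^ (-(s + 1))) * .ofReal (y ^ (s - 1)) := by
            gcongr; exact hD y hy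
        _ = _ := by
          rw [← ENNReal.ofReal_mul (by positivity), mul_assoc, ← rpow_add hy]
          ring_nf

theorem exists_le_radialMellin : ∃ c > 0, ∀ s, 1 ≤ s → s ≤ 2 → c ≤ (radialMellin K s).toReal := by
  have h1 := radialGauss_ne_top (K := K) one_pos
  have h0 := radialGauss_pos (K := K) 1
  refine ⟨(radialGauss K 1).toReal / 2, half_pos (ENNReal.toReal_pos h0.ne' h1), fun s hs hs2 ↦ ?_⟩
  rw [← ENNReal.ofReal_le_iff_le_toReal (radialMellin_ne_top hs)]
  have hint : IntegrableOn (fun y : ℝ ↦ y) (Set.Ioc (0 : ℝ) 1) :=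
    continuous_id.integrableOn_Icc.mono_set Set.Ioc_subset_Icc_self
  have hlin := ofReal_integral_eq_lintegral_ofReal hint
    ((ae_restrict_iff' measurableSet_Ioc).mpr (.of_forall fun t ht ↦ ht.1.le))
  calc ENNReal.ofReal ((radialGauss K 1).toReal / 2)
      = radialGauss K 1 * ∫⁻ y in Set.Ioc (0 : ℝ) 1, .ofReal y := by
        rw [← hlin,
          ← intervalIntegral.integral_of_le zero_le_one, div_eq_mul_inv,
          ENNReal.ofReal_mul ENNReal.toReal_nonneg, ENNReal.ofReal_toReal h1]
        norm_num
    _ = ∫⁻ y in Set.Ioc (0 : ℝ) 1, radialGauss K 1 * .ofReal y :=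
        (lintegral_const_mul _ (by fun_prop)).symm
    _ ≤ ∫⁻ y in Set.Ioc (0 : ℝ) 1, radialGauss K y * .ofReal (y ^ (s - 1)) := by
        refine setLIntegral_mono' measurableSet_Ioc fun y hy ↦ ?_
        gcongr
        · exact radialGauss_antitone hy.1.le hy.2
        · nth_rw 1 [← rpow_one y]
          exact rpow_le_rpow_of_exponent_ge hy.1 hy.2 (by linarith)
    _ ≤ _ := lintegral_mono_set Set.Ioc_subset_Ioi_self

variable (K) in
theorem exists_radialMellin_le : ∃ C, ∀ s, 1 ≤ s → s ≤ 2 → (radialMellin K s).toReal ≤ C := by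
  refine ⟨(radialMellin K 1 + radialMellin K 2).toReal, fun s hs hs2 ↦ ?_⟩
  refine ENNReal.toReal_mono (ENNReal.add_ne_top.mpr
    ⟨radialMellin_ne_top le_rfl, radialMellin_ne_top one_le_two⟩) ?_
  have := measurable_radialGauss K
  unfold radialMellin
  rw [← lintegral_add_left (by fun_prop)]
  refine setLIntegral_mono' measurableSet_Ioi fun y hy ↦ ?_
  have hy : 0 < y := hy
  rw [← mul_add, ← ENNReal.ofReal_add (by positivity) (by positivity)]
  gcongr
  rcases le_total y 1 with h | h
  · exact (rpow_le_rpow_of_exponent_ge hy h (by linarith : (1 : ℝ) - 1 ≤ s - 1)).trans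
      (le_add_of_nonneg_right (by positivity))
  · exact (rpow_le_rpow_of_exponent_le h (by linarith : s - 1 ≤ 2 - 1)).trans
      (le_add_of_nonneg_left (by positivity))

/-- The regular part of `rayGauss`. -/
def rayGaussRegular (m : ℕ) (J : Ideal (𝓞 K)) : ℝ → ℝ :=
  removePole (rayResidue K m).toReal fun t ↦ (rayGauss m J t).toReal

/-- The Dirichlet series of the ideals in a ray class. -/
def raySum (m : ℕ) (J : Ideal (𝓞 K)) (s : ℝ) : ℝ :=
  ∑' 𝔞 : rayIdeals m J, (Ideal.absNorm 𝔞.1 : ℝ) ^ (-s)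

theorem exists_rayGauss_bounds {m : ℕ} (hm : 2 ≤ m) {J : Ideal (𝓞 K)} (hJ0 : J ≠ ⊥)
    (hJ : IsCoprime J (Ideal.span {(m : 𝓞 K)})) : ∃ C,
      (∀ t, 0 < t → t ≤ 1 →
        |(rayGauss m J t).toReal - (rayResidue K m).toReal / t| ≤ C * t ^ 2) ∧
      ∀ t, 1 < t → |(rayGauss m J t).toReal| ≤ C * t ^ (-3 : ℝ) := by
  obtain ⟨C, hC0, hC⟩ := exists_rayGauss_toReal_le m J
  obtain ⟨D, hD0, hD⟩ := exists_abs_rayGauss_toReal_sub_le hm hJ0 hJ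
  refine ⟨max C D, fun t ht ht1 ↦ (hD t ht ht1).trans ?_, fun t ht ↦ ?_⟩
  · gcongr; exact le_max_right _ _
  · rw [abs_of_nonneg ENNReal.toReal_nonneg]
    refine (hC t (one_pos.trans ht)).trans ?_
    gcongr; exact le_max_left _ _

theorem integral_rayGauss_mul_rpow (m : ℕ) (J : Ideal (𝓞 K)) {s : ℝ} (hs : 1 < s) :
    ∫ t in Set.Ioi (0 : ℝ), (rayGauss m J t).toReal * t ^ (s - 1) =
      (radialMellin K s).toReal * raySum m J s := by
  have hmeas := measurable_rayGauss m J
  have h := congrArg ENNReal.toReal (lintegral_rayGauss_mul_rpow m J s)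
  have hsum : Summable fun 𝔞 : rayIdeals m J ↦ (Ideal.absNorm 𝔞.1 : ℝ) ^ (-s) :=
    (summable_absNorm_rpow hs).subtype _
  rw [ENNReal.toReal_mul, ← ENNReal.ofReal_tsum_of_nonneg (fun _ ↦ by positivity) hsum,
    ENNReal.toReal_ofReal (tsum_nonneg fun _ ↦ by positivity)] at h
  rw [raySum, ← h, ← integral_toReal (by fun_prop)]
  · refine setIntegral_congr_fun measurableSet_Ioi fun t ht ↦ ?_
    have ht : 0 < t := ht
    rw [ENNReal.toReal_mul, ENNReal.toReal_ofReal (by positivity)]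
  · exact (ae_restrict_iff' measurableSet_Ioi).mpr (.of_forall fun t ht ↦
      ENNReal.mul_lt_top (rayGauss_ne_top m J ht).lt_top ENNReal.ofReal_lt_top)

/-- The Laurent expansion at `s = 1` of the Dirichlet series of a ray class. -/
theorem exists_abs_raySum_sub_le {m : ℕ} (hm : 2 ≤ m) {J : Ideal (𝓞 K)} (hJ0 : J ≠ ⊥)
    (hJ : IsCoprime J (Ideal.span {(m : 𝓞 K)})) : ∃ C, ∀ s, 1 < s → s ≤ 2 →
      |(radialMellin K s).toReal * raySum m J s - (rayResidue K m).toReal / (s - 1) -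
        ∫ t in Set.Ioi (0 : ℝ), rayGaussRegular m J t| ≤ C * (s - 1) := by
  obtain ⟨C, h0, h1⟩ := exists_rayGauss_bounds hm hJ0 hJ
  have hg : Measurable fun t ↦ (rayGauss m J t).toReal := (measurable_rayGauss m J).ennreal_toReal
  refine ⟨C * ∫ t in Set.Ioi (0 : ℝ), mellinMajorant t, fun s hs hs2 ↦ ?_⟩
  have h := (integrableOn_mul_rpow_and_integral_eq hg h0 h1
    (sub_pos.mpr hs) (by linarith : s - 1 ≤ 1)).2
  rw [integral_rayGauss_mul_rpow m J hs] at h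
  rw [h, add_sub_cancel_left]
  exact abs_integral_removePole_mul_rpow_sub_le hg h0 h1 (sub_pos.mpr hs).le (by linarith)

end MellinTransform

noncomputable section RayClass

open scoped nonZeroDivisors

variable {K : Type*} [Field K] [NumberField K]

omit [NumberField K] in
theorem isCoprime_span_span_iff {α : 𝓞 K} {m : ℕ} :
    IsCoprime (Ideal.span {α}) (Ideal.span {(m : 𝓞 K)}) ↔ ∃ γ, (m : 𝓞 K) ∣ γ * α - 1 := by
  rw [Ideal.isCoprime_span_singleton_iff]
  constructor
  · rintro ⟨a, b, h⟩
    exact ⟨a, -b, by linear_combination h⟩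
  · rintro ⟨γ, b, h⟩
    exact ⟨γ, -b, by linear_combination h⟩

omit [NumberField K] in
theorem isCoprime_span_of_dvd_sub_one {α : 𝓞 K} {m : ℕ} (h : (m : 𝓞 K) ∣ α - 1) :
    IsCoprime (Ideal.span {α}) (Ideal.span {(m : 𝓞 K)}) :=
  isCoprime_span_span_iff.mpr ⟨1, by rwa [one_mul]⟩

omit [NumberField K] in
theorem dvd_mul_sub_one {m α β : 𝓞 K} (hα : m ∣ α - 1) (hβ : m ∣ β - 1) : m ∣ α * β - 1 := by
  have := (hα.mul_right β).add hβ
  convert this using 1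
  ring

variable (K) in
/-- Two ideals are ray equivalent modulo `m` if both fail to be coprime to `m`, or both are coprime
to `m` and they differ by a quotient of elements congruent to `1` modulo `m`. -/
def rayCon (m : ℕ) : Con (Ideal (𝓞 K)) where
  r I J := (IsCoprime I (Ideal.span {(m : 𝓞 K)}) ↔ IsCoprime J (Ideal.span {(m : 𝓞 K)})) ∧
    (IsCoprime I (Ideal.span {(m : 𝓞 K)}) → ∃ α β : 𝓞 K, (m : 𝓞 K) ∣ α - 1 ∧ (m : 𝓞 K) ∣ β - 1 ∧
      Ideal.span {α} * I = Ideal.span {β} * J)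
  iseqv :=
    { refl := fun I ↦ ⟨Iff.rfl, fun _ ↦ ⟨1, 1, by simp, by simp, rfl⟩⟩
      symm := fun ⟨h, h'⟩ ↦ ⟨h.symm, fun hJ ↦ by
        obtain ⟨α, β, hα, hβ, e⟩ := h' (h.mpr hJ)
        exact ⟨β, α, hβ, hα, e.symm⟩⟩
      trans := fun {I J L} ⟨h, h'⟩ ⟨g, g'⟩ ↦ ⟨h.trans g, fun hI ↦ by
        obtain ⟨α, β, hα, hβ, e⟩ := h' hI
        obtain ⟨α', β', hα', hβ', e'⟩ := g' (h.mp hI)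
        refine ⟨α' * α, β * β', dvd_mul_sub_one hα' hα, dvd_mul_sub_one hβ hβ', ?_⟩
        rw [← Ideal.span_singleton_mul_span_singleton, ← Ideal.span_singleton_mul_span_singleton,
          mul_assoc, e, mul_assoc, ← e', mul_left_comm]⟩ }
  mul' := fun {I J I' J'} ⟨h, h'⟩ ⟨g, g'⟩ ↦ by
    refine ⟨by rw [IsCoprime.mul_left_iff, IsCoprime.mul_left_iff, h, g], fun hI ↦ ?_⟩
    obtain ⟨α, β, hα, hβ, e⟩ := h' (IsCoprime.mul_left_iff.mp hI).1
    obtain ⟨α', β', hα', hβ', e'⟩ := g' (IsCoprime.mul_left_iff.mp hI).2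
    refine ⟨α * α', β * β', dvd_mul_sub_one hα hα', dvd_mul_sub_one hβ hβ', ?_⟩
    rw [← Ideal.span_singleton_mul_span_singleton, ← Ideal.span_singleton_mul_span_singleton,
      mul_mul_mul_comm, e, e', mul_mul_mul_comm]

variable (K) in
/-- The monoid of ray classes modulo `m`; the classes of the ideals coprime to `m` are its units. -/
abbrev RayClass (m : ℕ) : Type _ := (rayCon K m).Quotient

/-- The ray class of an ideal. -/
def rayClass (m : ℕ) : Ideal (𝓞 K) →* RayClass K m := (rayCon K m).mk'

omit [NumberField K] in
theorem rayClass_surjective (m : ℕ) : Function.Surjective (rayClass (K := K) m) :=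
  Con.mk'_surjective

omit [NumberField K] in
theorem rayClass_eq_iff {m : ℕ} {I J : Ideal (𝓞 K)} (hI : IsCoprime I (Ideal.span {(m : 𝓞 K)}))
    (hJ : IsCoprime J (Ideal.span {(m : 𝓞 K)})) :
    rayClass m I = rayClass m J ↔ ∃ α β : 𝓞 K, (m : 𝓞 K) ∣ α - 1 ∧ (m : 𝓞 K) ∣ β - 1 ∧
      Ideal.span {α} * I = Ideal.span {β} * J := by
  rw [rayClass, Con.coe_mk', Con.eq]
  exact ⟨fun h ↦ h.2 hI, fun h ↦ ⟨by simp [hI, hJ], fun _ ↦ h⟩⟩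

omit [NumberField K] in
theorem isCoprime_iff_of_rayClass_eq {m : ℕ} {I J : Ideal (𝓞 K)} (h : rayClass m I = rayClass m J) :
    IsCoprime I (Ideal.span {(m : 𝓞 K)}) ↔ IsCoprime J (Ideal.span {(m : 𝓞 K)}) := by
  rw [rayClass, Con.coe_mk', Con.eq] at h
  exact h.1

omit [NumberField K] in
theorem rayClass_span_eq_one {m : ℕ} {α : 𝓞 K} (h : (m : 𝓞 K) ∣ α - 1) :
    rayClass m (Ideal.span {α}) = 1 := by
  rw [← map_one (rayClass m), rayClass_eq_iff (isCoprime_span_of_dvd_sub_one h) isCoprime_one_left]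
  exact ⟨1, α, by simp, h, by simp⟩

omit [NumberField K] in
theorem rayClass_span_eq {m : ℕ} {α β : 𝓞 K} (hα : IsCoprime (Ideal.span {α}) (Ideal.span {(m : 𝓞 K)}))
    (h : (m : 𝓞 K) ∣ α - β) : rayClass m (Ideal.span {α}) = rayClass m (Ideal.span {β}) := by
  obtain ⟨γ, hγ⟩ := isCoprime_span_span_iff.mp hα
  have hγ' : (m : 𝓞 K) ∣ γ * β - 1 := by
    have := hγ.sub (h.mul_left γ)
    convert this using 1
    ring
  rw [rayClass_eq_iff hα (isCoprime_span_span_iff.mpr ⟨γ, hγ'⟩)]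
  exact ⟨γ * β, γ * α, hγ', hγ, by
    rw [Ideal.span_singleton_mul_span_singleton, Ideal.span_singleton_mul_span_singleton]
    ring_nf⟩

theorem ne_bot_of_isCoprime {m : ℕ} (hm : 2 ≤ m) {I : Ideal (𝓞 K)}
    (hI : IsCoprime I (Ideal.span {(m : 𝓞 K)})) : I ≠ ⊥ := by
  rintro rfl
  rw [Ideal.isCoprime_iff_sup_eq, bot_sup_eq, Ideal.span_singleton_eq_top] at hI
  exact not_isUnit_natCast hm hI

theorem ne_zero_of_dvd_sub_one {m : ℕ} (hm : 2 ≤ m) {α : 𝓞 K} (h : (m : 𝓞 K) ∣ α - 1) : α ≠ 0 := by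
  rintro rfl
  rw [zero_sub, dvd_neg] at h
  exact not_isUnit_natCast (K := K) hm (isUnit_of_dvd_one h)

/-- The exponent of the class group gives a principal power. -/
theorem exists_pow_eq_span {I : Ideal (𝓞 K)} (hI : I ≠ ⊥) :
    ∃ α : 𝓞 K, I ^ classNumber K = Ideal.span {α} := by
  have h : ClassGroup.mk0 (⟨I, mem_nonZeroDivisors_of_ne_zero hI⟩ ^ classNumber K : (Ideal (𝓞 K))⁰) = 1 := by
    rw [map_pow, classNumber, pow_card_eq_one]
  rw [ClassGroup.mk0_eq_one_iff] at h
  obtain ⟨α, hα⟩ := h.principal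
  exact ⟨α, by simpa using hα⟩

theorem exists_pow_dvd_sub_one {m : ℕ} (hm : 2 ≤ m) {α : 𝓞 K}
    (hα : IsCoprime (Ideal.span {α}) (Ideal.span {(m : 𝓞 K)})) : ∃ e > 0, (m : 𝓞 K) ∣ α ^ e - 1 := by
  have := finite_quotient_span_natCast (K := K) (show m ≠ 0 by omega)
  obtain ⟨γ, hγ⟩ := isCoprime_span_span_iff.mp hα
  have hu : IsUnit (Ideal.Quotient.mk (Ideal.span {(m : 𝓞 K)}) α) := by
    refine IsUnit.of_mul_eq_one (Ideal.Quotient.mk _ γ) ?_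
    rw [mul_comm, ← map_mul, ← map_one (Ideal.Quotient.mk _), mk_eq_mk_iff_dvd]
    exact hγ
  obtain ⟨e, he, h⟩ := isOfFinOrder_iff_pow_eq_one.mp
    (isOfFinOrder_of_finite hu.unit)
  refine ⟨e, he, ?_⟩
  rw [Units.ext_iff] at h
  rwa [Units.val_pow_eq_pow_val, IsUnit.unit_spec, Units.val_one, ← map_pow, ← map_one (Ideal.Quotient.mk _), mk_eq_mk_iff_dvd] at h

theorem isUnit_rayClass_iff {m : ℕ} (hm : 2 ≤ m) {I : Ideal (𝓞 K)} :
    IsUnit (rayClass m I) ↔ IsCoprime I (Ideal.span {(m : 𝓞 K)}) := by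
  constructor
  · intro h
    obtain ⟨r, hr⟩ := h.exists_right_inv
    obtain ⟨J, rfl⟩ := rayClass_surjective m r
    rw [← map_mul, ← map_one (rayClass m)] at hr
    exact (IsCoprime.mul_left_iff.mp ((isCoprime_iff_of_rayClass_eq hr).mpr isCoprime_one_left)).1
  · intro h
    obtain ⟨α, hα⟩ := exists_pow_eq_span (ne_bot_of_isCoprime hm h)
    have hc : IsCoprime (Ideal.span {α}) (Ideal.span {(m : 𝓞 K)}) := hα ▸ h.pow_left
    obtain ⟨e, he, h1⟩ := exists_pow_dvd_sub_one hm hc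
    have hpos : 0 < classNumber K := Fintype.card_pos
    refine IsUnit.of_pow_eq_one (n := classNumber K * e) ?_ (by positivity)
    rw [pow_mul, ← map_pow, hα, ← map_pow, Ideal.span_singleton_pow]
    exact rayClass_span_eq_one h1

theorem rayIdeals_eq {m : ℕ} (hm : 2 ≤ m) {J : Ideal (𝓞 K)} :
    rayIdeals m J = {I | rayClass m I * rayClass m J = 1} := by
  ext I
  constructor
  · rintro ⟨α, -, hα, h⟩
    rw [Set.mem_ofPred_eq, ← map_mul, h]
    exact rayClass_span_eq_one hα
  · intro h
    rw [Set.mem_ofPred_eq, ← map_mul, ← map_one (rayClass m)] at h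
    have hc := (isCoprime_iff_of_rayClass_eq h).mpr isCoprime_one_left
    obtain ⟨α, β, hα, hβ, e⟩ := (rayClass_eq_iff hc isCoprime_one_left).mp h
    rw [mul_one] at e
    have hα0 := ne_zero_of_dvd_sub_one hm hα
    obtain ⟨γ, rfl⟩ : α ∣ β := by
      rw [← Ideal.span_singleton_le_span_singleton, ← e]
      exact Ideal.mul_le_left
    have hγ : (m : 𝓞 K) ∣ γ - 1 := by
      have := hβ.sub (hα.mul_right γ)
      convert this using 1
      ring
    refine ⟨γ, ne_zero_of_dvd_sub_one hm hγ, hγ, ?_⟩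
    rw [← Ideal.span_singleton_mul_span_singleton] at e
    exact mul_left_cancel₀ (by simpa using hα0) e

theorem finite_rayClass {m : ℕ} (hm : 2 ≤ m) : Finite (RayClass K m) := by
  classical
  have := finite_quotient_span_natCast (K := K) (show m ≠ 0 by omega)
  have hq : ∀ C : ClassGroup (𝓞 K), ∃ I : Ideal (𝓞 K), ∀ J : (Ideal (𝓞 K))⁰,
      IsCoprime J.1 (Ideal.span {(m : 𝓞 K)}) → ClassGroup.mk0 J = C →
      IsCoprime I (Ideal.span {(m : 𝓞 K)}) ∧ ∃ α, J.1 * I = Ideal.span {α} := by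
    intro C
    by_cases h : ∃ I : (Ideal (𝓞 K))⁰, IsCoprime I.1 (Ideal.span {(m : 𝓞 K)}) ∧ ClassGroup.mk0 I = C
    · obtain ⟨I, hI, rfl⟩ := h
      refine ⟨I ^ (classNumber K - 1), fun J _ hJ ↦ ⟨hI.pow_left, ?_⟩⟩
      have h1 : ClassGroup.mk0 (J * I ^ (classNumber K - 1)) = 1 := by
        have hpos : 0 < classNumber K := Fintype.card_pos
        rw [map_mul, map_pow, hJ, ← pow_succ', Nat.sub_add_cancel hpos, classNumber, pow_card_eq_one]
      rw [ClassGroup.mk0_eq_one_iff] at h1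
      obtain ⟨α, hα⟩ := h1.principal
      exact ⟨α, by simpa using hα⟩
    · exact ⟨⊤, fun J hJ hJC ↦ (h ⟨J, hJ, hJC⟩).elim⟩
  choose Q hQ using hq
  have hspec : ∀ r : RayClass K m, ∃ x : Option (ClassGroup (𝓞 K) × (𝓞 K ⧸ Ideal.span {(m : 𝓞 K)})),
      ∃ I, rayClass m I = r ∧ (x = none → ¬ IsCoprime I (Ideal.span {(m : 𝓞 K)})) ∧
      ∀ C c, x = some (C, c) → IsCoprime I (Ideal.span {(m : 𝓞 K)}) ∧
        IsCoprime (Q C) (Ideal.span {(m : 𝓞 K)}) ∧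
        ∃ α, Ideal.Quotient.mk _ α = c ∧ I * Q C = Ideal.span {α} := by
    intro r
    obtain ⟨I, rfl⟩ := rayClass_surjective m r
    by_cases h : IsCoprime I (Ideal.span {(m : 𝓞 K)})
    · set J : (Ideal (𝓞 K))⁰ := ⟨I, mem_nonZeroDivisors_of_ne_zero (ne_bot_of_isCoprime hm h)⟩
      obtain ⟨h1, α, hα⟩ := hQ _ J h rfl
      refine ⟨some (ClassGroup.mk0 J, Ideal.Quotient.mk _ α), I, rfl, by simp, fun C c e ↦ ?_⟩
      obtain ⟨rfl, rfl⟩ : ClassGroup.mk0 J = C ∧ Ideal.Quotient.mk _ α = c := by simpa using e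
      exact ⟨h, h1, α, rfl, hα⟩
    · exact ⟨none, I, rfl, fun _ ↦ h, by simp⟩
  choose x I hI hnone hsome using hspec
  refine Finite.of_injective x fun r r' h ↦ ?_
  rw [← hI r, ← hI r']
  rcases hx : x r with _ | ⟨C, c⟩
  · rw [rayClass, Con.coe_mk', Con.eq]
    have h1 := hnone r hx
    exact ⟨by simp [h1, hnone r' (h ▸ hx)], fun h ↦ (h1 h).elim⟩
  · obtain ⟨h1, hq, α, rfl, hα⟩ := hsome r C c hx
    obtain ⟨h1', -, α', hαα', hα'⟩ := hsome r' C _ (h ▸ hx)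
    have e : rayClass m (I r * Q C) = rayClass m (I r' * Q C) := by
      rw [hα, hα']
      exact rayClass_span_eq (hα ▸ h1.mul_left hq) (mk_eq_mk_iff_dvd.mp hαα'.symm)
    rw [map_mul, map_mul] at e
    exact ((isUnit_rayClass_iff hm).mpr hq).mul_right_cancel e

end RayClass

noncomputable section CharacterSums

open Real MeasureTheory
open scoped ENNReal Classical

variable {K : Type*} [Field K] [NumberField K] {m : ℕ} [hm : Fact (2 ≤ m)]

instance : Fintype (RayClass K m) := @Fintype.ofFinite _ (finite_rayClass hm.out)

theorem exists_rayRep (r : RayClass K m) : ∃ J : Ideal (𝓞 K), IsUnit r →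
    rayClass m J * r = 1 ∧ J ≠ ⊥ ∧ IsCoprime J (Ideal.span {(m : 𝓞 K)}) := by
  by_cases h : IsUnit r
  · obtain ⟨r', hr'⟩ := h.exists_left_inv
    obtain ⟨J, rfl⟩ := rayClass_surjective m r'
    have hc := (isUnit_rayClass_iff hm.out).mp (IsUnit.of_mul_eq_one _ hr')
    exact ⟨J, fun _ ↦ ⟨hr', ne_bot_of_isCoprime hm.out hc, hc⟩⟩
  · exact ⟨⊥, fun h' ↦ (h h').elim⟩

/-- An integral ideal in the inverse of a given ray class. -/
def rayRep (r : RayClass K m) : Ideal (𝓞 K) := (exists_rayRep r).choose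

theorem rayRep_spec {r : RayClass K m} (hr : IsUnit r) : rayClass m (rayRep r) * r = 1 ∧
    rayRep r ≠ ⊥ ∧ IsCoprime (rayRep r) (Ideal.span {(m : 𝓞 K)}) :=
  (exists_rayRep r).choose_spec hr

theorem rayIdeals_rayRep {r : RayClass K m} (hr : IsUnit r) :
    rayIdeals m (rayRep r) = rayClass m ⁻¹' {r} := by
  rw [rayIdeals_eq hm.out]
  ext I
  have h := (rayRep_spec hr).1
  constructor
  · intro hI
    have hI : rayClass m I * rayClass m (rayRep r) = 1 := hI
    calc rayClass m I = rayClass m I * (rayClass m (rayRep r) * r) := by rw [h, mul_one]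
      _ = r := by rw [← mul_assoc, hI, one_mul]
  · intro hI
    have hI : rayClass m I = r := hI
    rw [Set.mem_ofPred_eq, hI, mul_comm, h]

theorem norm_mulChar_le_one (ψ : MulChar (RayClass K m) ℂ) (r : RayClass K m) : ‖ψ r‖ ≤ 1 := by
  by_cases hr : IsUnit r
  · obtain ⟨u, rfl⟩ := hr
    refine (Complex.norm_eq_one_of_pow_eq_one (n := Fintype.card (RayClass K m)ˣ) ?_ Fintype.card_ne_zero).le
    rw [← map_pow, ← Units.val_pow_eq_pow_val, pow_card_eq_one, Units.val_one, map_one]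
  · rw [ψ.map_nonunit hr, norm_zero]; exact zero_le_one

/-- The `L`-series of a ray class character at a real argument. -/
def rayLSeries (ψ : MulChar (RayClass K m) ℂ) (s : ℝ) : ℂ :=
  ∑' I : Ideal (𝓞 K), ψ (rayClass m I) * ((Ideal.absNorm I : ℝ) ^ (-s) : ℝ)

theorem summable_norm_rayLSeries (ψ : MulChar (RayClass K m) ℂ) {s : ℝ} (hs : 1 < s) :
    Summable fun I : Ideal (𝓞 K) ↦ ‖ψ (rayClass m I) * ((Ideal.absNorm I : ℝ) ^ (-s) : ℝ)‖ := by
  refine Summable.of_nonneg_of_le (fun _ ↦ norm_nonneg _) (fun I ↦ ?_) (summable_absNorm_rpow hs)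
  rw [norm_mul, Complex.norm_real, norm_of_nonneg (by positivity)]
  exact mul_le_of_le_one_left (by positivity) (norm_mulChar_le_one ψ _)

theorem rayLSeries_eq_sum (ψ : MulChar (RayClass K m) ℂ) {s : ℝ} (hs : 1 < s) :
    rayLSeries ψ s = ∑ r, ψ r * (raySum m (rayRep r) s : ℂ) := by
  have h := (summable_norm_rayLSeries ψ hs).of_norm.hasSum.tsum_fiberwise (rayClass m)
  rw [rayLSeries, ← h.tsum_eq, tsum_fintype]
  refine Finset.sum_congr rfl fun r _ ↦ ?_
  by_cases hr : IsUnit r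
  · rw [raySum, rayIdeals_rayRep hr, Complex.ofReal_tsum, ← tsum_mul_left]
    exact tsum_congr fun I ↦ by rw [show rayClass m I.1 = r from I.2]
  · rw [ψ.map_nonunit hr, zero_mul]
    exact (tsum_congr fun I : rayClass m ⁻¹' {r} ↦ by
      rw [show rayClass m I.1 = r from I.2, ψ.map_nonunit hr, zero_mul]).trans tsum_zero

/-- The value at `s = 1` of `radialMellin K s * rayLSeries ψ s` for nontrivial `ψ`. -/
def rayLValue (ψ : MulChar (RayClass K m) ℂ) : ℂ :=
  ∑ r, ψ r * ((∫ t in Set.Ioi (0 : ℝ), rayGaussRegular m (rayRep r) t : ℝ) : ℂ)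

theorem exists_norm_rayLSeries_sub_le (ψ : MulChar (RayClass K m) ℂ) : ∃ C, ∀ s, 1 < s → s ≤ 2 →
    ‖(radialMellin K s).toReal * rayLSeries ψ s -
      (∑ r, ψ r) * ((rayResidue K m).toReal / (s - 1) : ℝ) - rayLValue ψ‖ ≤ C * (s - 1) := by
  have h : ∀ r : RayClass K m, ∃ C, ∀ s, 1 < s → s ≤ 2 → ‖ψ r * ((radialMellin K s).toReal *
      raySum m (rayRep r) s - (rayResidue K m).toReal / (s - 1) -
      ∫ t in Set.Ioi (0 : ℝ), rayGaussRegular m (rayRep r) t : ℝ)‖ ≤ C * (s - 1) := by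
    intro r
    by_cases hr : IsUnit r
    · obtain ⟨C, hC⟩ := exists_abs_raySum_sub_le hm.out (rayRep_spec hr).2.1 (rayRep_spec hr).2.2
      refine ⟨C, fun s hs hs2 ↦ ?_⟩
      rw [norm_mul, Complex.norm_real]
      exact (mul_le_of_le_one_left (norm_nonneg _) (norm_mulChar_le_one ψ r)).trans (hC s hs hs2)
    · refine ⟨0, fun s _ _ ↦ ?_⟩
      rw [ψ.map_nonunit hr]
      simp
  choose C hC using h
  refine ⟨∑ r, C r, fun s hs hs2 ↦ ?_⟩
  rw [rayLSeries_eq_sum ψ hs, rayLValue, Finset.mul_sum, Finset.sum_mul, ← Finset.sum_sub_distrib,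
    ← Finset.sum_sub_distrib, Finset.sum_mul]
  refine (norm_sum_le _ _).trans (Finset.sum_le_sum fun r _ ↦ ?_)
  refine le_of_eq_of_le (congrArg norm ?_) (hC r s hs hs2)
  push_cast
  ring

end CharacterSums

noncomputable section MultiplicativeConvolution

open Real MeasureTheory
open scoped ENNReal Classical

/-- `g` has a simple pole `κ / t` at the origin, up to quadratic error, and decays cubically. -/
structure HasPole (κ C : ℝ) (g : ℝ → ℝ) : Prop where
  measurable : Measurable g
  residue_nonneg : 0 ≤ κ
  const_nonneg : 0 ≤ C
  near_zero : ∀ t, 0 < t → t ≤ 1 → |g t - κ / t| ≤ C * t ^ 2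
  near_top : ∀ t, 1 < t → |g t| ≤ C * t ^ (-3 : ℝ)

namespace HasPole

variable {κ κ' C C' : ℝ} {g g' f : ℝ → ℝ}

theorem zero : HasPole 0 0 0 := ⟨measurable_const, le_rfl, le_rfl, by simp, by simp⟩

theorem add (h : HasPole κ C g) (h' : HasPole κ' C' g') : HasPole (κ + κ') (C + C') (g + g') where
  measurable := h.measurable.add h'.measurable
  residue_nonneg := add_nonneg h.residue_nonneg h'.residue_nonneg
  const_nonneg := add_nonneg h.const_nonneg h'.const_nonneg
  near_zero t h0 h1 := by
    rw [Pi.add_apply, show g t + g' t - (κ + κ') / t = (g t - κ / t) + (g' t - κ' / t) by ring, add_mul]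
    exact (abs_add_le _ _).trans (add_le_add (h.near_zero t h0 h1) (h'.near_zero t h0 h1))
  near_top t ht := by
    rw [add_mul]
    exact (abs_add_le _ _).trans (add_le_add (h.near_top t ht) (h'.near_top t ht))

theorem sum {ι : Type*} {s : Finset ι} {κ C : ι → ℝ} {g : ι → ℝ → ℝ}
    (h : ∀ i ∈ s, HasPole (κ i) (C i) (g i)) : HasPole (∑ i ∈ s, κ i) (∑ i ∈ s, C i) (∑ i ∈ s, g i) := by
  induction s using Finset.induction_on with
  | empty => simpa using zero
  | insert i s hi ih =>
    rw [Finset.sum_insert hi, Finset.sum_insert hi, Finset.sum_insert hi]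
    exact (h i (Finset.mem_insert_self _ _)).add (ih fun j hj ↦ h j (Finset.mem_insert_of_mem hj))

theorem abs_le_div (h : HasPole κ C g) {t : ℝ} (ht : 0 < t) : |g t| ≤ (κ + C) * t⁻¹ := by
  have hκ := h.residue_nonneg
  have hC := h.const_nonneg
  rcases le_or_gt t 1 with h1 | h1
  · have h2 : |g t| ≤ |g t - κ / t| + |κ / t| := by simpa using abs_add_le (g t - κ / t) (κ / t)
    have h3 := h.near_zero t ht h1
    rw [abs_of_nonneg (by positivity : 0 ≤ κ / t)] at h2
    have h4 : C * t ^ 2 ≤ C * t⁻¹ := by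
      gcongr
      exact (pow_le_one₀ ht.le h1).trans ((one_le_inv₀ ht).mpr h1)
    calc _ ≤ C * t⁻¹ + κ / t := by linarith
      _ = _ := by ring
  · refine (h.near_top t h1).trans ?_
    rw [← rpow_neg_one]
    gcongr
    · linarith
    · exact h1.le
    · norm_num

theorem abs_le_cube (h : HasPole κ C g) {t : ℝ} (ht : 0 < t) : |g t| ≤ (κ + C) * t ^ (-3 : ℝ) := by
  have hκ := h.residue_nonneg
  have hC := h.const_nonneg
  rcases le_or_gt t 1 with h1 | h1
  · refine (h.abs_le_div ht).trans ?_
    rw [← rpow_neg_one]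
    exact mul_le_mul_of_nonneg_left (rpow_le_rpow_of_exponent_ge ht h1 (by norm_num)) (by positivity)
  · exact (h.near_top t h1).trans (mul_le_mul_of_nonneg_right (by linarith) (by positivity))

theorem abs_sub_le (h : HasPole κ C g) {t : ℝ} (ht : 0 < t) : |g t - κ / t| ≤ κ + C := by
  have hκ := h.residue_nonneg
  have hC := h.const_nonneg
  rcases le_or_gt t 1 with h1 | h1
  · refine (h.near_zero t ht h1).trans ?_
    nlinarith [pow_le_one₀ ht.le h1 (n := 2)]
  · have h2 : |g t - κ / t| ≤ |g t| + |κ / t| := abs_sub _ _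
    rw [abs_of_nonneg (by positivity : 0 ≤ κ / t)] at h2
    have h3 : t ^ (-3 : ℝ) ≤ 1 := rpow_le_one_of_one_le_of_nonpos h1.le (by norm_num)
    have h4 : κ / t ≤ κ := div_le_self hκ h1.le
    nlinarith [h.near_top t h1]

theorem integrableOn_removePole_mul_rpow (h : HasPole κ C g) {p : ℝ} (hp : |p| ≤ 1) :
    IntegrableOn (fun t ↦ removePole κ g t * t ^ p) (Set.Ioi 0) :=
  _root_.integrableOn_removePole_mul_rpow h.measurable h.near_zero h.near_top hp

theorem integrableOn_removePole (h : HasPole κ C g) : IntegrableOn (removePole κ g) (Set.Ioi 0) :=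
  _root_.integrableOn_removePole h.measurable h.near_zero h.near_top

/-- Integrability of the multiplicative convolution. -/
theorem integrableOn_conv (h : HasPole κ C g) (h' : HasPole κ' C' g') {t : ℝ} (ht : 0 < t) :
    IntegrableOn (fun v ↦ g (t / v) * g' v * v⁻¹) (Set.Ioi 0) := by
  have hm := h.measurable
  have hm' := h'.measurable
  refine Integrable.mono' (integrableOn_mellinMajorant.const_mul
    ((κ + C) * (κ' + C') * (t⁻¹ + t ^ (-3 : ℝ)))) (by fun_prop)
    ((ae_restrict_iff' measurableSet_Ioi).mpr (.of_forall fun v hv ↦ ?_))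
  have hv : 0 < v := hv
  have hκ := h.residue_nonneg
  have hC := h.const_nonneg
  have hκ' := h'.residue_nonneg
  have hC' := h'.const_nonneg
  rw [norm_mul, norm_mul, norm_eq_abs, norm_eq_abs, norm_of_nonneg (by positivity)]
  unfold mellinMajorant
  split_ifs with hv1
  · calc _ ≤ (κ + C) * (t / v) ^ (-3 : ℝ) * ((κ' + C') * v⁻¹) * v⁻¹ := by
          gcongr
          · exact h.abs_le_cube (by positivity)
          · exact h'.abs_le_div hv
      _ = (κ + C) * (κ' + C') * t ^ (-3 : ℝ) * v := by
          rw [div_rpow ht.le hv.le, rpow_neg ht.le, rpow_neg hv.le]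
          norm_cast
          field_simp
      _ ≤ _ := by gcongr; exact le_add_of_nonneg_left (by positivity)
  · calc _ ≤ (κ + C) * (t / v)⁻¹ * ((κ' + C') * v ^ (-3 : ℝ)) * v⁻¹ := by
          gcongr
          · exact h.abs_le_div (by positivity)
          · exact h'.abs_le_cube hv
      _ = (κ + C) * (κ' + C') * t⁻¹ * v ^ (-3 : ℝ) := by field_simp
      _ ≤ (κ + C) * (κ' + C') * (t⁻¹ + t ^ (-3 : ℝ)) * v ^ (-2 : ℝ) := by
          gcongr
          · exact le_add_of_nonneg_right (by positivity)
          · exact (not_le.mp hv1).le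
          · norm_num

/-- If two functions have the same pole and the same total mass, their multiplicative convolutions
with a third function differ by a bounded amount. -/
theorem exists_conv_le {A D : ℝ} (hf : HasPole A D f) (h : HasPole κ C g) (h' : HasPole κ C' g')
    (heq : ∫ t in Set.Ioi (0 : ℝ), removePole κ g t = ∫ t in Set.Ioi (0 : ℝ), removePole κ g' t) :
    ∃ B, ∀ t, 0 < t → ∫ v in Set.Ioi (0 : ℝ), f (t / v) * g v * v⁻¹ ≤
      (∫ v in Set.Ioi (0 : ℝ), f (t / v) * g' v * v⁻¹) + B := by
  set d : ℝ → ℝ := fun v ↦ removePole κ g v - removePole κ g' v with hd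
  have hd' : ∀ v, g v - g' v = d v := fun v ↦ by simp only [hd, removePole]; ring
  have hdi : IntegrableOn d (Set.Ioi 0) := h.integrableOn_removePole.sub h'.integrableOn_removePole
  have hdv : IntegrableOn (fun v ↦ d v * v⁻¹) (Set.Ioi 0) := by
    have h1 := (h.integrableOn_removePole_mul_rpow (p := -1) (by simp)).sub
      (h'.integrableOn_removePole_mul_rpow (p := -1) (by simp))
    refine h1.congr_fun (fun v _ ↦ ?_) measurableSet_Ioi
    simp only [Pi.sub_apply, rpow_neg_one, hd]
    ring
  have hd0 : ∫ v in Set.Ioi (0 : ℝ), d v = 0 := by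
    rw [hd, integral_sub h.integrableOn_removePole h'.integrableOn_removePole, heq, sub_self]
  refine ⟨(A + D) * ∫ v in Set.Ioi (0 : ℝ), ‖d v * v⁻¹‖, fun t ht ↦ ?_⟩
  rw [← sub_le_iff_le_add', ← integral_sub (hf.integrableOn_conv h ht) (hf.integrableOn_conv h' ht)]
  calc _ ≤ ∫ v in Set.Ioi (0 : ℝ), (A / t * d v + (A + D) * ‖d v * v⁻¹‖) := by
        refine setIntegral_mono_on ((hf.integrableOn_conv h ht).sub (hf.integrableOn_conv h' ht))
          ((hdi.const_mul _).add (hdv.norm.const_mul _)) measurableSet_Ioi fun v hv ↦ ?_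
        have hv : 0 < v := hv
        have h1 : f (t / v) * g v * v⁻¹ - f (t / v) * g' v * v⁻¹ =
            A / t * d v + (f (t / v) - A / (t / v)) * (d v * v⁻¹) := by
          rw [← hd' v]
          field_simp
          ring
        rw [h1]
        refine add_le_add le_rfl ((le_abs_self _).trans ?_)
        rw [abs_mul]
        exact mul_le_mul_of_nonneg_right (hf.abs_sub_le (by positivity)) (abs_nonneg _)
    _ = _ := by
        rw [integral_add (hdi.const_mul _) (hdv.norm.const_mul _), integral_const_mul, hd0, mul_zero,
          zero_add, integral_const_mul]

end HasPole

end MultiplicativeConvolution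

section DivisorSums

open scoped Classical

variable {M : Type*} [CommMonoidWithZero M] [UniqueFactorizationMonoid M] [Subsingleton Mˣ]

theorem finite_setOf_dvd {x : M} (hx : x ≠ 0) : {y | y ∣ x}.Finite := by
  have : Fintype Mˣ := Fintype.ofSubsingleton 1
  have := UniqueFactorizationMonoid.fintypeSubtypeDvd x hx
  exact Set.finite_coe_iff.mp (Finite.of_fintype {y // y ∣ x})

theorem exists_natCast_eq_geom_sum {z : ℂ} (hz : z ^ 2 = 1) (n : ℕ) :
    ∃ k : ℕ, ∑ j ∈ Finset.range (n + 1), z ^ j = k ∧ (Even n → 1 ≤ k) := by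
  rcases mul_self_eq_one_iff.mp ((sq z).symm.trans hz) with rfl | rfl
  · exact ⟨n + 1, by simp, fun _ ↦ by omega⟩
  · rw [neg_one_geom_sum]
    split_ifs with h
    · exact ⟨0, by simp, fun h' ↦ by simp [Nat.even_add_one, h'] at h⟩
    · exact ⟨1, by simp, fun _ ↦ le_rfl⟩

theorem sum_divisors_prime_pow {p : M} (hp : Prime p) (n : ℕ) {s : Finset M}
    (hs : ∀ b, b ∈ s ↔ b ∣ p ^ n) (χ : M →* ℂ) :
    ∑ b ∈ s, χ b = ∑ j ∈ Finset.range (n + 1), χ p ^ j := by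
  have : s = (Finset.range (n + 1)).image (p ^ ·) := by
    ext b
    rw [hs, dvd_prime_pow hp, Finset.mem_image]
    simp only [associated_iff_eq, Finset.mem_range, Nat.lt_succ_iff, eq_comm]
  rw [this, Finset.sum_image fun i _ j _ h ↦ pow_injective_of_not_isUnit hp.not_isUnit hp.ne_zero h]
  simp_rw [map_pow]

theorem sum_divisors_mul {x y : M} (hxy : IsRelPrime x y) {s t u : Finset M} (hs : ∀ b, b ∈ s ↔ b ∣ x * y)
    (ht : ∀ b, b ∈ t ↔ b ∣ x) (hu : ∀ b, b ∈ u ↔ b ∣ y) (χ : M →* ℂ) :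
    ∑ b ∈ s, χ b = (∑ b ∈ t, χ b) * ∑ b ∈ u, χ b := by
  rw [Finset.sum_mul_sum, ← Finset.sum_product']
  refine (Finset.sum_bij (fun p _ ↦ p.1 * p.2) ?_ ?_ ?_ ?_).symm
  · rintro ⟨a, b⟩ h
    simp only [Finset.mem_product, ht, hu] at h
    exact (hs _).mpr (mul_dvd_mul h.1 h.2)
  · rintro ⟨a, b⟩ h ⟨a', b'⟩ h' e
    simp only [Finset.mem_product, ht, hu] at h h' e
    have key : ∀ {a a' b b' : M}, a ∣ x → b' ∣ y → a * b = a' * b' → a ∣ a' := fun h h' e ↦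
      (hxy.of_dvd_left h |>.of_dvd_right h').dvd_of_dvd_mul_right (e ▸ dvd_mul_right _ _)
    have key' : ∀ {a a' b b' : M}, b ∣ y → a' ∣ x → a * b = a' * b' → b ∣ b' := fun h h' e ↦
      (hxy.of_dvd_left h' |>.of_dvd_right h).symm.dvd_of_dvd_mul_left (e ▸ dvd_mul_left _ _)
    exact Prod.ext (dvd_antisymm (key h.1 h'.2 e) (key h'.1 h.2 e.symm))
      (dvd_antisymm (key' h.2 h'.1 e) (key' h'.2 h.1 e.symm))
  · intro b hb
    obtain ⟨c, d, hc, hd, rfl⟩ := exists_dvd_and_dvd_of_dvd_mul ((hs b).mp hb)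
    exact ⟨(c, d), Finset.mem_product.mpr ⟨(ht c).mpr hc, (hu d).mpr hd⟩, rfl⟩
  · intro p _
    rw [map_mul]

/-- The divisor sum of a multiplicative function with values `±1` is a natural number,
which is positive at squares of primes. -/
theorem exists_natCast_eq_sum_divisors {χ : M →* ℂ} (x : M) (hx : x ≠ 0) :
    (∀ b, b ∣ x → χ b ^ 2 = 1) → ∀ s : Finset M, (∀ b, b ∈ s ↔ b ∣ x) → ∃ k : ℕ, ∑ b ∈ s, χ b = k := by
  have : Nontrivial M := ⟨x, 0, hx⟩
  induction x using UniqueFactorizationMonoid.induction_on_coprime with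
  | h0 => exact (hx rfl).elim
  | h1 h =>
    rw [isUnit_iff_eq_one] at h
    subst h
    intro _ s hs
    have : s = {1} := by ext b; rw [hs, ← isUnit_iff_dvd_one, isUnit_iff_eq_one, Finset.mem_singleton]
    exact ⟨1, by simp [this]⟩
  | @hpr p n hp =>
    intro h s hs
    rw [sum_divisors_prime_pow hp n hs χ]
    rcases eq_or_ne n 0 with rfl | hn
    · exact ⟨1, by simp⟩
    · obtain ⟨k, hk, -⟩ := exists_natCast_eq_geom_sum (h p (dvd_pow_self p hn)) n
      exact ⟨k, hk⟩
  | @hcp x y hxy ihx ihy =>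
    intro h s hs
    have hx0 := left_ne_zero_of_mul hx
    have hy0 := right_ne_zero_of_mul hx
    obtain ⟨k, hk⟩ := ihx hx0 (fun b hb ↦ h b (hb.mul_right y)) (finite_setOf_dvd hx0).toFinset (by simp)
    obtain ⟨l, hl⟩ := ihy hy0 (fun b hb ↦ h b (hb.mul_left x)) (finite_setOf_dvd hy0).toFinset (by simp)
    exact ⟨k * l, by rw [sum_divisors_mul hxy hs (t := (finite_setOf_dvd hx0).toFinset)
      (u := (finite_setOf_dvd hy0).toFinset) (by simp) (by simp) χ, hk, hl, Nat.cast_mul]⟩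

end DivisorSums

noncomputable section QuadraticNonvanishing

open Real MeasureTheory
open scoped ENNReal Classical

variable {K : Type*} [Field K] [NumberField K]

variable (K) in
/-- The multiplicative self-convolution of the radial test function. -/
def radialConv (y : ℝ) : ℝ≥0∞ :=
  ∫⁻ v in Set.Ioi (0 : ℝ), radialGauss K (y / v) * radialGauss K v * .ofReal v⁻¹

theorem lintegral_radialGauss_mul {M N : ℝ} (hN : 0 < N) (t : ℝ) :
    ∫⁻ v in Set.Ioi (0 : ℝ), radialGauss K (t / v * M) * radialGauss K (v * N) * .ofReal v⁻¹ =
      radialConv K (t * (M * N)) := by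
  have hmeas := measurable_radialGauss K
  have h := lintegral_comp_mul_mul_rpow
    (f := fun y ↦ radialGauss K (t * (M * N) / y) * radialGauss K y) (by fun_prop) hN (-1)
  simp only [neg_add_cancel, neg_zero, rpow_zero, ENNReal.ofReal_one, one_mul, rpow_neg_one] at h
  rw [radialConv, ← h]
  refine setLIntegral_congr_fun measurableSet_Ioi fun v hv ↦ ?_
  have hv : 0 < v := hv
  congr 3
  field_simp

variable (K) in
theorem exists_le_radialConv : ∃ δ : ℝ≥0∞, δ ≠ 0 ∧ ∀ y, 0 < y → y ≤ 1 → δ ≤ radialConv K y := by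
  refine ⟨radialGauss K 1 * radialGauss K 2 * .ofReal 2⁻¹, ?_, fun y hy hy1 ↦ ?_⟩
  · have h1 := (radialGauss_pos (K := K) 1).ne'
    have h2 := (radialGauss_pos (K := K) 2).ne'
    simp [h1, h2]
  · calc _ = ∫⁻ _ in Set.Icc (1 : ℝ) 2, radialGauss K 1 * radialGauss K 2 * .ofReal 2⁻¹ := by
          rw [setLIntegral_const, Real.volume_Icc]; norm_num
      _ ≤ ∫⁻ v in Set.Icc (1 : ℝ) 2, radialGauss K (y / v) * radialGauss K v * .ofReal v⁻¹ := by
          refine setLIntegral_mono' measurableSet_Icc fun v hv ↦ ?_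
          have hv0 : 0 < v := one_pos.trans_le hv.1
          refine mul_le_mul' (mul_le_mul' (radialGauss_antitone (by positivity) ?_)
            (radialGauss_antitone hv0.le hv.2)) (ENNReal.ofReal_le_ofReal (inv_anti₀ hv0 hv.2))
          exact (div_le_one hv0).mpr (hy1.trans hv.1)
      _ ≤ _ := lintegral_mono_set fun v hv ↦ one_pos.trans_le hv.1

variable {m : ℕ} [hm : Fact (2 ≤ m)]

/-- The radial Gaussian sum over the integral ideals in a set of ray classes. -/
def classGauss (s : Finset (RayClass K m)) (t : ℝ) : ℝ≥0∞ :=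
  ∑' I : Ideal (𝓞 K), (if rayClass m I ∈ s then 1 else 0) * radialGauss K (t * Ideal.absNorm I)

theorem classGauss_eq_sum {s : Finset (RayClass K m)} (hs : ∀ r ∈ s, IsUnit r) (t : ℝ) :
    classGauss s t = ∑ r ∈ s, rayGauss m (rayRep r) t := by
  rw [classGauss, ← ENNReal.tsum_fiberwise _ (rayClass m), tsum_fintype, ← Finset.sum_subset (Finset.subset_univ s)]
  · refine Finset.sum_congr rfl fun r hr ↦ ?_
    rw [rayGauss, rayIdeals_rayRep (hs r hr)]
    exact tsum_congr fun I ↦ by rw [show rayClass m I.1 = r from I.2, if_pos hr, one_mul]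
  · intro r _ hr
    exact ENNReal.tsum_eq_zero.mpr fun I ↦ by rw [show rayClass m I.1 = r from I.2, if_neg hr, zero_mul]

theorem exists_hasPole_classGauss {s : Finset (RayClass K m)} (hs : ∀ r ∈ s, IsUnit r) :
    ∃ C, HasPole (s.card * (rayResidue K m).toReal) C (fun t ↦ ∑ r ∈ s, (rayGauss m (rayRep r) t).toReal) := by
  have h : ∀ r : RayClass K m, ∃ C, r ∈ s → HasPole (rayResidue K m).toReal C
      fun t ↦ (rayGauss m (rayRep r) t).toReal := by
    intro r
    by_cases hr : r ∈ s
    · obtain ⟨C, h0, h1⟩ := exists_rayGauss_bounds hm.out (rayRep_spec (hs r hr)).2.1 (rayRep_spec (hs r hr)).2.2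
      refine ⟨C, fun _ ↦ ⟨(measurable_rayGauss m _).ennreal_toReal, ENNReal.toReal_nonneg, ?_, h0, h1⟩⟩
      simpa using (abs_nonneg _).trans (h0 1 one_pos le_rfl)
    · exact ⟨0, fun h ↦ (hr h).elim⟩
  choose C hC using h
  refine ⟨∑ r ∈ s, C r, ?_⟩
  have := HasPole.sum hC
  simp only [Finset.sum_const, nsmul_eq_mul] at this
  convert this using 1
  ext t
  rw [Finset.sum_apply]

theorem classGauss_toReal {s : Finset (RayClass K m)} (hs : ∀ r ∈ s, IsUnit r) {t : ℝ} (ht : 0 < t) :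
    (classGauss s t).toReal = ∑ r ∈ s, (rayGauss m (rayRep r) t).toReal := by
  rw [classGauss_eq_sum hs, ENNReal.toReal_sum fun r _ ↦ rayGauss_ne_top m _ ht]

theorem classGauss_ne_top {s : Finset (RayClass K m)} (hs : ∀ r ∈ s, IsUnit r) {t : ℝ} (ht : 0 < t) :
    classGauss s t ≠ ⊤ := by
  rw [classGauss_eq_sum hs]
  exact ENNReal.sum_ne_top.mpr fun r _ ↦ rayGauss_ne_top m _ ht

/-- The multiplicative convolution of two sums over ideals. -/
def classConv (s s' : Finset (RayClass K m)) (t : ℝ) : ℝ≥0∞ :=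
  ∫⁻ v in Set.Ioi (0 : ℝ), classGauss s (t / v) * classGauss s' v * .ofReal v⁻¹

/-- The number of factorizations with factors in prescribed ray classes. -/
def factorCount (s s' : Finset (RayClass K m)) (𝔠 : Ideal (𝓞 K)) : ℝ≥0∞ :=
  ∑' p : {p : Ideal (𝓞 K) × Ideal (𝓞 K) // p.1 * p.2 = 𝔠},
    (if rayClass m p.1.1 ∈ s then 1 else 0) * (if rayClass m p.1.2 ∈ s' then 1 else 0)

theorem classConv_eq_tsum (s : Finset (RayClass K m)) {s' : Finset (RayClass K m)}
    (hs' : ∀ r ∈ s', IsUnit r) (t : ℝ) :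
    classConv s s' t = ∑' 𝔠 : Ideal (𝓞 K), factorCount s s' 𝔠 * radialConv K (t * Ideal.absNorm 𝔠) := by
  have := countable_ideal K
  have hmeas := measurable_radialGauss K
  have h1 : ∀ v, classGauss s (t / v) * classGauss s' v * .ofReal v⁻¹ =
      ∑' p : Ideal (𝓞 K) × Ideal (𝓞 K), (if rayClass m p.1 ∈ s then 1 else 0) *
        (if rayClass m p.2 ∈ s' then 1 else 0) * (radialGauss K (t / v * Ideal.absNorm p.1) *
          radialGauss K (v * Ideal.absNorm p.2) * .ofReal v⁻¹) := by
    intro v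
    rw [ENNReal.tsum_prod', classGauss, classGauss, ← ENNReal.tsum_mul_right, ← ENNReal.tsum_mul_right]
    refine tsum_congr fun I ↦ ?_
    rw [← ENNReal.tsum_mul_left, ← ENNReal.tsum_mul_right]
    exact tsum_congr fun J ↦ by ring
  rw [classConv]
  simp_rw [h1]
  rw [lintegral_tsum fun p ↦ (by fun_prop), ← ENNReal.tsum_fiberwise _ fun p ↦ p.1 * p.2]
  refine tsum_congr fun 𝔠 ↦ ?_
  rw [factorCount, ← ENNReal.tsum_mul_right]
  refine tsum_congr fun p ↦ ?_
  have hp : (Ideal.absNorm 𝔠 : ℝ) = Ideal.absNorm p.1.1 * Ideal.absNorm p.1.2 := by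
    rw [← Nat.cast_mul, ← map_mul, show p.1.1 * p.1.2 = 𝔠 from p.2]
  rw [lintegral_const_mul _ (by fun_prop)]
  by_cases h2 : rayClass m p.1.2 ∈ s'
  · rw [lintegral_radialGauss_mul, hp]
    exact_mod_cast absNorm_pos_of_ne_bot (ne_bot_of_isCoprime hm.out ((isUnit_rayClass_iff hm.out).mp (hs' _ h2)))
  · simp [h2]

theorem factorCount_eq_card {s : Finset (RayClass K m)} (hs : ∀ r, r ∈ s ↔ IsUnit r)
    (s' : Finset (RayClass K m)) {𝔠 : Ideal (𝓞 K)} (h : IsUnit (rayClass m 𝔠)) {D : Finset (Ideal (𝓞 K))}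
    (hD : ∀ I, I ∈ D ↔ I ∣ 𝔠) : factorCount s s' 𝔠 = (D.filter fun I ↦ rayClass m I ∈ s').card := by
  have h𝔠 : 𝔠 ≠ ⊥ := ne_bot_of_isCoprime hm.out ((isUnit_rayClass_iff hm.out).mp h)
  have hbij : Function.Bijective fun p : {p : Ideal (𝓞 K) × Ideal (𝓞 K) // p.1 * p.2 = 𝔠} ↦
      (⟨p.1.2, (hD _).mpr (Dvd.intro_left _ p.2)⟩ : D) := by
    constructor
    · rintro ⟨⟨I, J⟩, hp⟩ ⟨⟨I', J'⟩, hp'⟩ h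
      obtain rfl : J = J' := congrArg Subtype.val h
      simp only at hp hp'
      have hJ : J ≠ ⊥ := by rintro rfl; exact h𝔠 (hp ▸ Ideal.mul_bot I)
      obtain rfl := mul_right_cancel₀ hJ (hp.trans hp'.symm)
      rfl
    · rintro ⟨J, hJ⟩
      obtain ⟨I, hI⟩ := (hD J).mp hJ
      exact ⟨⟨(I, J), by rw [hI, mul_comm]⟩, rfl⟩
  have hfac : ∀ p : {p : Ideal (𝓞 K) × Ideal (𝓞 K) // p.1 * p.2 = 𝔠}, rayClass m p.1.1 ∈ s := fun p ↦
    (hs _).mpr (isUnit_of_dvd_unit (map_dvd (rayClass m) (Dvd.intro _ p.2)) h)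
  rw [factorCount]
  simp_rw [if_pos (hfac _), one_mul]
  refine ((Equiv.ofBijective _ hbij).tsum_eq
    fun J : D ↦ (if rayClass m J.1 ∈ s' then 1 else 0 : ℝ≥0∞)).trans ?_
  rw [tsum_fintype, Finset.sum_coe_sort D fun J ↦ (if rayClass m J ∈ s' then 1 else 0 : ℝ≥0∞), Finset.sum_boole]

omit [NumberField K] hm in
theorem factorCount_eq_zero {s s' : Finset (RayClass K m)} (hs : ∀ r ∈ s, IsUnit r)
    (hs' : ∀ r ∈ s', IsUnit r) {𝔠 : Ideal (𝓞 K)} (h : ¬ IsUnit (rayClass m 𝔠)) : factorCount s s' 𝔠 = 0 := by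
  refine ENNReal.tsum_eq_zero.mpr fun p ↦ ?_
  by_cases h1 : rayClass m p.1.1 ∈ s
  · by_cases h2 : rayClass m p.1.2 ∈ s'
    · refine (h ?_).elim
      rw [← p.2, map_mul]
      exact (hs _ h1).mul (hs' _ h2)
    · simp [h2]
  · simp [h1]

variable (K m) in
theorem exists_prime_isUnit_rayClass : ∃ P : Ideal (𝓞 K), Prime P ∧ IsUnit (rayClass m P) := by
  have h : ((1 + m : ℕ) : 𝓞 K) ∉ (⊥ : Ideal (𝓞 K)) := by
    rw [Ideal.mem_bot, Nat.cast_eq_zero]; omega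
  have hm2 := hm.out
  obtain ⟨P, hP, hle⟩ := Ideal.exists_le_maximal _
    (Ideal.span_singleton_ne_top (not_isUnit_natCast (K := K) (show 2 ≤ 1 + m by omega)))
  have hmem : ((1 + m : ℕ) : 𝓞 K) ∈ P := hle (Ideal.mem_span_singleton_self _)
  refine ⟨P, Ideal.prime_of_isPrime (fun hb ↦ h (hb ▸ hmem)) hP.isPrime, (isUnit_rayClass_iff hm.out).mpr ?_⟩
  rw [Ideal.isCoprime_iff_exists]
  refine ⟨_, hmem, -m, neg_mem (Ideal.mem_span_singleton_self _), by push_cast; ring⟩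

/-- The classes on which a character takes a given value. -/
def charFiber (ψ : MulChar (RayClass K m) ℂ) (z : ℂ) : Finset (RayClass K m) :=
  Finset.univ.filter fun r ↦ ψ r = z

theorem mem_charFiber {ψ : MulChar (RayClass K m) ℂ} {z : ℂ} {r : RayClass K m} :
    r ∈ charFiber ψ z ↔ ψ r = z := by
  simp [charFiber]

theorem isUnit_of_mem_charFiber {ψ : MulChar (RayClass K m) ℂ} {z : ℂ} (hz : z ≠ 0) :
    ∀ r ∈ charFiber ψ z, IsUnit r := by
  intro r hr
  by_contra h
  exact hz ((mem_charFiber.mp hr).symm.trans (ψ.map_nonunit h))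

section QuadraticCharacter

variable {ψ : MulChar (RayClass K m) ℂ} (hψ : ∀ r, ψ r = 0 ∨ ψ r = 1 ∨ ψ r = -1)

include hψ

theorem sum_quadraticChar_mul {ι : Type*} (s : Finset ι) (r : ι → RayClass K m) (f : ι → ℂ) :
    ∑ i ∈ s, ψ (r i) * f i = ∑ i ∈ s.filter (fun i ↦ r i ∈ charFiber ψ 1), f i -
      ∑ i ∈ s.filter (fun i ↦ r i ∈ charFiber ψ (-1)), f i := by
  rw [Finset.sum_filter, Finset.sum_filter, ← Finset.sum_sub_distrib]
  refine Finset.sum_congr rfl fun i _ ↦ ?_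
  simp only [mem_charFiber]
  rcases hψ (r i) with h | h | h <;> rw [h] <;> norm_num

theorem factorCount_add_le {U : Finset (RayClass K m)} (hU : ∀ r, r ∈ U ↔ IsUnit r) {P : Ideal (𝓞 K)}
    (hP : Prime P) (hPm : IsUnit (rayClass m P)) (𝔠 : Ideal (𝓞 K)) :
    factorCount U (charFiber ψ (-1)) 𝔠 + (if 𝔠 ∈ Set.range fun i : ℕ ↦ P ^ (2 * i) then 1 else 0) ≤
      factorCount U (charFiber ψ 1) 𝔠 := by
  have hsq : ∀ r, IsUnit r → ψ r ^ 2 = 1 := by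
    intro r hr
    have h0 : ψ r ≠ 0 := (hr.map ψ).ne_zero
    rcases hψ r with h | h | h
    · exact (h0 h).elim
    all_goals rw [h]; norm_num
  by_cases h : IsUnit (rayClass m 𝔠)
  · have h𝔠 : 𝔠 ≠ ⊥ := ne_bot_of_isCoprime hm.out ((isUnit_rayClass_iff hm.out).mp h)
    set D := (finite_setOf_dvd h𝔠).toFinset with hD
    have hD' : ∀ I, I ∈ D ↔ I ∣ 𝔠 := by simp [hD]
    let χ : Ideal (𝓞 K) →* ℂ := ψ.toMonoidHom.comp (rayClass m)
    have hχ : ∀ I, χ I = ψ (rayClass m I) := fun _ ↦ rfl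
    have hχ2 : ∀ I, I ∣ 𝔠 → χ I ^ 2 = 1 := fun I hI ↦
      hsq _ (isUnit_of_dvd_unit (map_dvd (rayClass m) hI) h)
    obtain ⟨k, hk, hk1⟩ : ∃ k : ℕ, ∑ I ∈ D, χ I = k ∧ ((𝔠 ∈ Set.range fun i : ℕ ↦ P ^ (2 * i)) → 1 ≤ k) := by
      by_cases hc : 𝔠 ∈ Set.range fun i : ℕ ↦ P ^ (2 * i)
      · obtain ⟨i, rfl⟩ := hc
        obtain ⟨k, hk, hk1⟩ := exists_natCast_eq_geom_sum (hsq _ hPm) (2 * i)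
        exact ⟨k, (sum_divisors_prime_pow hP _ hD' χ).trans hk, fun _ ↦ hk1 (even_two_mul i)⟩
      · obtain ⟨k, hk⟩ := exists_natCast_eq_sum_divisors 𝔠 h𝔠 hχ2 D hD'
        exact ⟨k, hk, fun h ↦ (hc h).elim⟩
    rw [factorCount_eq_card hU _ h hD', factorCount_eq_card hU _ h hD']
    have h1 := sum_quadraticChar_mul hψ D (fun I ↦ rayClass m I) 1
    simp only [Pi.one_apply, mul_one, Finset.sum_const, nsmul_eq_mul] at h1
    simp only [hχ] at hk
    rw [hk] at h1
    have h2 : (D.filter fun I ↦ rayClass m I ∈ charFiber ψ (-1)).card + k =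
        (D.filter fun I ↦ rayClass m I ∈ charFiber ψ 1).card := by
      have : ((k : ℂ) + (D.filter fun I ↦ rayClass m I ∈ charFiber ψ (-1)).card) =
        (D.filter fun I ↦ rayClass m I ∈ charFiber ψ 1).card := by rw [h1]; ring
      rw [add_comm]
      exact_mod_cast this
    rw [← h2, Nat.cast_add]
    refine add_le_add le_rfl ?_
    split_ifs with hc
    · exact_mod_cast hk1 hc
    · exact zero_le
  · rw [if_neg, add_zero, factorCount_eq_zero (fun r ↦ (hU r).mp) (isUnit_of_mem_charFiber (by norm_num)) h]
    · exact zero_le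
    · rintro ⟨i, rfl⟩
      exact h (by rw [map_pow]; exact hPm.pow _)

theorem integral_classGauss_eq (h1 : ψ ≠ 1) (h : rayLValue ψ = 0) :
    (charFiber ψ 1).card = (charFiber ψ (-1)).card ∧
    ∑ r ∈ charFiber ψ 1, ∫ t in Set.Ioi (0 : ℝ), rayGaussRegular m (rayRep r) t =
      ∑ r ∈ charFiber ψ (-1), ∫ t in Set.Ioi (0 : ℝ), rayGaussRegular m (rayRep r) t := by
  have hf : ∀ z, Finset.univ.filter (fun r ↦ r ∈ charFiber ψ z) = charFiber ψ z := fun z ↦ by ext; simp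
  constructor
  · have h2 := sum_quadraticChar_mul hψ Finset.univ id 1
    simp only [id, Pi.one_apply, mul_one, MulChar.sum_eq_zero_of_ne_one h1, hf, Finset.sum_const,
      nsmul_eq_mul] at h2
    exact_mod_cast sub_eq_zero.mp h2.symm
  · have h2 := sum_quadraticChar_mul hψ Finset.univ id
      fun r ↦ ((∫ t in Set.Ioi (0 : ℝ), rayGaussRegular m (rayRep r) t : ℝ) : ℂ)
    rw [rayLValue] at h
    simp only [id, hf, h] at h2
    exact_mod_cast sub_eq_zero.mp h2.symm

end QuadraticCharacter

theorem integral_removePole_sum {s : Finset (RayClass K m)} (hs : ∀ r ∈ s, IsUnit r) :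
    ∫ t in Set.Ioi (0 : ℝ), removePole (s.card * (rayResidue K m).toReal)
      (fun t ↦ ∑ r ∈ s, (rayGauss m (rayRep r) t).toReal) t =
    ∑ r ∈ s, ∫ t in Set.Ioi (0 : ℝ), rayGaussRegular m (rayRep r) t := by
  rw [← integral_finsetSum]
  · refine integral_congr_ae (.of_forall fun t ↦ ?_)
    simp only [rayGaussRegular, removePole, Finset.sum_sub_distrib, Finset.sum_const, nsmul_eq_mul]
    split_ifs <;> ring
  · intro r hr
    obtain ⟨C, h0, h1⟩ := exists_rayGauss_bounds hm.out (rayRep_spec (hs r hr)).2.1 (rayRep_spec (hs r hr)).2.2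
    exact HasPole.integrableOn_removePole ⟨(measurable_rayGauss m _).ennreal_toReal, ENNReal.toReal_nonneg,
      by simpa using (abs_nonneg _).trans (h0 1 one_pos le_rfl), h0, h1⟩

theorem classConv_eq_ofReal {s s' : Finset (RayClass K m)} (hs : ∀ r ∈ s, IsUnit r)
    (hs' : ∀ r ∈ s', IsUnit r) {t : ℝ} (ht : 0 < t) : classConv s s' t =
      .ofReal (∫ v in Set.Ioi (0 : ℝ), (∑ r ∈ s, (rayGauss m (rayRep r) (t / v)).toReal) *
        (∑ r ∈ s', (rayGauss m (rayRep r) v).toReal) * v⁻¹) := by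
  obtain ⟨C, hC⟩ := exists_hasPole_classGauss hs
  obtain ⟨C', hC'⟩ := exists_hasPole_classGauss hs'
  rw [ofReal_integral_eq_lintegral_ofReal (hC.integrableOn_conv hC' ht)]
  · refine setLIntegral_congr_fun measurableSet_Ioi fun v hv ↦ ?_
    have hv : 0 < v := hv
    rw [← classGauss_toReal hs (by positivity), ← classGauss_toReal hs' hv, ENNReal.ofReal_mul (by positivity),
      ENNReal.ofReal_mul (by positivity), ENNReal.ofReal_toReal (classGauss_ne_top hs (by positivity)),
      ENNReal.ofReal_toReal (classGauss_ne_top hs' hv)]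
  · refine (ae_restrict_iff' measurableSet_Ioi).mpr (.of_forall fun v hv ↦ ?_)
    have hv : 0 < v := hv
    simp only [Pi.zero_apply]
    positivity

/-- The `L`-value of a nontrivial quadratic ray class character does not vanish. -/
theorem rayLValue_ne_zero_of_quadratic {ψ : MulChar (RayClass K m) ℂ} (h1 : ψ ≠ 1)
    (hψ : ∀ r, ψ r = 0 ∨ ψ r = 1 ∨ ψ r = -1) : rayLValue ψ ≠ 0 := by
  intro h
  obtain ⟨hcard, hint⟩ := integral_classGauss_eq hψ h1 h
  set s := charFiber ψ 1
  set s' := charFiber ψ (-1)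
  have hs : ∀ r ∈ s, IsUnit r := isUnit_of_mem_charFiber (by norm_num)
  have hs' : ∀ r ∈ s', IsUnit r := isUnit_of_mem_charFiber (by norm_num)
  set U : Finset (RayClass K m) := Finset.univ.filter IsUnit
  have hU : ∀ r, r ∈ U ↔ IsUnit r := fun r ↦ by simp [U]
  obtain ⟨D, hD⟩ := exists_hasPole_classGauss fun r ↦ (hU r).mp
  obtain ⟨C, hC⟩ := exists_hasPole_classGauss hs
  obtain ⟨C', hC'⟩ := exists_hasPole_classGauss hs'
  rw [← integral_removePole_sum hs, ← integral_removePole_sum hs'] at hint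
  rw [← hcard] at hC' hint
  obtain ⟨B, hB⟩ := hD.exists_conv_le hC hC' hint
  obtain ⟨P, hP, hPm⟩ := exists_prime_isUnit_rayClass K m
  obtain ⟨δ, hδ, hE⟩ := exists_le_radialConv K
  obtain ⟨n, hn⟩ := ENNReal.exists_nat_mul_gt hδ (ENNReal.ofReal_ne_top (r := B))
  have hN : 0 < (Ideal.absNorm P : ℝ) := by exact_mod_cast absNorm_pos_of_ne_bot hP.ne_zero
  have hN1 : 1 ≤ (Ideal.absNorm P : ℝ) := by exact_mod_cast absNorm_pos_of_ne_bot hP.ne_zero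
  set t : ℝ := ((Ideal.absNorm P : ℝ) ^ (2 * n))⁻¹ with ht
  have ht0 : 0 < t := by positivity
  have hupper : classConv U s t ≤ classConv U s' t + .ofReal B := by
    rw [classConv_eq_ofReal (fun r ↦ (hU r).mp) hs ht0, classConv_eq_ofReal (fun r ↦ (hU r).mp) hs' ht0]
    exact (ENNReal.ofReal_le_ofReal (hB t ht0)).trans ENNReal.ofReal_add_le
  have hlower : classConv U s' t + n * δ ≤ classConv U s t := by
    rw [classConv_eq_tsum U hs, classConv_eq_tsum U hs']
    calc _ ≤ ∑' 𝔠 : Ideal (𝓞 K), factorCount U s' 𝔠 * radialConv K (t * Ideal.absNorm 𝔠) +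
          ∑' 𝔠 : Ideal (𝓞 K), (if 𝔠 ∈ Set.range fun i : ℕ ↦ P ^ (2 * i) then 1 else 0) *
            radialConv K (t * Ideal.absNorm 𝔠) := ?_
      _ = ∑' 𝔠 : Ideal (𝓞 K), (factorCount U s' 𝔠 +
          (if 𝔠 ∈ Set.range fun i : ℕ ↦ P ^ (2 * i) then 1 else 0)) *
            radialConv K (t * Ideal.absNorm 𝔠) := by rw [← ENNReal.tsum_add]; simp_rw [add_mul]
      _ ≤ _ := ENNReal.tsum_le_tsum fun 𝔠 ↦ mul_le_mul_left (factorCount_add_le hψ hU hP hPm 𝔠) _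
    refine add_le_add le_rfl ?_
    have hinj : Function.Injective fun i : ℕ ↦ P ^ (2 * i) := fun i j hij ↦ by
      have := pow_injective_of_not_isUnit hP.not_isUnit hP.ne_zero hij
      omega
    refine le_trans ?_ (ENNReal.sum_le_tsum ((Finset.range n).image fun i : ℕ ↦ P ^ (2 * i)))
    rw [Finset.sum_image hinj.injOn, ← nsmul_eq_mul, ← Finset.card_range n, ← Finset.sum_const, Finset.card_range]
    refine Finset.sum_le_sum fun i hi ↦ ?_
    rw [if_pos ⟨i, rfl⟩, one_mul, map_pow, Nat.cast_pow]
    refine hE _ (by positivity) ?_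
    rw [ht, inv_mul_le_one₀ (by positivity)]
    exact pow_le_pow_right₀ hN1 (by have := Finset.mem_range.mp hi; omega)
  have hfin : classConv U s' t ≠ ⊤ := by
    rw [classConv_eq_ofReal (fun r ↦ (hU r).mp) hs' ht0]
    exact ENNReal.ofReal_ne_top
  exact absurd ((ENNReal.add_le_add_iff_left hfin).mp (hlower.trans hupper)) hn.not_ge

end QuadraticNonvanishing

noncomputable section EulerProduct

open Filter Topology
open scoped Classical

variable {K : Type*} [Field K] [NumberField K]

theorem exists_heightOneSpectrum_dvd {I : Ideal (𝓞 K)} (hI : I ≠ 1) :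
    ∃ v : HeightOneSpectrum (𝓞 K), v.asIdeal ∣ I := by
  rcases eq_or_ne I ⊥ with rfl | h0
  · obtain ⟨P, hP, -⟩ := exists_prime_isUnit_rayClass K 2 (hm := ⟨le_rfl⟩)
    exact ⟨⟨P, Ideal.isPrime_of_prime hP, hP.ne_zero⟩, dvd_zero _⟩
  · obtain ⟨P, hP, hle⟩ := Ideal.exists_le_maximal I (by rwa [← Ideal.one_eq_top])
    exact ⟨⟨P, hP.isPrime, ne_bot_of_le_ne_bot h0 hle⟩, Ideal.dvd_iff_le.mpr hle⟩

variable {f : Ideal (𝓞 K) →*₀ ℂ}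

theorem tsum_ite_insert (hf : Summable fun I ↦ ‖f I‖) {S : Finset (HeightOneSpectrum (𝓞 K))}
    {v : HeightOneSpectrum (𝓞 K)} (hv : v ∉ S) :
    ∑' I, (if ∀ w ∈ insert v S, ¬ w.asIdeal ∣ I then f I else 0) =
      (1 - f v.asIdeal) * ∑' I, (if ∀ w ∈ S, ¬ w.asIdeal ∣ I then f I else 0) := by
  set g : Ideal (𝓞 K) → ℂ := fun I ↦ if ∀ w ∈ S, ¬ w.asIdeal ∣ I then f I else 0 with hg
  set h : Ideal (𝓞 K) → ℂ := fun I ↦ if v.asIdeal ∣ I then g I else 0 with hh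
  have hgs : Summable g := .of_norm_bounded hf fun I ↦ by
    simp only [hg]; split_ifs <;> simp
  have hhs : Summable h := .of_norm_bounded hf fun I ↦ by
    simp only [hh, hg]; split_ifs <;> simp
  have h1 : ∑' I, h I = f v.asIdeal * ∑' I, g I := by
    rw [← tsum_mul_left]
    have hinj : Function.Injective fun I : Ideal (𝓞 K) ↦ v.asIdeal * I :=
      fun I J hIJ ↦ mul_left_cancel₀ v.ne_bot hIJ
    rw [← hinj.tsum_eq]
    · refine tsum_congr fun I ↦ ?_
      have : (∀ w ∈ S, ¬ w.asIdeal ∣ v.asIdeal * I) ↔ ∀ w ∈ S, ¬ w.asIdeal ∣ I := by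
        refine forall₂_congr fun w hw ↦ not_congr ⟨fun hd ↦ ?_, fun hd ↦ hd.mul_left _⟩
        refine (w.prime.dvd_or_dvd hd).resolve_left fun hd ↦ hv ?_
        have : w = v := HeightOneSpectrum.ext
          (v.isMaximal.eq_of_le w.isPrime.ne_top (Ideal.dvd_iff_le.mp hd)).symm
        exact this ▸ hw
      simp only [hh, hg, dvd_mul_right, if_true, this, map_mul, mul_ite, mul_zero]
    · intro I hI
      have : v.asIdeal ∣ I := by
        by_contra hd
        exact hI (by simp only [hh, if_neg hd])
      obtain ⟨J, rfl⟩ := this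
      exact ⟨J, rfl⟩
  rw [sub_mul, one_mul, ← h1, ← hgs.tsum_sub hhs]
  refine tsum_congr fun I ↦ ?_
  simp only [hh, hg, Finset.forall_mem_insert]
  split_ifs <;> simp_all

theorem tsum_ite_eq_prod_mul (hf : Summable fun I ↦ ‖f I‖) (S : Finset (HeightOneSpectrum (𝓞 K))) :
    ∑' I, (if ∀ w ∈ S, ¬ w.asIdeal ∣ I then f I else 0) = (∏ v ∈ S, (1 - f v.asIdeal)) * ∑' I, f I := by
  induction S using Finset.induction_on with
  | empty => simp
  | insert v S hv ih => rw [tsum_ite_insert hf hv, ih, Finset.prod_insert hv, mul_assoc]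

/-- The Euler product of a completely multiplicative function on ideals. -/
theorem tendsto_prod_mul_tsum (hf : Summable fun I ↦ ‖f I‖) :
    Tendsto (fun S : Finset (HeightOneSpectrum (𝓞 K)) ↦ (∏ v ∈ S, (1 - f v.asIdeal)) * ∑' I, f I)
      atTop (𝓝 1) := by
  simp_rw [← tsum_ite_eq_prod_mul hf]
  have h1 : ∑' I : Ideal (𝓞 K), (if I = 1 then (1 : ℂ) else 0) = 1 := tsum_ite_eq 1 _
  rw [← h1]
  refine tendsto_tsum_of_dominated_convergence hf (fun I ↦ ?_) (.of_forall fun S I ↦ ?_)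
  · split_ifs with hI
    · subst hI
      refine tendsto_const_nhds.congr fun S ↦ ?_
      rw [if_pos fun w _ h ↦ w.prime.not_isUnit (isUnit_of_dvd_one h), map_one]
    · obtain ⟨v, hv⟩ := exists_heightOneSpectrum_dvd hI
      refine tendsto_const_nhds.congr' ?_
      filter_upwards [eventually_ge_atTop {v}] with S hS
      rw [if_neg fun h ↦ h v (hS (Finset.mem_singleton_self v)) hv]
  · split_ifs <;> simp

omit [NumberField K] in
theorem injective_asIdeal : Function.Injective fun v : HeightOneSpectrum (𝓞 K) ↦ v.asIdeal :=
  fun _ _ h ↦ HeightOneSpectrum.ext h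

theorem exp_neg_tsum_log (hf : Summable fun I ↦ ‖f I‖)
    (hf1 : ∀ v : HeightOneSpectrum (𝓞 K), ‖f v.asIdeal‖ ≤ 1 / 2) :
    Complex.exp (-∑' v : HeightOneSpectrum (𝓞 K), Complex.log (1 - f v.asIdeal)) = ∑' I, f I := by
  have hs : Summable fun v : HeightOneSpectrum (𝓞 K) ↦ ‖f v.asIdeal‖ := hf.comp_injective injective_asIdeal
  have hlog : Summable fun v : HeightOneSpectrum (𝓞 K) ↦ Complex.log (1 - f v.asIdeal) := by
    simpa [sub_eq_add_neg] using Complex.summable_log_one_add_of_summable hs.of_norm.neg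
  have h0 : ∀ v : HeightOneSpectrum (𝓞 K), 1 - f v.asIdeal ≠ 0 := fun v h ↦ by
    have := hf1 v
    rw [← sub_eq_zero.mp h, norm_one] at this
    norm_num at this
  have h1 : Tendsto (fun S : Finset (HeightOneSpectrum (𝓞 K)) ↦ ∏ v ∈ S, (1 - f v.asIdeal)) atTop
      (𝓝 (Complex.exp (∑' v : HeightOneSpectrum (𝓞 K), Complex.log (1 - f v.asIdeal)))) := by
    refine ((Complex.continuous_exp.tendsto _).comp hlog.hasSum).congr fun S ↦ ?_
    simp only [Function.comp_apply, Complex.exp_sum]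
    exact Finset.prod_congr rfl fun v _ ↦ Complex.exp_log (h0 v)
  have h2 := tendsto_nhds_unique (h1.mul_const _) (tendsto_prod_mul_tsum hf)
  rw [Complex.exp_neg]
  exact (eq_inv_of_mul_eq_one_right h2).symm

theorem norm_log_one_sub_add_le {z : ℂ} (hz : ‖z‖ ≤ 1 / 2) : ‖Complex.log (1 - z) + z‖ ≤ ‖z‖ ^ 2 := by
  have h := Complex.norm_log_one_add_sub_self_le (z := -z) (by rw [norm_neg]; linarith)
  rw [norm_neg, sub_neg_eq_add, ← sub_eq_add_neg] at h
  refine h.trans ?_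
  have h1 : (1 - ‖z‖)⁻¹ ≤ 2 := by
    rw [inv_le_comm₀ (by linarith) two_pos]; linarith
  nlinarith [sq_nonneg ‖z‖]

theorem norm_log_one_sub_le {z : ℂ} (hz : ‖z‖ ≤ 1 / 2) : ‖Complex.log (1 - z)‖ ≤ 2 * ‖z‖ := by
  have h := norm_log_one_sub_add_le hz
  have h1 : ‖Complex.log (1 - z)‖ ≤ ‖Complex.log (1 - z) + z‖ + ‖z‖ := by
    simpa using norm_sub_le (Complex.log (1 - z) + z) z
  nlinarith [norm_nonneg z]

end EulerProduct

noncomputable section Nonvanishing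

open Filter Topology
open scoped Classical

variable {K : Type*} [Field K] [NumberField K]

/-- The Dirichlet series over the primes with given coefficients, at a real argument. -/
def primeSum (f : HeightOneSpectrum (𝓞 K) → ℂ) (s : ℝ) : ℂ :=
  ∑' v : HeightOneSpectrum (𝓞 K), f v * ((Ideal.absNorm v.asIdeal : ℝ) ^ (-s) : ℝ)

theorem two_le_absNorm (v : HeightOneSpectrum (𝓞 K)) : (2 : ℝ) ≤ Ideal.absNorm v.asIdeal := by
  have h0 : 0 < Ideal.absNorm v.asIdeal := by exact_mod_cast absNorm_pos_of_ne_bot v.ne_bot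
  have h1 : Ideal.absNorm v.asIdeal ≠ 1 := fun h ↦ v.isPrime.ne_top (Ideal.absNorm_eq_one_iff.mp h)
  have h2 : 2 ≤ Ideal.absNorm v.asIdeal := by omega
  exact_mod_cast h2

theorem absNorm_rpow_le_half (v : HeightOneSpectrum (𝓞 K)) {s : ℝ} (hs : 1 ≤ s) :
    (Ideal.absNorm v.asIdeal : ℝ) ^ (-s) ≤ 1 / 2 := by
  have h := two_le_absNorm v
  calc _ ≤ (Ideal.absNorm v.asIdeal : ℝ) ^ (-1 : ℝ) := Real.rpow_le_rpow_of_exponent_le (by linarith) (by linarith)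
    _ ≤ _ := by
      rw [Real.rpow_neg_one, one_div]
      exact inv_anti₀ two_pos h

theorem summable_prime_rpow {s : ℝ} (hs : 1 < s) :
    Summable fun v : HeightOneSpectrum (𝓞 K) ↦ (Ideal.absNorm v.asIdeal : ℝ) ^ (-s) :=
  (summable_absNorm_rpow hs).comp_injective injective_asIdeal

theorem norm_term_le {f : HeightOneSpectrum (𝓞 K) → ℂ} {B : ℝ} (hf : ∀ v, ‖f v‖ ≤ B)
    (s : ℝ) (v : HeightOneSpectrum (𝓞 K)) :
    ‖f v * ((Ideal.absNorm v.asIdeal : ℝ) ^ (-s) : ℝ)‖ ≤ B * (Ideal.absNorm v.asIdeal : ℝ) ^ (-s) := by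
  rw [norm_mul, Complex.norm_real, Real.norm_of_nonneg (by positivity)]
  exact mul_le_mul_of_nonneg_right (hf v) (by positivity)

theorem summable_primeSum {f : HeightOneSpectrum (𝓞 K) → ℂ} {B : ℝ} (hf : ∀ v, ‖f v‖ ≤ B) {s : ℝ} (hs : 1 < s) :
    Summable fun v : HeightOneSpectrum (𝓞 K) ↦ f v * ((Ideal.absNorm v.asIdeal : ℝ) ^ (-s) : ℝ) :=
  .of_norm_bounded ((summable_prime_rpow hs).mul_left B) (norm_term_le hf s)

variable {m : ℕ} [hm : Fact (2 ≤ m)]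

/-- The general term of `rayLSeries`, as a multiplicative function. -/
def rayTerm (ψ : MulChar (RayClass K m) ℂ) (s : ℝ) : Ideal (𝓞 K) →*₀ ℂ where
  toFun I := ψ (rayClass m I) * ((Ideal.absNorm I : ℝ) ^ (-s) : ℝ)
  map_zero' := by
    rw [ψ.map_nonunit, zero_mul]
    exact fun h ↦ ne_bot_of_isCoprime hm.out ((isUnit_rayClass_iff hm.out).mp h) rfl
  map_one' := by rw [map_one, map_one, map_one]; simp
  map_mul' I J := by
    rw [map_mul, map_mul, map_mul, Nat.cast_mul, Real.mul_rpow (by positivity) (by positivity)]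
    push_cast
    ring

theorem rayTerm_apply (ψ : MulChar (RayClass K m) ℂ) (s : ℝ) (I : Ideal (𝓞 K)) :
    rayTerm ψ s I = ψ (rayClass m I) * ((Ideal.absNorm I : ℝ) ^ (-s) : ℝ) := rfl

theorem norm_rayTerm_le (ψ : MulChar (RayClass K m) ℂ) (s : ℝ) (v : HeightOneSpectrum (𝓞 K)) :
    ‖rayTerm ψ s v.asIdeal‖ ≤ (Ideal.absNorm v.asIdeal : ℝ) ^ (-s) :=
  (norm_term_le (f := fun w ↦ ψ (rayClass m w.asIdeal)) (fun _ ↦ norm_mulChar_le_one ψ _) s v).trans_eq (one_mul _)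

theorem norm_rayTerm_le_half (ψ : MulChar (RayClass K m) ℂ) {s : ℝ} (hs : 1 ≤ s) (v : HeightOneSpectrum (𝓞 K)) :
    ‖rayTerm ψ s v.asIdeal‖ ≤ 1 / 2 :=
  (norm_rayTerm_le ψ s v).trans (absNorm_rpow_le_half v hs)

/-- A logarithm of `rayLSeries`. -/
def rayLog (ψ : MulChar (RayClass K m) ℂ) (s : ℝ) : ℂ :=
  -∑' v : HeightOneSpectrum (𝓞 K), Complex.log (1 - rayTerm ψ s v.asIdeal)

theorem exp_rayLog (ψ : MulChar (RayClass K m) ℂ) {s : ℝ} (hs : 1 < s) :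
    Complex.exp (rayLog ψ s) = rayLSeries ψ s :=
  exp_neg_tsum_log (summable_norm_rayLSeries ψ hs) (norm_rayTerm_le_half ψ hs.le)

theorem continuousOn_rayLog (ψ : MulChar (RayClass K m) ℂ) : ContinuousOn (rayLog ψ) (Set.Ioi 1) := by
  intro s hs
  have hs : 1 < s := hs
  refine ContinuousAt.continuousWithinAt (ContinuousOn.continuousAt (s := Set.Ici ((1 + s) / 2)) ?_
    (Ici_mem_nhds (by linarith)))
  refine (continuousOn_tsum (fun v t ht ↦ ?_) ((summable_prime_rpow (K := K)
    (show 1 < (1 + s) / 2 by linarith)).mul_left 2) fun v t ht ↦ ?_).neg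
  · have ht : (1 + s) / 2 ≤ t := ht
    refine ContinuousAt.continuousWithinAt (ContinuousAt.clog ?_ ?_)
    · have h0 : (Ideal.absNorm v.asIdeal : ℝ) ≠ 0 := by linarith [two_le_absNorm v]
      have : ContinuousAt (fun t : ℝ ↦ (Ideal.absNorm v.asIdeal : ℝ) ^ (-t)) t :=
        (Real.continuousAt_const_rpow h0).comp continuousAt_neg
      simp only [rayTerm_apply]
      exact continuousAt_const.sub (continuousAt_const.mul (Complex.continuous_ofReal.continuousAt.comp this))
    · refine Complex.mem_slitPlane_of_norm_lt_one (z := -rayTerm ψ t v.asIdeal) ?_ |> (by simpa [sub_eq_add_neg] using ·)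
      rw [norm_neg]
      exact (norm_rayTerm_le_half ψ (by linarith) v).trans_lt (by norm_num)
  · have ht : (1 + s) / 2 ≤ t := ht
    refine (norm_log_one_sub_le (norm_rayTerm_le_half ψ (by linarith) v)).trans ?_
    refine mul_le_mul_of_nonneg_left ((norm_rayTerm_le ψ t v).trans ?_) zero_le_two
    exact Real.rpow_le_rpow_of_exponent_le (by linarith [two_le_absNorm v]) (by linarith)

variable (K) in
theorem exists_norm_rayLog_sub_le (m : ℕ) [Fact (2 ≤ m)] : ∃ Z, ∀ (ψ : MulChar (RayClass K m) ℂ) (s : ℝ), 1 < s →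
    ‖rayLog ψ s - primeSum (fun v ↦ ψ (rayClass m v.asIdeal)) s‖ ≤ Z := by
  refine ⟨∑' v : HeightOneSpectrum (𝓞 K), (Ideal.absNorm v.asIdeal : ℝ) ^ (-2 : ℝ), fun ψ s hs ↦ ?_⟩
  have hs1 : Summable fun v : HeightOneSpectrum (𝓞 K) ↦ rayTerm ψ s v.asIdeal :=
    summable_primeSum (f := fun v ↦ ψ (rayClass m v.asIdeal)) (fun v ↦ norm_mulChar_le_one ψ _) hs
  have hlog : Summable fun v : HeightOneSpectrum (𝓞 K) ↦ Complex.log (1 - rayTerm ψ s v.asIdeal) := by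
    simpa [sub_eq_add_neg] using Complex.summable_log_one_add_of_summable hs1.neg
  rw [rayLog, primeSum, ← norm_neg, neg_sub, sub_neg_eq_add, add_comm]
  simp_rw [← rayTerm_apply]
  rw [← hlog.tsum_add hs1]
  refine tsum_of_norm_bounded (summable_prime_rpow one_lt_two).hasSum fun v ↦ ?_
  refine (norm_log_one_sub_add_le (norm_rayTerm_le_half ψ hs.le v)).trans ?_
  have h := two_le_absNorm v
  calc _ ≤ ((Ideal.absNorm v.asIdeal : ℝ) ^ (-s)) ^ 2 := by
        gcongr; exact norm_rayTerm_le ψ s v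
    _ = (Ideal.absNorm v.asIdeal : ℝ) ^ (-s * 2) := by
        rw [Real.rpow_mul (by positivity), ← Real.rpow_natCast]; norm_num
    _ ≤ _ := Real.rpow_le_rpow_of_exponent_le (by linarith) (by linarith)

theorem tendsto_sub_one : Tendsto (fun s : ℝ ↦ s - 1) (𝓝[>] 1) (𝓝 0) := by
  have : Tendsto (fun s : ℝ ↦ s - 1) (𝓝 1) (𝓝 (1 - 1)) := tendsto_id.sub_const 1
  rw [sub_self] at this
  exact this.mono_left nhdsWithin_le_nhds

theorem eventually_Ioc : ∀ᶠ s : ℝ in 𝓝[>] 1, 1 < s ∧ s ≤ 2 := by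
  filter_upwards [Ioc_mem_nhdsGT (one_lt_two (α := ℝ))] with s hs using hs

theorem tendsto_rayLSeries {ψ : MulChar (RayClass K m) ℂ} (h1 : ψ ≠ 1) :
    Tendsto (fun s : ℝ ↦ (radialMellin K s).toReal * rayLSeries ψ s) (𝓝[>] 1) (𝓝 (rayLValue ψ)) := by
  obtain ⟨C, hC⟩ := exists_norm_rayLSeries_sub_le ψ
  rw [tendsto_iff_norm_sub_tendsto_zero]
  refine squeeze_zero' (.of_forall fun _ ↦ norm_nonneg _) ?_ (by simpa using tendsto_sub_one.const_mul C)
  filter_upwards [eventually_Ioc] with s hs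
  simpa [MulChar.sum_eq_zero_of_ne_one h1] using hC s hs.1 hs.2

theorem tendsto_rayLSeries_one :
    Tendsto (fun s : ℝ ↦ ((s - 1) * (radialMellin K s).toReal : ℝ) * rayLSeries (1 : MulChar (RayClass K m) ℂ) s)
      (𝓝[>] 1) (𝓝 (Fintype.card (RayClass K m)ˣ * (rayResidue K m).toReal : ℝ)) := by
  obtain ⟨C, hC⟩ := exists_norm_rayLSeries_sub_le (1 : MulChar (RayClass K m) ℂ)
  rw [tendsto_iff_norm_sub_tendsto_zero]
  refine squeeze_zero' (g := fun s ↦ (s - 1) * (C * (s - 1) + ‖rayLValue (1 : MulChar (RayClass K m) ℂ)‖))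
    (.of_forall fun _ ↦ norm_nonneg _) ?_ ?_
  · filter_upwards [eventually_Ioc] with s hs
    have h := hC s hs.1 hs.2
    rw [MulChar.sum_one_eq_card_units] at h
    have hs0 : 0 < s - 1 := sub_pos.mpr hs.1
    have h2 := (norm_add_le _ (rayLValue (1 : MulChar (RayClass K m) ℂ))).trans (add_le_add h le_rfl)
    rw [sub_add_cancel] at h2
    refine le_of_eq_of_le ?_ (mul_le_mul_of_nonneg_left h2 hs0.le)
    have h3 : s - 1 = ‖((s - 1 : ℝ) : ℂ)‖ := by rw [Complex.norm_real, Real.norm_of_nonneg hs0.le]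
    refine Eq.trans ?_ (congrArg (· * _) h3.symm)
    rw [← norm_mul]
    congr 1
    have : ((s - 1 : ℝ) : ℂ) ≠ 0 := by exact_mod_cast hs0.ne'
    push_cast at this ⊢
    field_simp
  · simpa using tendsto_sub_one.mul ((tendsto_sub_one.const_mul C).add_const _)

omit hm in
theorem exists_norm_rayLSeries_le_of_tendsto {ψ : MulChar (RayClass K m) ℂ} {g : ℝ → ℝ} {l : ℂ}
    (hg : ∀ᶠ s in 𝓝[>] 1, 0 < g s) (h : Tendsto (fun s : ℝ ↦
      (g s * (radialMellin K s).toReal : ℝ) * rayLSeries ψ s) (𝓝[>] 1) (𝓝 l)) :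
    ∃ C, 0 ≤ C ∧ ∀ᶠ s in 𝓝[>] 1, ‖rayLSeries ψ s‖ ≤ C / g s := by
  obtain ⟨c, hc0, hc⟩ := exists_le_radialMellin (K := K)
  refine ⟨(‖l‖ + 1) / c, by positivity, ?_⟩
  filter_upwards [h.norm.eventually_lt_const (lt_add_one _), eventually_Ioc, hg] with s hs hs1 hgs
  have h1 := hc s hs1.1.le hs1.2
  have h0 : 0 < (radialMellin K s).toReal := hc0.trans_le h1
  rw [norm_mul, Complex.norm_real, Real.norm_of_nonneg (by positivity)] at hs
  rw [div_div, le_div_iff₀ (by positivity)]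
  refine le_trans ?_ hs.le
  nlinarith [mul_nonneg (mul_nonneg hgs.le (norm_nonneg (rayLSeries ψ s))) (sub_nonneg.mpr h1)]

theorem norm_rayLSeries_le_of_rayLValue_eq_zero {ψ : MulChar (RayClass K m) ℂ} (h1 : ψ ≠ 1)
    (h : rayLValue ψ = 0) : ∃ C, 0 ≤ C ∧ ∀ᶠ s in 𝓝[>] 1, ‖rayLSeries ψ s‖ ≤ C * (s - 1) := by
  obtain ⟨c, hc0, hc⟩ := exists_le_radialMellin (K := K)
  obtain ⟨C, hC⟩ := exists_norm_rayLSeries_sub_le ψ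
  have hC0 : 0 ≤ C := by simpa [show (2 : ℝ) - 1 = 1 by norm_num] using (norm_nonneg _).trans (hC 2 (by norm_num) le_rfl)
  refine ⟨C / c, by positivity, ?_⟩
  filter_upwards [eventually_Ioc] with s hs1
  have h2 := hC s hs1.1 hs1.2
  rw [MulChar.sum_eq_zero_of_ne_one h1, h, zero_mul, sub_zero, sub_zero, norm_mul, Complex.norm_real,
    Real.norm_of_nonneg (by positivity)] at h2
  rw [div_mul_eq_mul_div, le_div_iff₀ hc0, mul_comm]
  exact (mul_le_mul_of_nonneg_right (hc s hs1.1.le hs1.2) (norm_nonneg _)).trans h2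

theorem three_add_four_mul_re_nonneg {z : ℂ} (hz : ‖z‖ = 1) : 0 ≤ 3 + 4 * z.re + (z ^ 2).re := by
  have h : z.re ^ 2 + z.im ^ 2 = 1 := by
    rw [sq, sq, ← Complex.normSq_apply, Complex.normSq_eq_norm_sq, hz, one_pow]
  rw [sq, Complex.mul_re]
  nlinarith [sq_nonneg (1 + z.re)]

theorem norm_mulChar_eq_one (ψ : MulChar (RayClass K m) ℂ) {r : RayClass K m} (hr : IsUnit r) : ‖ψ r‖ = 1 := by
  obtain ⟨u, rfl⟩ := hr
  refine Complex.norm_eq_one_of_pow_eq_one (n := Fintype.card (RayClass K m)ˣ) ?_ Fintype.card_ne_zero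
  rw [← map_pow, ← Units.val_pow_eq_pow_val, pow_card_eq_one, Units.val_one, map_one]

theorem re_primeSum_nonneg (ψ : MulChar (RayClass K m) ℂ) {s : ℝ} (hs : 1 < s) :
    0 ≤ (3 * primeSum (fun v ↦ (1 : MulChar (RayClass K m) ℂ) (rayClass m v.asIdeal)) s +
      4 * primeSum (fun v ↦ ψ (rayClass m v.asIdeal)) s +
      primeSum (fun v ↦ (ψ ^ 2) (rayClass m v.asIdeal)) s).re := by
  have h : ∀ ψ : MulChar (RayClass K m) ℂ, Summable fun v : HeightOneSpectrum (𝓞 K) ↦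
    ψ (rayClass m v.asIdeal) * ((Ideal.absNorm v.asIdeal : ℝ) ^ (-s) : ℝ) :=
    fun ψ ↦ summable_primeSum (fun v ↦ norm_mulChar_le_one ψ _) hs
  simp only [primeSum]
  rw [← tsum_mul_left, ← tsum_mul_left, ← ((h 1).mul_left 3).tsum_add ((h ψ).mul_left 4),
    ← (((h 1).mul_left 3).add ((h ψ).mul_left 4)).tsum_add (h _),
    Complex.re_tsum ((((h 1).mul_left 3).add ((h ψ).mul_left 4)).add (h _))]
  refine tsum_nonneg fun v ↦ ?_
  have h0 : (0 : ℝ) ≤ (Ideal.absNorm v.asIdeal : ℝ) ^ (-s) := by positivity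
  rw [← mul_assoc, ← mul_assoc, ← add_mul, ← add_mul, Complex.re_mul_ofReal]
  refine mul_nonneg ?_ h0
  by_cases hr : IsUnit (rayClass m v.asIdeal)
  · have := three_add_four_mul_re_nonneg (norm_mulChar_eq_one ψ hr)
    rw [MulChar.one_apply hr, MulChar.pow_apply' _ two_ne_zero]
    simpa using this
  · simp [MulChar.map_nonunit _ hr]

/-- `L`-values of nontrivial ray class characters do not vanish. -/
theorem rayLValue_ne_zero {ψ : MulChar (RayClass K m) ℂ} (h1 : ψ ≠ 1) : rayLValue ψ ≠ 0 := by
  by_cases h2 : ψ ^ 2 = 1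
  · refine rayLValue_ne_zero_of_quadratic h1 fun r ↦ ?_
    by_cases hr : IsUnit r
    · refine .inr (mul_self_eq_one_iff.mp ?_)
      rw [← sq, ← MulChar.pow_apply' _ two_ne_zero, h2, MulChar.one_apply hr]
    · exact .inl (ψ.map_nonunit hr)
  · intro h
    obtain ⟨Z, hZ⟩ := exists_norm_rayLog_sub_le K m
    have hpos : ∀ᶠ s : ℝ in 𝓝[>] 1, 0 < s - 1 := by
      filter_upwards [eventually_Ioc] with s hs using sub_pos.mpr hs.1
    obtain ⟨A, hA0, hA⟩ := exists_norm_rayLSeries_le_of_tendsto hpos (tendsto_rayLSeries_one (K := K) (m := m))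
    obtain ⟨B, hB0, hB⟩ := norm_rayLSeries_le_of_rayLValue_eq_zero h1 h
    obtain ⟨C, hC0, hC⟩ := exists_norm_rayLSeries_le_of_tendsto (ψ := ψ ^ 2) (g := fun _ ↦ 1)
      (.of_forall fun _ ↦ one_pos) (by simpa using tendsto_rayLSeries h2)
    have key : ∀ᶠ s : ℝ in 𝓝[>] 1, Real.exp (-(8 * Z)) ≤ A ^ 3 * B ^ 4 * C * (s - 1) := by
      filter_upwards [hA, hB, hC, eventually_Ioc] with s h3 h4 h5 hs
      have hs0 : 0 < s - 1 := sub_pos.mpr hs.1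
      have e : ‖Complex.exp (3 * rayLog (1 : MulChar (RayClass K m) ℂ) s + 4 * rayLog ψ s + rayLog (ψ ^ 2) s)‖ =
          ‖rayLSeries (1 : MulChar (RayClass K m) ℂ) s‖ ^ 3 * ‖rayLSeries ψ s‖ ^ 4 * ‖rayLSeries (ψ ^ 2) s‖ := by
        rw [Complex.exp_add, Complex.exp_add, ← exp_rayLog _ hs.1, ← exp_rayLog _ hs.1, ← exp_rayLog _ hs.1,
          ← norm_pow, ← norm_pow, ← norm_mul, ← norm_mul, ← Complex.exp_nat_mul, ← Complex.exp_nat_mul]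
        norm_num
      have hre := re_primeSum_nonneg ψ hs.1
      have b1 := abs_le.mp ((Complex.abs_re_le_norm _).trans (hZ 1 s hs.1))
      have b2 := abs_le.mp ((Complex.abs_re_le_norm _).trans (hZ ψ s hs.1))
      have b3 := abs_le.mp ((Complex.abs_re_le_norm _).trans (hZ (ψ ^ 2) s hs.1))
      calc Real.exp (-(8 * Z)) ≤ ‖Complex.exp (3 * rayLog (1 : MulChar (RayClass K m) ℂ) s + 4 * rayLog ψ s + rayLog (ψ ^ 2) s)‖ := by
            rw [Complex.norm_exp]
            refine Real.exp_le_exp.mpr ?_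
            simp only [Complex.add_re, Complex.sub_re, Complex.mul_re, Complex.re_ofNat, Complex.im_ofNat,
              zero_mul, sub_zero] at hre b1 b2 b3 ⊢
            linarith [b1.1, b2.1, b3.1]
        _ ≤ (A / (s - 1)) ^ 3 * (B * (s - 1)) ^ 4 * C := by
            rw [e]
            have h5 : ‖rayLSeries (ψ ^ 2) s‖ ≤ C := by simpa using h5
            gcongr
        _ = _ := by field_simp
    have lim : Tendsto (fun s : ℝ ↦ A ^ 3 * B ^ 4 * C * (s - 1)) (𝓝[>] 1) (𝓝 0) := by
      simpa using tendsto_sub_one.const_mul (A ^ 3 * B ^ 4 * C)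
    exact absurd (ge_of_tendsto lim key) (Real.exp_pos _).not_ge

end Nonvanishing

noncomputable section PrimeAsymptotics

open Filter Topology
open scoped Classical

theorem eqOn_const_of_exp_eq {k : ℝ → ℂ} {S : Set ℝ} (hS : IsPreconnected S) (hk : ContinuousOn k S)
    (h : ∀ x ∈ S, ∀ y ∈ S, Complex.exp (k x) = Complex.exp (k y)) {x y : ℝ} (hx : x ∈ S) (hy : y ∈ S) :
    k x = k y := by
  have hint : ∀ z ∈ S, ∃ n : ℤ, k z = k y + n * (2 * Real.pi * Complex.I) := fun z hz ↦
    Complex.exp_eq_exp_iff_exists_int.mp (h z hz y hy)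
  have hc : ContinuousOn (fun z ↦ (k z - k y).im / (2 * Real.pi)) S :=
    (Complex.continuous_im.comp_continuousOn (hk.sub continuousOn_const)).div_const _
  have hval : ∀ z ∈ S, ∀ n : ℤ, k z = k y + n * (2 * Real.pi * Complex.I) →
      (k z - k y).im / (2 * Real.pi) = n := by
    intro z _ n hn
    rw [hn, add_sub_cancel_left]
    have := Real.pi_ne_zero
    simp
  have hconst := hS.constant_of_mapsTo Int.isClosedEmbedding_coe_real.isEmbedding.isDiscrete_range hc (T := Set.range ((↑) : ℤ → ℝ)) (fun z hz ↦ by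
    obtain ⟨n, hn⟩ := hint z hz
    exact ⟨n, (hval z hz n hn).symm⟩) hx hy
  obtain ⟨n, hn⟩ := hint x hx
  rw [hval x hx n hn, sub_self, Complex.zero_im, zero_div] at hconst
  obtain rfl : n = 0 := by exact_mod_cast hconst
  simpa using hn

variable {K : Type*} [Field K] [NumberField K]

variable (K) in
theorem exists_abs_log_radialMellin_le : ∃ C, ∀ s, 1 ≤ s → s ≤ 2 → |Real.log (radialMellin K s).toReal| ≤ C := by
  obtain ⟨c, hc0, hc⟩ := exists_le_radialMellin (K := K)
  obtain ⟨C, hC⟩ := exists_radialMellin_le K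
  refine ⟨|Real.log c| + |Real.log C|, fun s h1 h2 ↦ abs_le.mpr ⟨?_, ?_⟩⟩
  · have := Real.log_le_log hc0 (hc s h1 h2)
    linarith [neg_abs_le (Real.log c), abs_nonneg (Real.log C)]
  · have := Real.log_le_log (hc0.trans_le (hc s h1 h2)) (hC s h1 h2)
    linarith [le_abs_self (Real.log C), abs_nonneg (Real.log c)]

variable {m : ℕ} [hm : Fact (2 ≤ m)]

theorem exists_norm_rayLog_add_le {ψ : MulChar (RayClass K m) ℂ} {g : ℝ → ℝ} {l : ℂ} (hl : l ≠ 0)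
    (hg : ∀ᶠ s in 𝓝[>] 1, 0 < g s) (h : Tendsto (fun s : ℝ ↦
      (g s * (radialMellin K s).toReal : ℝ) * rayLSeries ψ s) (𝓝[>] 1) (𝓝 l)) :
    ∃ C, ∀ᶠ s in 𝓝[>] 1, ‖rayLog ψ s + Real.log (g s)‖ ≤ C := by
  obtain ⟨c, hc0, hc⟩ := exists_le_radialMellin (K := K)
  obtain ⟨D, hD⟩ := exists_abs_log_radialMellin_le K
  have hw : Tendsto (fun s : ℝ ↦ (g s * (radialMellin K s).toReal : ℝ) * rayLSeries ψ s / l) (𝓝[>] 1) (𝓝 1) := by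
    simpa [hl] using h.div_const l
  have hev : ∀ᶠ s in 𝓝[>] (1 : ℝ), (1 < s ∧ s ≤ 2) ∧ 0 < g s ∧
      (g s * (radialMellin K s).toReal : ℝ) * rayLSeries ψ s / l ∈ Complex.slitPlane ∧
      ‖Complex.log ((g s * (radialMellin K s).toReal : ℝ) * rayLSeries ψ s / l)‖ ≤ 1 := by
    have h1 : Tendsto (fun z : ℂ ↦ ‖Complex.log z‖) (𝓝 1) (𝓝 0) := by
      have := (continuousAt_clog Complex.one_mem_slitPlane).norm.tendsto
      rwa [Complex.log_one, norm_zero] at this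
    filter_upwards [eventually_Ioc, hg, hw.eventually (Complex.isOpen_slitPlane.mem_nhds Complex.one_mem_slitPlane),
      hw.eventually (h1.eventually_le_const one_pos)] with s a b c d using ⟨a, b, c, d⟩
  obtain ⟨u, hu, hsub⟩ := mem_nhdsGT_iff_exists_Ioo_subset.mp hev
  have hu : 1 < u := hu
  have hlog : ∀ s ∈ Set.Ioo 1 u, Complex.log (rayLSeries ψ s / l) =
      -Real.log (g s * (radialMellin K s).toReal) +
        Complex.log ((g s * (radialMellin K s).toReal : ℝ) * rayLSeries ψ s / l) := by
    intro s hs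
    obtain ⟨⟨h1, h2⟩, h3, h4, -⟩ := hsub hs
    have h5 : 0 < g s * (radialMellin K s).toReal := mul_pos h3 (hc0.trans_le (hc s h1.le h2))
    rw [← Complex.ofReal_neg, ← Real.log_inv, ← Complex.log_ofReal_mul (inv_pos.mpr h5) (Complex.slitPlane_ne_zero h4)]
    congr 1
    have : ((g s * (radialMellin K s).toReal : ℝ) : ℂ) ≠ 0 := by exact_mod_cast h5.ne'
    rw [Complex.ofReal_inv, mul_div_assoc, inv_mul_cancel_left₀ this]
  have hslit : ∀ s ∈ Set.Ioo 1 u, rayLSeries ψ s / l ∈ Complex.slitPlane := by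
    intro s hs
    obtain ⟨⟨h1, h2⟩, h3, h4, -⟩ := hsub hs
    have h5 : 0 < g s * (radialMellin K s).toReal := mul_pos h3 (hc0.trans_le (hc s h1.le h2))
    have h6 := hlog s hs
    rw [Complex.mem_slitPlane_iff_arg] at h4 ⊢
    have h7 : rayLSeries ψ s / l ≠ 0 := fun h0 ↦ h4.2 (by rw [mul_div_assoc, h0, mul_zero])
    refine ⟨?_, h7⟩
    have := congrArg Complex.im h6
    rw [Complex.log_im, Complex.add_im, Complex.neg_im, Complex.ofReal_im, neg_zero, zero_add, Complex.log_im] at this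
    rw [this]
    exact h4.1
  set k : ℝ → ℂ := fun s ↦ rayLog ψ s - Complex.log (rayLSeries ψ s / l) with hk
  have hkc : ContinuousOn k (Set.Ioo 1 u) := by
    have h1 : ContinuousOn (rayLog ψ) (Set.Ioo 1 u) := (continuousOn_rayLog ψ).mono fun s hs ↦ hs.1
    refine h1.sub (ContinuousOn.clog ?_ hslit)
    refine ContinuousOn.div_const ?_ _
    exact (Complex.continuous_exp.comp_continuousOn h1).congr fun s hs ↦ (exp_rayLog ψ hs.1).symm
  have hexp : ∀ s ∈ Set.Ioo 1 u, Complex.exp (k s) = l := by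
    intro s hs
    have h0 := Complex.slitPlane_ne_zero (hslit s hs)
    rw [hk, Complex.exp_sub, Complex.exp_log h0, exp_rayLog ψ hs.1, div_div_cancel₀]
    exact fun h ↦ h0 (by rw [h, zero_div])
  refine ⟨‖k ((1 + u) / 2)‖ + 1 + D, ?_⟩
  filter_upwards [mem_nhdsGT_iff_exists_Ioo_subset.mpr ⟨u, hu, subset_rfl⟩] with s hs
  have hks : k s = k ((1 + u) / 2) := eqOn_const_of_exp_eq isPreconnected_Ioo hkc
    (fun x hx y hy ↦ (hexp x hx).trans (hexp y hy).symm) hs ⟨by linarith, by linarith⟩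
  obtain ⟨⟨h1, h2⟩, h3, h4, h5⟩ := hsub hs
  have e : rayLog ψ s + Real.log (g s) = k s +
      Complex.log ((g s * (radialMellin K s).toReal : ℝ) * rayLSeries ψ s / l) -
      Real.log (radialMellin K s).toReal := by
    simp only [hk]
    rw [hlog s hs, Real.log_mul h3.ne' (hc0.trans_le (hc s h1.le h2)).ne']
    push_cast
    ring
  rw [e, hks]
  refine (norm_sub_le _ _).trans (add_le_add ((norm_add_le _ _).trans (add_le_add le_rfl h5)) ?_)
  rw [Complex.norm_real]
  exact hD s h1.le h2

theorem exists_norm_primeSum_le {ψ : MulChar (RayClass K m) ℂ} (h1 : ψ ≠ 1) :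
    ∃ C, ∀ᶠ s in 𝓝[>] 1, ‖primeSum (fun v ↦ ψ (rayClass m v.asIdeal)) s‖ ≤ C := by
  obtain ⟨Z, hZ⟩ := exists_norm_rayLog_sub_le K m
  obtain ⟨C, hC⟩ := exists_norm_rayLog_add_le (ψ := ψ) (g := fun _ ↦ 1) (rayLValue_ne_zero h1)
    (.of_forall fun _ ↦ one_pos) (by simpa using tendsto_rayLSeries h1)
  refine ⟨C + Z, ?_⟩
  filter_upwards [hC, eventually_Ioc] with s hs h2
  rw [Real.log_one, Complex.ofReal_zero, add_zero] at hs
  have := norm_sub_le (rayLog ψ s) (rayLog ψ s - primeSum (fun v ↦ ψ (rayClass m v.asIdeal)) s)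
  rw [sub_sub_cancel] at this
  exact this.trans (add_le_add hs (hZ ψ s h2.1))

variable (K m) in
theorem exists_norm_primeSum_one_add_le : ∃ C, ∀ᶠ s in 𝓝[>] 1,
    ‖primeSum (fun v : HeightOneSpectrum (𝓞 K) ↦ (1 : MulChar (RayClass K m) ℂ) (rayClass m v.asIdeal)) s +
      Real.log (s - 1)‖ ≤ C := by
  obtain ⟨Z, hZ⟩ := exists_norm_rayLog_sub_le K m
  have hpos : ∀ᶠ s : ℝ in 𝓝[>] 1, 0 < s - 1 := by
    filter_upwards [eventually_Ioc] with s hs using sub_pos.mpr hs.1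
  have h0 : ((Fintype.card (RayClass K m)ˣ * (rayResidue K m).toReal : ℝ) : ℂ) ≠ 0 := by
    have := rayResidue_toReal_pos (K := K) hm.out
    have := Fintype.card_pos (α := (RayClass K m)ˣ)
    exact_mod_cast (by positivity : (0 : ℝ) < Fintype.card (RayClass K m)ˣ * (rayResidue K m).toReal).ne'
  obtain ⟨C, hC⟩ := exists_norm_rayLog_add_le (K := K) (m := m) h0 hpos tendsto_rayLSeries_one
  refine ⟨C + Z, ?_⟩
  filter_upwards [hC, eventually_Ioc] with s hs h2
  have := norm_sub_le (rayLog (1 : MulChar (RayClass K m) ℂ) s + Real.log (s - 1))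
    (rayLog (1 : MulChar (RayClass K m) ℂ) s - primeSum (fun v ↦ (1 : MulChar (RayClass K m) ℂ) (rayClass m v.asIdeal)) s)
  refine le_trans (le_of_eq (congrArg norm ?_)) (this.trans (add_le_add hs (hZ 1 s h2.1)))
  ring

end PrimeAsymptotics

noncomputable section Density

open Filter Topology
open scoped Classical

variable {K : Type*} [Field K] [NumberField K]

/-- A bounded weight on the primes has logarithmic mean value `δ`. -/
structure HasDensity (f : HeightOneSpectrum (𝓞 K) → ℂ) (δ : ℂ) : Prop where
  bounded : ∃ B, ∀ v, ‖f v‖ ≤ B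
  tendsto : Tendsto (fun s : ℝ ↦ primeSum f s / (-Real.log (s - 1) : ℝ)) (𝓝[>] 1) (𝓝 δ)

theorem tendsto_neg_log_sub_one : Tendsto (fun s : ℝ ↦ -Real.log (s - 1)) (𝓝[>] 1) atTop := by
  refine tendsto_neg_atBot_atTop.comp (Real.tendsto_log_nhdsGT_zero.comp ?_)
  refine tendsto_nhdsWithin_iff.mpr ⟨tendsto_sub_one, ?_⟩
  filter_upwards [eventually_Ioc] with s hs using sub_pos.mpr hs.1

theorem tendsto_zero_of_bounded {F : ℝ → ℂ} {C : ℝ} (h : ∀ᶠ s in 𝓝[>] 1, ‖F s‖ ≤ C) :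
    Tendsto (fun s : ℝ ↦ F s / (-Real.log (s - 1) : ℝ)) (𝓝[>] 1) (𝓝 0) := by
  rw [tendsto_zero_iff_norm_tendsto_zero]
  refine squeeze_zero' (.of_forall fun _ ↦ norm_nonneg _) ?_ (tendsto_neg_log_sub_one.const_div_atTop C)
  filter_upwards [h, tendsto_neg_log_sub_one.eventually_gt_atTop 0] with s hs h0
  rw [norm_div, Complex.norm_real, Real.norm_of_nonneg h0.le]
  exact div_le_div_of_nonneg_right hs h0.le

namespace HasDensity

variable {f g : HeightOneSpectrum (𝓞 K) → ℂ} {δ ε : ℂ}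

theorem add (h : HasDensity f δ) (h' : HasDensity g ε) : HasDensity (fun v ↦ f v + g v) (δ + ε) := by
  obtain ⟨B, hB⟩ := h.bounded
  obtain ⟨C, hC⟩ := h'.bounded
  refine ⟨⟨B + C, fun v ↦ (norm_add_le _ _).trans (add_le_add (hB v) (hC v))⟩, ?_⟩
  refine (h.tendsto.add h'.tendsto).congr' ?_
  filter_upwards [eventually_Ioc] with s hs
  rw [← add_div, primeSum, primeSum, ← (summable_primeSum hB hs.1).tsum_add (summable_primeSum hC hs.1)]
  simp only [primeSum, add_mul]

theorem const_mul (h : HasDensity f δ) (c : ℂ) : HasDensity (fun v ↦ c * f v) (c * δ) := by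
  obtain ⟨B, hB⟩ := h.bounded
  refine ⟨⟨‖c‖ * B, fun v ↦ (norm_mul_le _ _).trans (mul_le_mul_of_nonneg_left (hB v) (norm_nonneg _))⟩, ?_⟩
  refine (h.tendsto.const_mul c).congr fun s ↦ ?_
  simp only [primeSum, mul_assoc, tsum_mul_left, mul_div_assoc]

theorem zero : HasDensity (fun _ : HeightOneSpectrum (𝓞 K) ↦ (0 : ℂ)) 0 :=
  ⟨⟨0, by simp⟩, by simp [primeSum]⟩

theorem sub (h : HasDensity f δ) (h' : HasDensity g ε) : HasDensity (fun v ↦ f v - g v) (δ - ε) := by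
  simpa [sub_eq_add_neg] using h.add (h'.const_mul (-1))

theorem sum {ι : Type*} {s : Finset ι} {f : ι → HeightOneSpectrum (𝓞 K) → ℂ} {δ : ι → ℂ}
    (h : ∀ i ∈ s, HasDensity (f i) (δ i)) : HasDensity (fun v ↦ ∑ i ∈ s, f i v) (∑ i ∈ s, δ i) := by
  induction s using Finset.induction_on with
  | empty => simpa using zero
  | insert i s hi ih =>
    simp only [Finset.sum_insert hi]
    exact (h i (Finset.mem_insert_self _ _)).add (ih fun j hj ↦ h j (Finset.mem_insert_of_mem hj))

/-- Weights which are summable against `1 / N v` have mean value zero. -/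
theorem of_summable (hf : ∃ B, ∀ v, ‖f v‖ ≤ B)
    (h : Summable fun v ↦ ‖f v‖ * (Ideal.absNorm v.asIdeal : ℝ)⁻¹) : HasDensity f 0 := by
  refine ⟨hf, tendsto_zero_of_bounded (C := ∑' v, ‖f v‖ * (Ideal.absNorm v.asIdeal : ℝ)⁻¹) ?_⟩
  filter_upwards [eventually_Ioc] with s hs
  refine tsum_of_norm_bounded h.hasSum fun v ↦ ?_
  have h2 := two_le_absNorm v
  rw [norm_mul, Complex.norm_real, Real.norm_of_nonneg (by positivity), ← Real.rpow_neg_one]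
  gcongr
  · linarith
  · linarith [hs.1]

theorem congr_of_finite (h : HasDensity f δ) (hg : {v | f v ≠ g v}.Finite) : HasDensity g δ := by
  have h1 : HasDensity (fun v ↦ g v - f v) 0 := by
    have hne : ∀ v ∉ hg.toFinset, g v - f v = 0 := fun v hv ↦ by
      rw [Set.Finite.mem_toFinset, Set.mem_ofPred_eq, not_not] at hv
      rw [hv, sub_self]
    refine of_summable ⟨∑ v ∈ hg.toFinset, ‖g v - f v‖, fun v ↦ ?_⟩ ?_
    · by_cases hv : v ∈ hg.toFinset
      · exact Finset.single_le_sum (f := fun v ↦ ‖g v - f v‖) (fun _ _ ↦ norm_nonneg _) hv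
      · rw [hne v hv, norm_zero]
        positivity
    · exact summable_of_ne_finset_zero (s := hg.toFinset) fun v hv ↦ by rw [hne v hv, norm_zero, zero_mul]
  simpa using h.add h1

theorem re_nonneg (h : HasDensity f δ) (hf : ∀ v, 0 ≤ (f v).re) : 0 ≤ δ.re := by
  obtain ⟨B, hB⟩ := h.bounded
  refine ge_of_tendsto ((Complex.continuous_re.tendsto _).comp h.tendsto) ?_
  filter_upwards [eventually_Ioc, tendsto_neg_log_sub_one.eventually_gt_atTop 0] with s hs h0
  simp only [Function.comp_apply]
  rw [Complex.div_ofReal_re, primeSum, Complex.re_tsum (summable_primeSum hB hs.1)]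
  refine div_nonneg (tsum_nonneg fun v ↦ ?_) h0.le
  rw [Complex.re_mul_ofReal]
  exact mul_nonneg (hf v) (by positivity)

end HasDensity

variable {m : ℕ} [hm : Fact (2 ≤ m)]

theorem hasDensity_mulChar_of_ne_one {ψ : MulChar (RayClass K m) ℂ} (h1 : ψ ≠ 1) :
    HasDensity (fun v ↦ ψ (rayClass m v.asIdeal)) 0 := by
  obtain ⟨C, hC⟩ := exists_norm_primeSum_le h1
  exact ⟨⟨1, fun v ↦ norm_mulChar_le_one ψ _⟩, tendsto_zero_of_bounded hC⟩

variable (K m) in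
theorem hasDensity_mulChar_one :
    HasDensity (fun v : HeightOneSpectrum (𝓞 K) ↦ (1 : MulChar (RayClass K m) ℂ) (rayClass m v.asIdeal)) 1 := by
  obtain ⟨C, hC⟩ := exists_norm_primeSum_one_add_le K m
  refine ⟨⟨1, fun v ↦ norm_mulChar_le_one _ _⟩, ?_⟩
  have h := (tendsto_zero_of_bounded hC).add_const 1
  rw [zero_add] at h
  refine h.congr' ?_
  filter_upwards [tendsto_neg_log_sub_one.eventually_gt_atTop 0] with s h0
  have : ((-Real.log (s - 1) : ℝ) : ℂ) ≠ 0 := by exact_mod_cast h0.ne'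
  rw [div_add_one this]
  push_cast
  ring_nf

theorem hasDensity_mulChar (ψ : MulChar (RayClass K m) ℂ) :
    HasDensity (fun v ↦ ψ (rayClass m v.asIdeal)) (if ψ = 1 then 1 else 0) := by
  split_ifs with h
  · exact h ▸ hasDensity_mulChar_one K m
  · exact hasDensity_mulChar_of_ne_one h

end Density

noncomputable section RayMean

open Filter Topology
open scoped Classical

variable {K : Type*} [Field K] [NumberField K] {m : ℕ} [hm : Fact (2 ≤ m)]

theorem finite_setOf_mem_asIdeal {x : 𝓞 K} (hx : x ≠ 0) : {v : HeightOneSpectrum (𝓞 K) | x ∈ v.asIdeal}.Finite := by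
  have h : (Ideal.span {x} : Ideal (𝓞 K)) ≠ 0 := by simpa [Ideal.zero_eq_bot] using hx
  refine ((finite_setOf_dvd h).preimage injective_asIdeal.injOn).subset fun v hv ↦ ?_
  simpa [Ideal.dvd_span_singleton] using hv

theorem isCoprime_asIdeal_span_iff {v : HeightOneSpectrum (𝓞 K)} {x : 𝓞 K} :
    IsCoprime v.asIdeal (Ideal.span {x}) ↔ x ∉ v.asIdeal := by
  refine ⟨fun h hx ↦ v.isPrime.ne_top ?_, fun h ↦ ?_⟩
  · rw [Ideal.isCoprime_iff_sup_eq, sup_eq_left.mpr ((Ideal.span_singleton_le_iff_mem _).mpr hx)] at h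
    exact h
  · rw [Ideal.isCoprime_iff_sup_eq]
    by_contra hne
    refine h (v.isMaximal.eq_of_le hne le_sup_left ▸ ?_)
    exact Ideal.mem_sup_right (Ideal.mem_span_singleton_self x)

/-- The mean value of a function over the unit ray classes. -/
def rayMean (f : RayClass K m → ℂ) : ℂ := (Fintype.card (RayClass K m)ˣ : ℂ)⁻¹ * ∑ u : (RayClass K m)ˣ, f u

instance : Fintype (MulChar (RayClass K m) ℂ) := Fintype.ofFinite _

theorem sum_mulChar_apply_units (u : (RayClass K m)ˣ) :
    ∑ ψ : MulChar (RayClass K m) ℂ, ψ u = if u = 1 then (Fintype.card (RayClass K m)ˣ : ℂ) else 0 := by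
  split_ifs with h
  · subst h
    simp only [Units.val_one, map_one, Finset.sum_const, Finset.card_univ, nsmul_eq_mul, mul_one,
      ← Nat.card_eq_fintype_card, MulChar.card_eq_card_units_of_hasEnoughRootsOfUnity]
  · have hu : (u : RayClass K m) ≠ 1 := fun h' ↦ h (Units.ext h')
    obtain ⟨χ, hχ⟩ := MulChar.exists_apply_ne_one_of_hasEnoughRootsOfUnity (RayClass K m) ℂ hu
    refine eq_zero_of_mul_eq_self_left hχ ?_
    simp only [Finset.mul_sum, ← MulChar.mul_apply]
    exact Fintype.sum_bijective _ (Group.mulLeft_bijective χ) _ _ fun χ' ↦ rfl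

/-- Equidistribution of prime ideals in ray classes. -/
theorem hasDensity_rayMean (f : RayClass K m → ℂ) :
    HasDensity (fun v ↦ f (rayClass m v.asIdeal)) (rayMean f) := by
  set h : ℂ := (Fintype.card (RayClass K m)ˣ : ℂ) with hh
  have hne : h ≠ 0 := by rw [hh]; exact_mod_cast Fintype.card_ne_zero
  let c : MulChar (RayClass K m) ℂ → ℂ := fun ψ ↦ h⁻¹ * ∑ u : (RayClass K m)ˣ, f u * ψ ((u⁻¹ : (RayClass K m)ˣ))
  have hexp (w : (RayClass K m)ˣ) : ∑ ψ, c ψ * ψ w = f w := by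
    simp only [c, mul_assoc, Finset.sum_mul]
    rw [← Finset.mul_sum, Finset.sum_comm]
    have : ∀ u : (RayClass K m)ˣ, ∑ ψ : MulChar (RayClass K m) ℂ, f u * (ψ ((u⁻¹ : (RayClass K m)ˣ)) * ψ w)
        = if u = w then f u * h else 0 := fun u ↦ by
      simp only [← map_mul, ← Units.val_mul]
      rw [← Finset.mul_sum, sum_mulChar_apply_units, mul_ite, mul_zero]
      simp only [inv_mul_eq_one, hh]
    simp only [this]
    rw [Finset.sum_ite_eq' Finset.univ w, if_pos (Finset.mem_univ _)]
    field_simp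
  have h1 : HasDensity (fun v ↦ ∑ ψ, c ψ * ψ (rayClass m v.asIdeal))
      (∑ ψ, c ψ * if ψ = 1 then 1 else 0) := HasDensity.sum fun ψ _ ↦ (hasDensity_mulChar ψ).const_mul _
  have hmean : (∑ ψ, c ψ * if ψ = 1 then 1 else 0) = rayMean f := by
    simp only [mul_ite, mul_one, mul_zero, Finset.sum_ite_eq', Finset.mem_univ, if_true]
    simp [c, rayMean, MulChar.one_apply_coe, hh]
  rw [hmean] at h1
  refine h1.congr_of_finite (((finite_setOf_mem_asIdeal (K := K) (x := (m : 𝓞 K)) ?_)).subset fun v hv ↦ ?_)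
  · exact_mod_cast (by linarith [hm.out] : m ≠ 0)
  · by_contra hv'
    obtain ⟨w, hw⟩ := (isUnit_rayClass_iff hm.out).mpr (isCoprime_asIdeal_span_iff.mpr hv')
    exact hv (by rw [← hw]; exact hexp w)

theorem rayMean_indicator (u : (RayClass K m)ˣ) :
    rayMean (fun r : RayClass K m ↦ if r = u then 1 else 0) = (Fintype.card (RayClass K m)ˣ : ℂ)⁻¹ := by
  simp [rayMean, Units.val_inj]

/-- Every unit ray class contains a prime outside any given set of density zero. -/
theorem exists_prime_rayClass_eq (u : (RayClass K m)ˣ) {E : Set (HeightOneSpectrum (𝓞 K))}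
    (hE : HasDensity (E.indicator 1) 0) : ∃ v ∉ E, rayClass m v.asIdeal = u := by
  by_contra! hno
  have h := hasDensity_rayMean (fun r : RayClass K m ↦ if r = u then 1 else 0)
  rw [rayMean_indicator] at h
  have h2 := (hE.sub h).re_nonneg fun v ↦ ?_
  · have : (0 : ℝ) < (Fintype.card (RayClass K m)ˣ : ℝ)⁻¹ := by
      have : 0 < Fintype.card (RayClass K m)ˣ := Fintype.card_pos
      positivity
    rw [zero_sub, Complex.neg_re, ← Complex.ofReal_natCast, ← Complex.ofReal_inv, Complex.ofReal_re] at h2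
    linarith
  · by_cases hv : v ∈ E
    · rw [Set.indicator_of_mem hv]
      split_ifs <;> simp
    · rw [Set.indicator_of_notMem hv, if_neg (hno v hv), sub_zero, Complex.zero_re]

theorem hasDensity_indicator_of_finite {E : Set (HeightOneSpectrum (𝓞 K))} (hE : E.Finite) :
    HasDensity (E.indicator 1) 0 :=
  HasDensity.zero.congr_of_finite (hE.subset fun v hv ↦ by
    by_contra h
    exact hv (Set.indicator_of_notMem h _).symm)

/-- An ideal in the ray class of a principal ideal `(r)` has a generator congruent to `r`. -/
theorem exists_generator_of_rayClass_eq {I : Ideal (𝓞 K)} {r : 𝓞 K}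
    (hr : IsCoprime (Ideal.span {r}) (Ideal.span {(m : 𝓞 K)})) (h : rayClass m I = rayClass m (Ideal.span {r})) :
    ∃ d, I = Ideal.span {d} ∧ (m : 𝓞 K) ∣ d - r := by
  have hI := (isCoprime_iff_of_rayClass_eq h).mpr hr
  obtain ⟨α, β, hα, hβ, e⟩ := (rayClass_eq_iff hI hr).mp h
  have hα0 := ne_zero_of_dvd_sub_one hm.out hα
  rw [Ideal.span_singleton_mul_span_singleton] at e
  have hle : Ideal.span {β * r} ≤ Ideal.span {α} := e ▸ Ideal.mul_le_left
  obtain ⟨d, hd⟩ := Ideal.span_singleton_le_span_singleton.mp hle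
  refine ⟨d, ?_, ?_⟩
  · rw [hd, ← Ideal.span_singleton_mul_span_singleton] at e
    exact (Ideal.span_singleton_mul_right_inj hα0).mp e
  · obtain ⟨x, hx⟩ := hα
    obtain ⟨y, hy⟩ := hβ
    refine ⟨y * r - x * d, ?_⟩
    linear_combination -hd + r * hy - d * hx

/-- Dirichlet's theorem on primes in arithmetic progressions, for principal primes of a number field. -/
theorem exists_prime_element {r : 𝓞 K} (hr : IsCoprime (Ideal.span {r}) (Ideal.span {(m : 𝓞 K)}))
    {E : Set (HeightOneSpectrum (𝓞 K))} (hE : HasDensity (E.indicator 1) 0) :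
    ∃ (v : HeightOneSpectrum (𝓞 K)) (d : 𝓞 K), v ∉ E ∧ v.asIdeal = Ideal.span {d} ∧ (m : 𝓞 K) ∣ d - r := by
  obtain ⟨u, hu⟩ := (isUnit_rayClass_iff hm.out).mpr hr
  obtain ⟨v, hv, h⟩ := exists_prime_rayClass_eq u hE
  obtain ⟨d, hd, hdr⟩ := exists_generator_of_rayClass_eq hr (h.trans hu)
  exact ⟨v, d, hv, hd, hdr⟩

end RayMean

noncomputable section RelativeNorm

open scoped Classical

theorem dvd_prod_sub_one {R ι : Type*} [CommRing R] {m : R} {s : Finset ι} {f : ι → R}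
    (h : ∀ i ∈ s, m ∣ f i - 1) : m ∣ ∏ i ∈ s, f i - 1 := by
  rw [← Ideal.mem_span_singleton, ← Ideal.Quotient.eq, map_prod, map_one]
  refine Finset.prod_eq_one fun i hi ↦ ?_
  rw [← map_one (Ideal.Quotient.mk _), Ideal.Quotient.eq, Ideal.mem_span_singleton]
  exact h i hi

variable {K L : Type*} [Field K] [NumberField K] [Field L] [NumberField L] [Algebra K L]

/-- The norm of an algebraic integer congruent to `1` is congruent to `1`. -/
theorem dvd_intNorm_sub_one {m : ℕ} {r : 𝓞 L} (h : (m : 𝓞 L) ∣ r - 1) :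
    (m : 𝓞 K) ∣ Algebra.intNorm (𝓞 K) (𝓞 L) r - 1 := by
  rcases eq_or_ne m 0 with rfl | hm
  · rw [Nat.cast_zero, zero_dvd_iff, sub_eq_zero] at h ⊢
    rw [h, map_one]
  let E := AlgebraicClosure K
  obtain ⟨y, hy⟩ := h
  let S := integralClosure ℤ E
  have hint (σ : L →ₐ[K] E) : IsIntegral ℤ (σ (y : L)) := y.isIntegral_coe.map (σ.restrictScalars ℤ)
  let z : (L →ₐ[K] E) → S := fun σ ↦ ⟨σ (y : L), hint σ⟩
  have hdvd : (m : S) ∣ ∏ σ, (1 + m * z σ) - 1 := dvd_prod_sub_one fun σ _ ↦ ⟨z σ, by ring⟩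
  obtain ⟨q, hq⟩ := hdvd
  have hr : (r : L) = 1 + m * (y : L) := by
    rw [← sub_eq_iff_eq_add']
    simpa using congrArg (fun t : 𝓞 L ↦ (t : L)) hy
  have hnorm : algebraMap K E (Algebra.norm K (r : L)) - 1 = m * (q : E) := by
    rw [Algebra.norm_eq_prod_embeddings]
    have := congrArg (fun t : S ↦ (t : E)) hq
    simp only [hr, map_add, map_one, map_mul, map_natCast]
    simpa [z] using this
  have hmK : (m : K) ≠ 0 := by exact_mod_cast hm
  have hmE : (m : E) ≠ 0 := by exact_mod_cast hm
  let t : K := (Algebra.norm K (r : L) - 1) / m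
  have ht : IsIntegral ℤ t := by
    rw [← isIntegral_algebraMap_iff (algebraMap K E).injective]
    have hq' : algebraMap K E t = q := by
      simp only [t, map_div₀, map_sub, map_one, map_natCast]
      rw [hnorm, mul_div_cancel_left₀ _ hmE]
    rw [hq']
    exact q.2
  obtain ⟨T, hT⟩ := (IsIntegralClosure.isIntegral_iff (A := 𝓞 K)).mp ht
  refine ⟨T, RingOfIntegers.ext ?_⟩
  change algebraMap (𝓞 K) K _ = algebraMap (𝓞 K) K _
  rw [map_sub, map_one, map_mul, map_natCast, hT, mul_div_cancel₀ _ hmK]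
  exact congrArg (· - 1) (Algebra.algebraMap_intNorm (A := 𝓞 K) (K := K) (L := L) (B := 𝓞 L) r)

omit [NumberField K] in
theorem isCoprime_span_natCast_iff {m : ℕ} {I : Ideal (𝓞 K)} :
    IsCoprime I (Ideal.span {(m : 𝓞 K)}) ↔ ∃ x ∈ I, (m : 𝓞 K) ∣ x - 1 := by
  rw [Ideal.isCoprime_iff_exists]
  refine ⟨fun ⟨x, hx, y, hy, h⟩ ↦ ⟨x, hx, ?_⟩, fun ⟨x, hx, h⟩ ↦ ⟨x, hx, 1 - x, ?_, by ring⟩⟩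
  · rw [← neg_sub, ← h, add_sub_cancel_left, dvd_neg]
    exact Ideal.mem_span_singleton.mp hy
  · rw [Ideal.mem_span_singleton, ← neg_sub, dvd_neg]
    exact h

theorem isCoprime_relNorm_iff {m : ℕ} {I : Ideal (𝓞 L)} :
    IsCoprime (Ideal.relNorm (𝓞 K) I) (Ideal.span {(m : 𝓞 K)}) ↔ IsCoprime I (Ideal.span {(m : 𝓞 L)}) := by
  rw [isCoprime_span_natCast_iff, isCoprime_span_natCast_iff]
  constructor
  · rintro ⟨x, hx, h⟩
    refine ⟨algebraMap (𝓞 K) (𝓞 L) x, Ideal.relNorm_le_comap (𝓞 K) I hx, ?_⟩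
    simpa using map_dvd (algebraMap (𝓞 K) (𝓞 L)) h
  · rintro ⟨x, hx, h⟩
    refine ⟨Algebra.intNorm (𝓞 K) (𝓞 L) x, ?_, dvd_intNorm_sub_one h⟩
    rw [Ideal.relNorm_apply]
    exact Ideal.subset_span ⟨x, hx, rfl⟩

variable (K L) in
/-- The norm map on ray classes. -/
def rayNorm (m : ℕ) : RayClass L m →* RayClass K m :=
  (rayCon L m).lift ((rayClass m).comp (Ideal.relNorm (𝓞 K) : Ideal (𝓞 L) →*₀ Ideal (𝓞 K)).toMonoidHom) <| by
    rintro I J ⟨h, h'⟩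
    rw [Con.ker_rel]
    change rayClass m (Ideal.relNorm (𝓞 K) I) = rayClass m (Ideal.relNorm (𝓞 K) J)
    by_cases hI : IsCoprime I (Ideal.span {(m : 𝓞 L)})
    · obtain ⟨α, β, hα, hβ, e⟩ := h' hI
      rw [rayClass_eq_iff (isCoprime_relNorm_iff.mpr hI) (isCoprime_relNorm_iff.mpr (h.mp hI))]
      refine ⟨Algebra.intNorm (𝓞 K) (𝓞 L) α, Algebra.intNorm (𝓞 K) (𝓞 L) β, dvd_intNorm_sub_one hα,
        dvd_intNorm_sub_one hβ, ?_⟩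
      rw [← Ideal.relNorm_singleton, ← Ideal.relNorm_singleton, ← map_mul, ← map_mul, e]
    · rw [rayClass, Con.coe_mk', Con.eq]
      exact ⟨by rw [isCoprime_relNorm_iff, isCoprime_relNorm_iff, h],
        fun hI' ↦ absurd (isCoprime_relNorm_iff.mp hI') hI⟩

theorem rayNorm_rayClass {m : ℕ} (I : Ideal (𝓞 L)) :
    rayNorm K L m (rayClass m I) = rayClass m (Ideal.relNorm (𝓞 K) I) := rfl

theorem relNorm_asIdeal (w : HeightOneSpectrum (𝓞 L)) :
    Ideal.relNorm (𝓞 K) w.asIdeal = (w.under (𝓞 K)).asIdeal ^ w.asIdeal.inertiaDeg (𝓞 K) := by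
  have := w.isMaximal
  have := (w.under (𝓞 K)).isMaximal
  have : w.asIdeal.LiesOver (w.under (𝓞 K)).asIdeal := ⟨rfl⟩
  exact Ideal.relNorm_eq_pow_of_isMaximal w.asIdeal (w.under (𝓞 K)).asIdeal

theorem absNorm_asIdeal (w : HeightOneSpectrum (𝓞 L)) : Ideal.absNorm w.asIdeal =
    Ideal.absNorm (w.under (𝓞 K)).asIdeal ^ w.asIdeal.inertiaDeg (𝓞 K) := by
  rw [← Ideal.absNorm_relNorm (𝓞 K), relNorm_asIdeal, map_pow]

theorem inertiaDeg_pos (w : HeightOneSpectrum (𝓞 L)) : 0 < w.asIdeal.inertiaDeg (𝓞 K) := by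
  have := w.isMaximal
  exact Ideal.inertiaDeg_pos _ _

variable (L) in
theorem sum_inertiaDeg_le (v : HeightOneSpectrum (𝓞 K)) (T : Finset {w : HeightOneSpectrum (𝓞 L) // w.under (𝓞 K) = v}) :
    ∑ w ∈ T, w.1.asIdeal.inertiaDeg (𝓞 K) ≤ Module.finrank (𝓞 K) (𝓞 L) := by
  have := v.isMaximal
  let g : {w : HeightOneSpectrum (𝓞 L) // w.under (𝓞 K) = v} → v.asIdeal.primesOver (𝓞 L) :=
    fun w ↦ ⟨w.1.asIdeal, w.1.isPrime, ⟨(congrArg HeightOneSpectrum.asIdeal w.2).symm⟩⟩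
  have hg : Function.Injective g := fun w w' h ↦
    Subtype.ext (HeightOneSpectrum.ext (congrArg Subtype.val h))
  have := IsDedekindDomain.primesOver_finite v.asIdeal (𝓞 L)
  let _ : Fintype (v.asIdeal.primesOver (𝓞 L)) := this.fintype
  rw [← Ideal.sum_ramification_inertia_eq_finrank v.asIdeal (𝓞 L)]
  calc ∑ w ∈ T, w.1.asIdeal.inertiaDeg (𝓞 K)
      = ∑ q ∈ T.map ⟨g, hg⟩, q.1.inertiaDeg (𝓞 K) := by rw [Finset.sum_map]; rfl
    _ ≤ ∑ q ∈ T.map ⟨g, hg⟩, q.1.ramificationIdx (𝓞 K) * q.1.inertiaDeg (𝓞 K) := by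
        refine Finset.sum_le_sum fun q _ ↦ Nat.le_mul_of_pos_left _ ?_
        have := q.2.1
        exact Ideal.ramificationIdx_pos _ _
    _ ≤ _ := Finset.sum_le_sum_of_subset (Finset.subset_univ _)

variable (L) in
theorem card_le_finrank (v : HeightOneSpectrum (𝓞 K)) (T : Finset {w : HeightOneSpectrum (𝓞 L) // w.under (𝓞 K) = v}) :
    T.card ≤ Module.finrank (𝓞 K) (𝓞 L) := by
  refine le_trans ?_ (sum_inertiaDeg_le L v T)
  rw [Finset.card_eq_sum_ones]
  exact Finset.sum_le_sum fun w _ ↦ inertiaDeg_pos w.1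

end RelativeNorm

noncomputable section DegreeOne

open Filter Topology
open scoped Classical

variable {K L : Type*} [Field K] [NumberField K] [Field L] [NumberField L] [Algebra K L]

theorem summable_inv_absNorm_of_inertiaDeg_ne_one :
    Summable fun w : HeightOneSpectrum (𝓞 L) ↦
      if w.asIdeal.inertiaDeg (𝓞 K) = 1 then 0 else (Ideal.absNorm w.asIdeal : ℝ)⁻¹ := by
  have hK := summable_prime_rpow (K := K) (s := 2) one_lt_two
  let u : HeightOneSpectrum (𝓞 K) → ℝ := fun v ↦ (Ideal.absNorm v.asIdeal : ℝ) ^ (-2 : ℝ)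
  have hu (v) : 0 ≤ u v := by positivity
  refine summable_of_sum_le (c := Module.finrank (𝓞 K) (𝓞 L) * ∑' v, u v) (fun w ↦ by positivity) fun s ↦ ?_
  calc ∑ w ∈ s, (if w.asIdeal.inertiaDeg (𝓞 K) = 1 then 0 else (Ideal.absNorm w.asIdeal : ℝ)⁻¹)
      ≤ ∑ w ∈ s, u (w.under (𝓞 K)) := by
        refine Finset.sum_le_sum fun w _ ↦ ?_
        split_ifs with h
        · exact hu _
        · have h2 : 2 ≤ w.asIdeal.inertiaDeg (𝓞 K) := by
            have := inertiaDeg_pos (K := K) w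
            omega
          have hN := two_le_absNorm (w.under (𝓞 K))
          simp only [u]
          rw [absNorm_asIdeal (K := K), Real.rpow_neg (by linarith)]
          push_cast
          rw [Real.rpow_ofNat]
          exact inv_anti₀ (by positivity) (pow_le_pow_right₀ (by linarith) h2)
    _ = ∑ v ∈ s.image (HeightOneSpectrum.under (𝓞 K)), (s.filter fun w ↦ w.under (𝓞 K) = v).card • u v :=
        Finset.sum_comp u _
    _ ≤ ∑ v ∈ s.image (HeightOneSpectrum.under (𝓞 K)), Module.finrank (𝓞 K) (𝓞 L) * u v := by
        refine Finset.sum_le_sum fun v _ ↦ ?_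
        rw [nsmul_eq_mul]
        refine mul_le_mul_of_nonneg_right ?_ (hu v)
        have := card_le_finrank L v (s.subtype fun w ↦ w.under (𝓞 K) = v)
        rw [Finset.card_subtype] at this
        exact_mod_cast this
    _ ≤ _ := by
        rw [← Finset.mul_sum]
        exact mul_le_mul_of_nonneg_left (hK.sum_le_tsum _ fun v _ ↦ hu v) (Nat.cast_nonneg _)

variable (L) in
/-- The number of primes of `L` of relative degree one above a prime of `K`. -/
def degOneCount (v : HeightOneSpectrum (𝓞 K)) : ℂ :=
  ∑' w : {w : HeightOneSpectrum (𝓞 L) // w.under (𝓞 K) = v}, if w.1.asIdeal.inertiaDeg (𝓞 K) = 1 then 1 else 0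

/-- Mean values over the primes of `L` can be computed over the primes of `K`. -/
theorem HasDensity.mul_degOneCount {e : HeightOneSpectrum (𝓞 L) → ℂ} {δ : ℂ} (he : HasDensity e δ)
    {f : HeightOneSpectrum (𝓞 K) → ℂ} (hf : ∃ B, ∀ v, ‖f v * degOneCount L v‖ ≤ B)
    (hfe : ∀ w, w.asIdeal.inertiaDeg (𝓞 K) = 1 → e w = f (w.under (𝓞 K))) :
    HasDensity (fun v ↦ f v * degOneCount L v) δ := by
  obtain ⟨B, hB⟩ := he.bounded
  have hneg : HasDensity (fun w ↦ if w.asIdeal.inertiaDeg (𝓞 K) = 1 then 0 else e w) 0 := by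
    refine HasDensity.of_summable ⟨B, fun w ↦ ?_⟩ ?_
    · split_ifs
      · rw [norm_zero]
        exact (norm_nonneg _).trans (hB w)
      · exact hB w
    · refine .of_nonneg_of_le (fun w ↦ by positivity) (fun w ↦ ?_)
        ((summable_inv_absNorm_of_inertiaDeg_ne_one (K := K)).mul_left B)
      split_ifs
      · simp
      · exact mul_le_mul_of_nonneg_right (hB w) (by positivity)
  have h1 := he.sub hneg
  rw [sub_zero] at h1
  refine ⟨hf, h1.tendsto.congr' ?_⟩
  obtain ⟨C, hC⟩ := h1.bounded
  filter_upwards [eventually_Ioc] with s hs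
  congr 1
  have hsum := summable_primeSum hC hs.1
  rw [primeSum, primeSum, ← (Equiv.sigmaFiberEquiv (HeightOneSpectrum.under (𝓞 K))).tsum_eq]
  refine (Summable.tsum_sigma
    ((Equiv.summable_iff (Equiv.sigmaFiberEquiv (HeightOneSpectrum.under (𝓞 K)))).mpr hsum)).trans ?_
  refine tsum_congr fun v ↦ ?_
  rw [mul_right_comm, degOneCount, ← tsum_mul_left]
  refine tsum_congr fun ⟨w, hw⟩ ↦ ?_
  change (e w - if w.asIdeal.inertiaDeg (𝓞 K) = 1 then 0 else e w) * _ = _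
  by_cases h : w.asIdeal.inertiaDeg (𝓞 K) = 1
  · have hN := absNorm_asIdeal (K := K) w
    simp only [if_pos h, sub_zero, mul_one]
    rw [hfe w h, hw]
    change _ * (((Ideal.absNorm w.asIdeal : ℝ) ^ (-s) : ℝ) : ℂ) = _
    rw [hN, h, pow_one, hw]
  · simp [if_neg h]

variable (K) in
theorem hasDensity_inertiaDeg_ne_one :
    HasDensity ({w : HeightOneSpectrum (𝓞 L) | w.asIdeal.inertiaDeg (𝓞 K) ≠ 1}.indicator 1) 0 := by
  have h (w : HeightOneSpectrum (𝓞 L)) : ‖Set.indicator {w : HeightOneSpectrum (𝓞 L) | w.asIdeal.inertiaDeg (𝓞 K) ≠ 1}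
      (1 : HeightOneSpectrum (𝓞 L) → ℂ) w‖ = if w.asIdeal.inertiaDeg (𝓞 K) = 1 then 0 else 1 := by
    rw [Set.indicator_apply]
    split_ifs <;> simp_all
  refine HasDensity.of_summable ⟨1, fun w ↦ ?_⟩ ?_
  · rw [h]
    split_ifs <;> norm_num
  · refine (summable_inv_absNorm_of_inertiaDeg_ne_one (K := K)).congr fun w ↦ ?_
    rw [h]
    split_ifs <;> simp

end DegreeOne

noncomputable section SplitPrimes

open Filter Topology
open scoped Classical ComplexConjugate

section Extension

variable {K L : Type*} [Field K] [NumberField K] [Field L] [NumberField L] [Algebra K L]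

theorem exists_sub_algebraMap_mem {w : HeightOneSpectrum (𝓞 L)} (h : w.asIdeal.inertiaDeg (𝓞 K) = 1) (s : 𝓞 L) :
    ∃ x : 𝓞 K, algebraMap (𝓞 K) (𝓞 L) x - s ∈ w.asIdeal := by
  set v := w.under (𝓞 K)
  let φ : 𝓞 K ⧸ v.asIdeal →+* 𝓞 L ⧸ w.asIdeal := Ideal.quotientMap w.asIdeal (algebraMap (𝓞 K) (𝓞 L)) le_rfl
  have hφ : Function.Injective φ := Ideal.quotientMap_injective
  have hcard : Nat.card (𝓞 L ⧸ w.asIdeal) ≤ Nat.card (𝓞 K ⧸ v.asIdeal) := by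
    have := absNorm_asIdeal (K := K) w
    rw [h, pow_one] at this
    exact this.le
  have : Finite (𝓞 L ⧸ w.asIdeal) := Ideal.finiteQuotientOfFreeOfNeBot _ w.ne_bot
  obtain ⟨y, hy⟩ := (hφ.bijective_of_nat_card_le hcard).2 (Ideal.Quotient.mk _ s)
  obtain ⟨x, rfl⟩ := Ideal.Quotient.mk_surjective y
  refine ⟨x, ?_⟩
  rw [← Ideal.Quotient.eq, ← hy]
  exact (Ideal.quotientMap_mk ..).symm

theorem exists_sq_sub_mem {w : HeightOneSpectrum (𝓞 L)} (h : w.asIdeal.inertiaDeg (𝓞 K) = 1) {t : 𝓞 K} {s : 𝓞 L}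
    (hs : s ^ 2 = algebraMap (𝓞 K) (𝓞 L) t) : ∃ x : 𝓞 K, x ^ 2 - t ∈ (w.under (𝓞 K)).asIdeal := by
  obtain ⟨x, hx⟩ := exists_sub_algebraMap_mem h s
  refine ⟨x, ?_⟩
  change algebraMap (𝓞 K) (𝓞 L) (x ^ 2 - t) ∈ w.asIdeal
  rw [map_sub, map_pow, ← hs, sq_sub_sq]
  exact Ideal.mul_mem_left _ _ hx

/-- If `L` contains a square root of `-1`, norms from `L` are totally positive. -/
theorem norm_pos_of_sq_eq_neg_one {i : L} (hi : i ^ 2 = -1) {a : L} (ha : a ≠ 0) (σ : K →+* ℝ) :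
    0 < σ (Algebra.norm K a) := by
  let _ : Algebra K ℂ := (Complex.ofRealHom.comp σ).toAlgebra
  have hσ (x : K) : algebraMap K ℂ x = (σ x : ℂ) := rfl
  let c : (L →ₐ[K] ℂ) → (L →ₐ[K] ℂ) := fun τ ↦
    { (starRingEnd ℂ).comp τ.toRingHom with
      commutes' := fun x ↦ by
        change conj (τ (algebraMap K L x)) = _
        rw [τ.commutes, hσ, Complex.conj_ofReal] }
  have hc (τ : L →ₐ[K] ℂ) (x : L) : c τ x = conj (τ x) := rfl
  have h1 : ∏ τ : L →ₐ[K] ℂ, τ a / (‖τ a‖ : ℂ) = 1 := by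
    refine Finset.prod_involution (fun τ _ ↦ c τ) (fun τ _ ↦ ?_) (fun τ _ _ h ↦ ?_) (fun _ _ ↦ Finset.mem_univ _)
      fun τ _ ↦ ?_
    · have hne : (‖τ a‖ : ℂ) ≠ 0 := by
        rw [Complex.ofReal_ne_zero, norm_ne_zero_iff]
        exact (map_ne_zero τ).mpr ha
      rw [hc, RCLike.norm_conj, div_mul_div_comm, Complex.mul_conj, Complex.normSq_eq_norm_sq]
      field_simp
      push_cast
      rfl
    · have h2 : conj (τ i) = τ i := by rw [← hc, h]
      have h3 : τ i ^ 2 = -1 := by rw [← map_pow, hi, map_neg, map_one]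
      obtain ⟨r, hr⟩ := Complex.conj_eq_iff_real.mp h2
      rw [hr] at h3
      have : r ^ 2 = -1 := by exact_mod_cast h3
      nlinarith [sq_nonneg r]
    · ext x
      rw [hc, hc, Complex.conj_conj]
  have h2 : algebraMap K ℂ (Algebra.norm K a) = (∏ τ : L →ₐ[K] ℂ, ‖τ a‖ : ℝ) := by
    rw [Algebra.norm_eq_prod_embeddings]
    rw [Finset.prod_div_distrib, div_eq_one_iff_eq] at h1
    · rw [h1, Complex.ofReal_prod]
    · refine Finset.prod_ne_zero_iff.mpr fun τ _ ↦ ?_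
      rw [Complex.ofReal_ne_zero, norm_ne_zero_iff]
      exact (map_ne_zero τ).mpr ha
  rw [hσ] at h2
  rw [Complex.ofReal_injective h2]
  exact Finset.prod_pos fun τ _ ↦ norm_pos_iff.mpr ((map_ne_zero τ).mpr ha)

variable (L) in
theorem finite_under_eq (v : HeightOneSpectrum (𝓞 K)) : Finite {w : HeightOneSpectrum (𝓞 L) // w.under (𝓞 K) = v} := by
  by_contra hinf
  have := not_finite_iff_infinite.mp hinf
  obtain ⟨T, hT⟩ := Infinite.exists_subset_card_eq {w : HeightOneSpectrum (𝓞 L) // w.under (𝓞 K) = v}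
    (Module.finrank (𝓞 K) (𝓞 L) + 1)
  have h := card_le_finrank L v T
  lia

variable (L) in
theorem exists_norm_prime {m : ℕ} (hm : 2 ≤ m) {i : L} (hi : i ^ 2 = -1) {E : Set (HeightOneSpectrum (𝓞 K))} (hE : E.Finite) :
    ∃ (w : HeightOneSpectrum (𝓞 L)) (p : 𝓞 K), w.asIdeal.inertiaDeg (𝓞 K) = 1 ∧ w.under (𝓞 K) ∉ E ∧
      (w.under (𝓞 K)).asIdeal = Ideal.span {p} ∧ (m : 𝓞 K) ∣ p - 1 ∧ ∀ σ : K →+* ℝ, 0 < σ (p : K) := by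
  have : Fact (2 ≤ m) := ⟨hm⟩
  have hfin : {w : HeightOneSpectrum (𝓞 L) | w.under (𝓞 K) ∈ E}.Finite := by
    refine Set.Finite.preimage' hE fun v _ ↦ ?_
    exact finite_under_eq L v
  have hE' : HasDensity (({w : HeightOneSpectrum (𝓞 L) | w.asIdeal.inertiaDeg (𝓞 K) ≠ 1} ∪
      {w | w.under (𝓞 K) ∈ E}).indicator 1) 0 := by
    refine (hasDensity_inertiaDeg_ne_one K).congr_of_finite (hfin.subset fun w hw ↦ ?_)
    by_contra h
    refine hw ?_
    simp only [Set.indicator_apply, Set.mem_union]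
    congr 1
    exact propext ⟨Or.inl, fun h' ↦ h'.resolve_right h⟩
  have h1 : IsCoprime (Ideal.span {(1 : 𝓞 L)}) (Ideal.span {(m : 𝓞 L)}) :=
    isCoprime_span_of_dvd_sub_one (by simp)
  obtain ⟨w, a, hw, hwa, hma⟩ := exists_prime_element h1 hE'
  have hw1 : w.asIdeal.inertiaDeg (𝓞 K) = 1 := by
    by_contra h
    exact hw (Or.inl h)
  refine ⟨w, Algebra.intNorm (𝓞 K) (𝓞 L) a, hw1, fun h ↦ hw (Or.inr h), ?_, dvd_intNorm_sub_one hma, fun σ ↦ ?_⟩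
  · rw [← Ideal.relNorm_singleton, ← hwa, relNorm_asIdeal, hw1, pow_one]
  · have ha : (a : L) ≠ 0 := by
      rw [ne_eq, RingOfIntegers.coe_eq_zero_iff]
      rintro rfl
      exact w.ne_bot (by simpa using hwa)
    have := norm_pos_of_sq_eq_neg_one hi ha σ
    rwa [← Algebra.algebraMap_intNorm (A := 𝓞 K) (K := K) (L := L) (B := 𝓞 L) a] at this

end Extension

variable {K : Type*} [Field K] [NumberField K]

/-- There are totally positive prime elements congruent to `1` modulo `m`, modulo which all elements
of a given finite set are squares. -/
theorem exists_totally_positive_prime {m : ℕ} (hm : 2 ≤ m) (T : Finset (𝓞 K))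
    {E : Set (HeightOneSpectrum (𝓞 K))} (hE : E.Finite) :
    ∃ (v : HeightOneSpectrum (𝓞 K)) (p : 𝓞 K), v ∉ E ∧ v.asIdeal = Ideal.span {p} ∧ (m : 𝓞 K) ∣ p - 1 ∧
      (∀ σ : K →+* ℝ, 0 < σ (p : K)) ∧ ∀ t ∈ T, ∃ x : 𝓞 K, x ^ 2 - t ∈ v.asIdeal := by
  let f : Polynomial K := ∏ t ∈ insert (-1) T, (Polynomial.X ^ 2 - Polynomial.C (t : K))
  let L := f.SplittingField
  have : NumberField L := NumberField.of_module_finite K L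
  have hroot (t : 𝓞 K) (ht : t ∈ insert (-1) T) : ∃ s : L, s ^ 2 = algebraMap K L t := by
    have hsp := Polynomial.SplittingField.splits f
    have h1 : ((Polynomial.X ^ 2 - Polynomial.C (t : K)).map (algebraMap K L)).Splits := by
      refine hsp.of_dvd ?_ (Polynomial.map_dvd _ (Finset.dvd_prod_of_mem _ ht))
      rw [Polynomial.map_ne_zero_iff (algebraMap K L).injective]
      exact Finset.prod_ne_zero_iff.mpr fun t _ ↦ Polynomial.X_pow_sub_C_ne_zero two_pos _
    obtain ⟨s, hs⟩ := h1.exists_eval_eq_zero (by simp [Polynomial.degree_X_pow_sub_C])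
    exact ⟨s, by simpa [sub_eq_zero] using hs⟩
  obtain ⟨i, hi⟩ := hroot (-1) (Finset.mem_insert_self _ _)
  obtain ⟨w, p, hw, hwE, hp, hmp, hpos⟩ := exists_norm_prime (K := K) L hm (i := i) (by simpa using hi) hE
  refine ⟨_, p, hwE, hp, hmp, hpos, fun t ht ↦ ?_⟩
  obtain ⟨s, hs⟩ := hroot t (Finset.mem_insert_of_mem ht)
  have hint : IsIntegral ℤ s := .of_pow two_pos (hs ▸ t.isIntegral_coe.map (Algebra.ofId K L |>.restrictScalars ℤ))
  obtain ⟨S, rfl⟩ := (IsIntegralClosure.isIntegral_iff (A := 𝓞 L)).mp hint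
  exact exists_sq_sub_mem hw (s := S) (RingOfIntegers.ext (by
    change algebraMap (𝓞 L) L (S ^ 2) = _
    rw [map_pow]
    exact hs))

end SplitPrimes

noncomputable section QuadraticTwist

open Filter Topology
open scoped Classical

section Symbol

variable {K : Type*} [Field K] [NumberField K]

/-- The quadratic symbol of `g` modulo the prime `v`, with value `1` on primes dividing `g`. -/
def quadSymbol (g : 𝓞 K) (v : HeightOneSpectrum (𝓞 K)) : ℂ :=
  if ∃ x, x ^ 2 - g ∈ v.asIdeal then 1 else -1

omit [NumberField K] in
theorem norm_quadSymbol (g : 𝓞 K) (v : HeightOneSpectrum (𝓞 K)) : ‖quadSymbol g v‖ = 1 := by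
  rw [quadSymbol]
  split_ifs <;> simp

end Symbol

section Extension

variable {K L : Type*} [Field K] [NumberField K] [Field L] [NumberField L] [Algebra K L]

variable (L) in
theorem norm_degOneCount_le (v : HeightOneSpectrum (𝓞 K)) :
    ‖degOneCount L v‖ ≤ Module.finrank (𝓞 K) (𝓞 L) := by
  have := finite_under_eq L v
  let _ := Fintype.ofFinite {w : HeightOneSpectrum (𝓞 L) // w.under (𝓞 K) = v}
  rw [degOneCount, tsum_fintype]
  refine (norm_sum_le_of_le _ (f := fun w : {w : HeightOneSpectrum (𝓞 L) // w.under (𝓞 K) = v} ↦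
    if w.1.asIdeal.inertiaDeg (𝓞 K) = 1 then (1 : ℂ) else 0) (n := fun _ ↦ (1 : ℝ)) fun w _ ↦ ?_).trans ?_
  · split_ifs <;> simp
  · simpa using card_le_finrank L v Finset.univ

theorem degOneCount_eq {g : 𝓞 K} {s : 𝓞 L} (hs : s ^ 2 = algebraMap (𝓞 K) (𝓞 L) g) {σ : L ≃ₐ[K] L}
    (hσ : σ s = -s) (h2 : Module.finrank K L = 2) {v : HeightOneSpectrum (𝓞 K)} (hv : 2 * g ∉ v.asIdeal) :
    degOneCount L v = 1 + quadSymbol g v := by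
  by_cases hg : ∃ x, x ^ 2 - g ∈ v.asIdeal
  · obtain ⟨x, hx⟩ := hg
    rw [quadSymbol, if_pos ⟨x, hx⟩]
    have hrank : Module.finrank (𝓞 K) (𝓞 L) = 2 := by
      rw [← h2]
      exact (IsFractionRing.finrank_eq (𝓞 K) K (𝓞 L) L).symm
    obtain ⟨y, w, hwv, hy, hxy⟩ : ∃ (y : 𝓞 K) (w : HeightOneSpectrum (𝓞 L)), w.under (𝓞 K) = v ∧
        s - algebraMap (𝓞 K) (𝓞 L) y ∈ w.asIdeal ∧ y ^ 2 - g ∈ v.asIdeal := by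
      have := v.isPrime
      obtain ⟨⟨P, hP, hPv⟩⟩ := v.asIdeal.nonempty_primesOver (S := 𝓞 L)
      let w : HeightOneSpectrum (𝓞 L) := ⟨P, hP, Ideal.ne_bot_of_liesOver_of_ne_bot v.ne_bot P⟩
      have hwv : w.under (𝓞 K) = v := HeightOneSpectrum.ext hPv.over.symm
      have hmem : (s - algebraMap (𝓞 K) (𝓞 L) x) * (s - algebraMap (𝓞 K) (𝓞 L) (-x)) ∈ w.asIdeal := by
        have h : x ^ 2 - g ∈ (w.under (𝓞 K)).asIdeal := hwv ▸ hx
        have h' : algebraMap (𝓞 K) (𝓞 L) (x ^ 2 - g) ∈ w.asIdeal := h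
        rw [map_sub, map_pow, ← hs] at h'
        rw [← neg_mem_iff]
        convert h' using 1
        rw [map_neg]
        ring
      rcases w.isPrime.mem_or_mem hmem with h | h
      · exact ⟨x, w, hwv, h, hx⟩
      · exact ⟨-x, w, hwv, h, by rwa [neg_sq]⟩
    let τ : 𝓞 L ≃+* 𝓞 L := RingOfIntegers.mapRingEquiv σ.toRingEquiv
    have hτs : τ s = -s := RingOfIntegers.ext hσ
    have hτ (z : 𝓞 K) : τ (algebraMap (𝓞 K) (𝓞 L) z) = algebraMap (𝓞 K) (𝓞 L) z :=
      RingOfIntegers.ext (σ.commutes z)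
    let w' := HeightOneSpectrum.comap τ.toRingHom τ.surjective w
    have hwv' : w'.under (𝓞 K) = v := by
      rw [← hwv]
      refine HeightOneSpectrum.ext (Ideal.ext fun z ↦ ?_)
      change τ (algebraMap (𝓞 K) (𝓞 L) z) ∈ w.asIdeal ↔ algebraMap (𝓞 K) (𝓞 L) z ∈ w.asIdeal
      rw [hτ]
    have hne : w ≠ w' := by
      intro h
      have h1 : τ (s - algebraMap (𝓞 K) (𝓞 L) y) ∈ w.asIdeal := by
        have : s - algebraMap (𝓞 K) (𝓞 L) y ∈ w'.asIdeal := h ▸ hy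
        exact this
      rw [map_sub, hτs, hτ] at h1
      have h3 : algebraMap (𝓞 K) (𝓞 L) (2 * y) ∈ w.asIdeal := by
        rw [← neg_mem_iff]
        convert add_mem hy h1 using 1
        rw [map_mul, map_ofNat]
        ring
      have h4 : 2 * y ∈ v.asIdeal := by rw [← hwv]; exact h3
      refine hv ?_
      have := v.asIdeal.mul_mem_right y h4
      have := sub_mem this (v.asIdeal.mul_mem_left 2 hxy)
      convert this using 1
      ring
    have := finite_under_eq L v
    let _ := Fintype.ofFinite {w : HeightOneSpectrum (𝓞 L) // w.under (𝓞 K) = v}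
    let T : Finset {w : HeightOneSpectrum (𝓞 L) // w.under (𝓞 K) = v} := {⟨w, hwv⟩, ⟨w', hwv'⟩}
    have hT : T.card = 2 := Finset.card_pair (by simpa using hne)
    have huniv : Finset.univ = T := by
      refine (Finset.eq_of_subset_of_card_le (Finset.subset_univ T) ?_).symm
      rw [hT, ← hrank]
      exact card_le_finrank L v Finset.univ
    have hdeg (u : {w : HeightOneSpectrum (𝓞 L) // w.under (𝓞 K) = v}) : u.1.asIdeal.inertiaDeg (𝓞 K) = 1 := by
      have h1 := sum_inertiaDeg_le L v Finset.univ
      rw [hrank, ← hT, ← huniv, Finset.card_eq_sum_ones] at h1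
      have h2 := (Finset.sum_eq_sum_iff_of_le fun u _ ↦ inertiaDeg_pos (K := K) u.1).mp
        (le_antisymm (Finset.sum_le_sum fun u _ ↦ inertiaDeg_pos (K := K) u.1) h1)
      exact (h2 u (Finset.mem_univ u)).symm
    rw [degOneCount, tsum_fintype, Finset.sum_congr rfl fun u _ ↦ if_pos (hdeg u)]
    rw [huniv, Finset.sum_const, hT]
    norm_num
  · rw [quadSymbol, if_neg hg, degOneCount, add_neg_cancel]
    refine (tsum_congr fun w ↦ if_neg fun h ↦ hg ?_).trans tsum_zero
    obtain ⟨x, hx⟩ := exists_sq_sub_mem h hs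
    exact ⟨x, w.2 ▸ hx⟩

theorem hasDensity_mul_quadSymbol {m : ℕ} [Fact (2 ≤ m)] {g : 𝓞 K} (hg : g ≠ 0) {s : 𝓞 L}
    (hs : s ^ 2 = algebraMap (𝓞 K) (𝓞 L) g) {σ : L ≃ₐ[K] L} (hσ : σ s = -s) (h2 : Module.finrank K L = 2)
    (F : RayClass K m → ℂ) :
    HasDensity (fun v ↦ F (rayClass m v.asIdeal) * quadSymbol g v)
      (rayMean (fun r : RayClass L m ↦ F (rayNorm K L m r)) - rayMean F) := by
  obtain ⟨B, hB⟩ := (hasDensity_rayMean F).bounded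
  have h := (hasDensity_rayMean (fun r : RayClass L m ↦ F (rayNorm K L m r))).mul_degOneCount
    (f := fun v ↦ F (rayClass m v.asIdeal)) ⟨B * Module.finrank (𝓞 K) (𝓞 L), fun v ↦ ?_⟩ fun w hw ↦ ?_
  · refine (h.sub (hasDensity_rayMean F)).congr_of_finite ?_
    refine (finite_setOf_mem_asIdeal (K := K) (x := 2 * g) (mul_ne_zero two_ne_zero hg)).subset fun v hv ↦ ?_
    by_contra h
    refine hv ?_
    rw [degOneCount_eq hs hσ h2 h]
    ring
  · rw [norm_mul]
    exact mul_le_mul (hB v) (norm_degOneCount_le L v) (norm_nonneg _) ((norm_nonneg _).trans (hB v))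
  · rw [rayNorm_rayClass, relNorm_asIdeal, hw, pow_one]

end Extension

theorem sum_re_nonneg_of_mul_eq {G : Type*} [Group G] [Fintype G] {f : G → ℂ}
    (hf : ∀ x y, f x ≠ 0 → f (x * y) = f x * f y) : 0 ≤ (∑ x, f x).re := by
  by_cases h : ∃ x, f x ≠ 0 ∧ f x ≠ 1
  · obtain ⟨x, hx0, hx1⟩ := h
    have h2 : ∑ y, f y = f x * ∑ y, f y := by
      rw [Finset.mul_sum, ← Equiv.sum_comp (Equiv.mulLeft x)]
      exact Finset.sum_congr rfl fun y _ ↦ hf x y hx0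
    have h3 : ∑ y, f y = 0 := by
      by_contra h
      exact hx1 (mul_right_cancel₀ h ((one_mul _).trans h2)).symm
    rw [h3, Complex.zero_re]
  · push Not at h
    rw [Complex.re_sum]
    refine Finset.sum_nonneg fun x _ ↦ ?_
    by_cases h0 : f x = 0
    · rw [h0, Complex.zero_re]
    · rw [h x h0, Complex.one_re]
      exact zero_le_one

section Main

universe u

variable {K : Type u} [Field K] [NumberField K] {m : ℕ} [Fact (2 ≤ m)]

theorem exists_hasDensity_mul_quadSymbol {g : 𝓞 K} (hg : ¬ IsSquare (g : K)) (F : RayClass K m → ℂ) :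
    ∃ (L : Type u) (_ : Field L) (_ : NumberField L) (_ : Algebra K L),
      HasDensity (fun v ↦ F (rayClass m v.asIdeal) * quadSymbol g v)
        (rayMean (fun r : RayClass L m ↦ F (rayNorm K L m r)) - rayMean F) := by
  let p : Polynomial K := Polynomial.X ^ 2 - Polynomial.C (g : K)
  have hp : Irreducible p := X_pow_sub_C_irreducible_of_prime Nat.prime_two fun b hb ↦
    hg ⟨b, by rw [← hb, sq]⟩
  have hfact : Fact (Irreducible p) := ⟨hp⟩
  let L := AdjoinRoot p
  have hmonic : p.Monic := Polynomial.monic_X_pow_sub_C _ two_ne_zero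
  have hfin : Module.Finite K L := hmonic.finite_adjoinRoot
  have hnf : NumberField L := NumberField.of_module_finite K L
  have hroot : AdjoinRoot.root p ^ 2 = algebraMap K L g := by
    have h := AdjoinRoot.eval₂_root p
    rw [Polynomial.eval₂_sub, Polynomial.eval₂_pow, Polynomial.eval₂_X, Polynomial.eval₂_C, sub_eq_zero] at h
    exact h
  let σ : L →ₐ[K] L := AdjoinRoot.liftAlgHom p (Algebra.ofId K L) (-AdjoinRoot.root p) (by
    rw [Polynomial.eval₂_sub, Polynomial.eval₂_pow, Polynomial.eval₂_X, Polynomial.eval₂_C, neg_sq, hroot]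
    exact sub_self _)
  have hint : IsIntegral ℤ (AdjoinRoot.root p) :=
    .of_pow two_pos (hroot ▸ g.isIntegral_coe.map (Algebra.ofId K L |>.restrictScalars ℤ))
  obtain ⟨s, hs⟩ := (IsIntegralClosure.isIntegral_iff (A := 𝓞 L)).mp hint
  refine ⟨L, inferInstance, hnf, inferInstance, hasDensity_mul_quadSymbol (s := s) ?_ ?_
    (σ := AlgEquiv.ofBijective σ (Algebra.IsAlgebraic.algHom_bijective σ)) ?_ ?_ F⟩
  · rintro rfl
    exact hg (by simp)
  · refine RingOfIntegers.ext ?_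
    change algebraMap (𝓞 L) L (s ^ 2) = _
    rw [map_pow, hs, hroot]
    rfl
  · change σ (algebraMap (𝓞 L) L s) = - algebraMap (𝓞 L) L s
    rw [hs]
    exact AdjoinRoot.liftAlgHom_root ..
  · rw [(AdjoinRoot.powerBasis hp.ne_zero).finrank, AdjoinRoot.powerBasis_dim]
    exact Polynomial.natDegree_X_pow_sub_C

theorem rayMean_const (z : ℂ) : rayMean (fun _ : RayClass K m ↦ z) = z := by
  simp [rayMean]

/-- The quadratic symbol of a nonsquare has mean value `0`. -/
theorem hasDensity_quadSymbol {g : 𝓞 K} (hg : ¬ IsSquare (g : K)) : HasDensity (quadSymbol g) 0 := by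
  have : Fact (2 ≤ 2) := ⟨le_rfl⟩
  obtain ⟨L, _, _, _, h⟩ := exists_hasDensity_mul_quadSymbol (m := 2) hg fun _ ↦ 1
  rw [rayMean_const, rayMean_const, sub_self] at h
  simpa using h

theorem exists_hasDensity_mul_quadSymbol_nonneg {g : 𝓞 K} (hg : ¬ IsSquare (g : K)) {F : RayClass K m → ℂ}
    (hF : ∀ x y, F x ≠ 0 → F (x * y) = F x * F y) (hF0 : rayMean F = 0) :
    ∃ δ : ℂ, 0 ≤ δ.re ∧ HasDensity (fun v ↦ F (rayClass m v.asIdeal) * quadSymbol g v) δ := by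
  obtain ⟨L, _, _, _, h⟩ := exists_hasDensity_mul_quadSymbol hg F
  rw [hF0, sub_zero] at h
  refine ⟨_, ?_, h⟩
  rw [rayMean, ← Complex.ofReal_natCast, ← Complex.ofReal_inv, Complex.re_ofReal_mul]
  refine mul_nonneg (by positivity) (sum_re_nonneg_of_mul_eq fun x y hx ↦ ?_)
  · rw [Units.val_mul, map_mul]
    exact hF _ _ hx

end Main

end QuadraticTwist

noncomputable section PrincipalSymbol

open scoped Classical

variable {K : Type*} [Field K] [NumberField K] {v : HeightOneSpectrum (𝓞 K)} {x y : 𝓞 K}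

omit [NumberField K] in
theorem quadSymbol_eq_one_iff : quadSymbol x v = 1 ↔ ∃ z, z ^ 2 - x ∈ v.asIdeal := by
  rw [quadSymbol]
  split_ifs with h
  · exact ⟨fun _ ↦ h, fun _ ↦ rfl⟩
  · exact ⟨fun h' ↦ absurd h' (by norm_num), fun h' ↦ absurd h' h⟩

omit [NumberField K] in
theorem quadSymbol_eq_or (x : 𝓞 K) (v : HeightOneSpectrum (𝓞 K)) : quadSymbol x v = 1 ∨ quadSymbol x v = -1 := by
  rw [quadSymbol]
  split_ifs <;> simp

omit [NumberField K] in
theorem quadSymbol_congr (h : x - y ∈ v.asIdeal) : quadSymbol x v = quadSymbol y v := by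
  rw [quadSymbol, quadSymbol]
  refine if_congr (exists_congr fun z ↦ ?_) rfl rfl
  rw [← sub_add_sub_cancel (z ^ 2) x y, add_mem_cancel_right h]

theorem exists_quadSymbol_eq (v : HeightOneSpectrum (𝓞 K)) :
    ∃ χ : MulChar (𝓞 K ⧸ v.asIdeal) ℤ, (∀ x, x ∉ v.asIdeal → quadSymbol x v = χ (Ideal.Quotient.mk _ x)) ∧
      (2 ∉ v.asIdeal → χ ≠ 1) := by
  have := v.isMaximal
  have : Finite (𝓞 K ⧸ v.asIdeal) := Ideal.finiteQuotientOfFreeOfNeBot _ v.ne_bot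
  let _ := Fintype.ofFinite (𝓞 K ⧸ v.asIdeal)
  let _ := Ideal.Quotient.field v.asIdeal
  refine ⟨quadraticChar (𝓞 K ⧸ v.asIdeal), fun x hx ↦ ?_, fun h2 ↦ quadraticChar_ne_one fun h ↦ h2 ?_⟩
  · have hx0 : Ideal.Quotient.mk v.asIdeal x ≠ 0 := by rwa [ne_eq, Ideal.Quotient.eq_zero_iff_mem]
    have hiff : (∃ z, z ^ 2 - x ∈ v.asIdeal) ↔ IsSquare (Ideal.Quotient.mk v.asIdeal x) := by
      rw [isSquare_iff_exists_sq]
      constructor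
      · rintro ⟨z, hz⟩
        exact ⟨Ideal.Quotient.mk _ z, by rw [← map_pow]; exact (Ideal.Quotient.eq.mpr hz).symm⟩
      · rintro ⟨z, hz⟩
        obtain ⟨z, rfl⟩ := Ideal.Quotient.mk_surjective z
        exact ⟨z, Ideal.Quotient.eq.mp (by rw [map_pow, hz])⟩
    rw [quadSymbol]
    split_ifs with h
    · rw [(quadraticChar_one_iff_isSquare hx0).mpr (hiff.mp h), Int.cast_one]
    · rw [quadraticChar_neg_one_iff_not_isSquare.mpr fun h' ↦ h (hiff.mpr h'), Int.cast_neg, Int.cast_one]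
  · rw [← Ideal.Quotient.eq_zero_iff_mem, map_ofNat]
    have := ringChar.charP (𝓞 K ⧸ v.asIdeal)
    rw [h] at this
    exact CharTwo.two_eq_zero

theorem quadSymbol_mul (hx : x ∉ v.asIdeal) (hy : y ∉ v.asIdeal) :
    quadSymbol (x * y) v = quadSymbol x v * quadSymbol y v := by
  obtain ⟨χ, hχ, -⟩ := exists_quadSymbol_eq v
  rw [hχ x hx, hχ y hy, hχ _ fun h ↦ (v.isPrime.mem_or_mem h).elim hx hy, map_mul, map_mul, Int.cast_mul]

theorem exists_quadSymbol_eq_neg_one (h2 : 2 ∉ v.asIdeal) : ∃ x, x ∉ v.asIdeal ∧ quadSymbol x v = -1 := by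
  obtain ⟨χ, hχ, h⟩ := exists_quadSymbol_eq v
  by_contra! h'
  refine h h2 (MulChar.ext fun u ↦ ?_)
  obtain ⟨x, hx⟩ := Ideal.Quotient.mk_surjective (u : 𝓞 K ⧸ v.asIdeal)
  have := v.isPrime
  have hxv : x ∉ v.asIdeal := fun hmem ↦ u.ne_zero (hx.symm.trans (Ideal.Quotient.eq_zero_iff_mem.mpr hmem))
  have h1 := (quadSymbol_eq_or x v).resolve_right (h' x hxv)
  rw [hχ x hxv, hx] at h1
  rw [MulChar.one_apply_coe]
  exact_mod_cast h1

theorem exists_isCoprime_of_forall_notMem {M : ℕ} (hM : M ≠ 0) (y : HeightOneSpectrum (𝓞 K) → 𝓞 K)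
    (hy : ∀ v, y v ∉ v.asIdeal) :
    ∃ x : 𝓞 K, IsCoprime (Ideal.span {x}) (Ideal.span {(M : 𝓞 K)}) ∧
      ∀ v : HeightOneSpectrum (𝓞 K), (M : 𝓞 K) ∈ v.asIdeal → x - y v ∈ v.asIdeal := by
  have hM0 : (M : 𝓞 K) ≠ 0 := Nat.cast_ne_zero.mpr hM
  obtain ⟨x, hx⟩ := exists_forall_sub_mem_ideal (s := (finite_setOf_mem_asIdeal hM0).toFinset)
    (fun v : HeightOneSpectrum (𝓞 K) ↦ v.asIdeal) (fun _ ↦ 1) (fun v _ ↦ v.prime)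
    (fun v _ w _ h h' ↦ h (HeightOneSpectrum.ext h')) fun v ↦ y v
  have hx' (v : HeightOneSpectrum (𝓞 K)) (hv : (M : 𝓞 K) ∈ v.asIdeal) : x - y v ∈ v.asIdeal := by
    simpa using hx v (by simpa using hv)
  refine ⟨x, ?_, hx'⟩
  rw [Ideal.isCoprime_iff_sup_eq]
  by_contra h
  obtain ⟨P, hP, hle⟩ := Ideal.exists_le_maximal _ h
  have hMP : (M : 𝓞 K) ∈ P := hle (Ideal.mem_sup_right (Ideal.mem_span_singleton_self _))
  have hxP : x ∈ P := hle (Ideal.mem_sup_left (Ideal.mem_span_singleton_self _))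
  let v : HeightOneSpectrum (𝓞 K) := ⟨P, hP.isPrime, fun h ↦ hM0 (by simpa [h] using hMP)⟩
  exact hy v (by simpa using sub_mem (show x ∈ v.asIdeal from hxP) (hx' v hMP))

variable (v) in
/-- The quadratic symbol modulo `v` of a generator of an ideal coprime to `m`, and `0` on all other ideals. -/
def idealSymbol (m : ℕ) (I : Ideal (𝓞 K)) : ℂ :=
  if h : IsCoprime I (Ideal.span {(m : 𝓞 K)}) ∧ ∃ x, I = Ideal.span {x} then quadSymbol h.2.choose v else 0

omit [NumberField K] in
theorem notMem_asIdeal_of_isCoprime {m : ℕ} (hm : (m : 𝓞 K) ∈ v.asIdeal)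
    (h : IsCoprime (Ideal.span {x}) (Ideal.span {(m : 𝓞 K)})) : x ∉ v.asIdeal := by
  intro hx
  refine v.isPrime.ne_top (top_le_iff.mp ?_)
  rw [← Ideal.isCoprime_iff_sup_eq.mp h, sup_le_iff, Ideal.span_singleton_le_iff_mem, Ideal.span_singleton_le_iff_mem]
  exact ⟨hx, hm⟩

omit [NumberField K] in
theorem idealSymbol_eq_zero_iff {m : ℕ} {I : Ideal (𝓞 K)} :
    idealSymbol v m I = 0 ↔ ¬ (IsCoprime I (Ideal.span {(m : 𝓞 K)}) ∧ ∃ x, I = Ideal.span {x}) := by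
  rw [idealSymbol]
  split_ifs with h
  · exact ⟨fun h' ↦ absurd (norm_quadSymbol (h.2.choose) v) (by simp [h']), fun h' ↦ absurd h h'⟩
  · exact ⟨fun _ ↦ h, fun _ ↦ rfl⟩

section Modulus

variable {m : ℕ} (hm : (m : 𝓞 K) ∈ v.asIdeal) (hu : ∀ u : (𝓞 K)ˣ, quadSymbol (u : 𝓞 K) v = 1)

include hm hu

theorem idealSymbol_span (hx : IsCoprime (Ideal.span {x}) (Ideal.span {(m : 𝓞 K)})) :
    idealSymbol v m (Ideal.span {x}) = quadSymbol x v := by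
  have h : IsCoprime (Ideal.span {x}) (Ideal.span {(m : 𝓞 K)}) ∧ ∃ y, Ideal.span {x} = Ideal.span {y} := ⟨hx, x, rfl⟩
  rw [idealSymbol, dif_pos h]
  obtain ⟨u, hxu⟩ := Ideal.span_singleton_eq_span_singleton.mp h.2.choose_spec
  rw [← hxu, quadSymbol_mul (notMem_asIdeal_of_isCoprime hm hx) fun h ↦
    v.isPrime.ne_top (Ideal.eq_top_of_isUnit_mem _ h u.isUnit), hu, mul_one]

theorem idealSymbol_mul {I J : Ideal (𝓞 K)} (hI : idealSymbol v m I ≠ 0) :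
    idealSymbol v m (I * J) = idealSymbol v m I * idealSymbol v m J := by
  obtain ⟨hI1, x, rfl⟩ := not_not.mp (mt idealSymbol_eq_zero_iff.mpr hI)
  have hx0 : x ≠ 0 := by
    rintro rfl
    exact notMem_asIdeal_of_isCoprime hm hI1 (zero_mem _)
  by_cases hJ : idealSymbol v m J = 0
  · rw [hJ, mul_zero, idealSymbol_eq_zero_iff]
    rintro ⟨h, z, hz⟩
    refine idealSymbol_eq_zero_iff.mp hJ ⟨(IsCoprime.mul_left_iff.mp h).2, ?_⟩
    obtain ⟨y, rfl⟩ : x ∣ z := by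
      rw [← Ideal.span_singleton_le_span_singleton, ← hz]
      exact Ideal.mul_le_left
    refine ⟨y, ?_⟩
    rw [← Ideal.span_singleton_mul_span_singleton] at hz
    exact mul_left_cancel₀ (by simpa using hx0) hz
  · obtain ⟨hJ1, y, rfl⟩ := not_not.mp (mt idealSymbol_eq_zero_iff.mpr hJ)
    have hmul := hI1.mul_left hJ1
    rw [Ideal.span_singleton_mul_span_singleton] at hmul ⊢
    rw [idealSymbol_span hm hu hI1, idealSymbol_span hm hu hJ1, idealSymbol_span hm hu hmul,
      quadSymbol_mul (notMem_asIdeal_of_isCoprime hm hI1) (notMem_asIdeal_of_isCoprime hm hJ1)]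

variable [Fact (2 ≤ m)]

theorem idealSymbol_congr {I J : Ideal (𝓞 K)} (h : rayClass m I = rayClass m J) :
    idealSymbol v m I = idealSymbol v m J := by
  wlog hJ : idealSymbol v m J ≠ 0 generalizing I J
  · by_cases hI : idealSymbol v m I ≠ 0
    · exact (this h.symm hI).symm
    · rw [not_not.mp hI, not_not.mp hJ]
  · obtain ⟨hJ1, y, rfl⟩ := not_not.mp (mt idealSymbol_eq_zero_iff.mpr hJ)
    have hI1 := (isCoprime_iff_of_rayClass_eq h).mpr hJ1
    obtain ⟨x, rfl, hxy⟩ := exists_generator_of_rayClass_eq hJ1 h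
    rw [idealSymbol_span hm hu hI1, idealSymbol_span hm hu hJ1]
    exact quadSymbol_congr (v.asIdeal.mem_of_dvd hxy hm)

omit hm hu in
variable (v m) in
/-- The function induced by `idealSymbol` on ray classes. -/
def principalSymbol (r : RayClass K m) : ℂ := idealSymbol v m (rayClass_surjective m r).choose

theorem principalSymbol_rayClass (I : Ideal (𝓞 K)) : principalSymbol v m (rayClass m I) = idealSymbol v m I :=
  idealSymbol_congr hm hu (rayClass_surjective m (rayClass m I)).choose_spec

theorem principalSymbol_mul {r s : RayClass K m} (h : principalSymbol v m r ≠ 0) :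
    principalSymbol v m (r * s) = principalSymbol v m r * principalSymbol v m s := by
  obtain ⟨I, rfl⟩ := rayClass_surjective m r
  obtain ⟨J, rfl⟩ := rayClass_surjective m s
  rw [← map_mul, principalSymbol_rayClass hm hu, principalSymbol_rayClass hm hu, principalSymbol_rayClass hm hu]
  rw [principalSymbol_rayClass hm hu] at h
  exact idealSymbol_mul hm hu h

theorem rayMean_principalSymbol (h2 : 2 ∉ v.asIdeal) : rayMean (principalSymbol v m) = 0 := by
  have hm2 : 2 ≤ m := Fact.out
  obtain ⟨y, hy, hy1⟩ := exists_quadSymbol_eq_neg_one h2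
  obtain ⟨x, hx, hxy⟩ := exists_isCoprime_of_forall_notMem (K := K) (M := m) (by lia)
    (fun w ↦ if w = v then y else 1) fun w ↦ by
      split_ifs with h
      · exact h ▸ hy
      · exact fun h1 ↦ w.isPrime.ne_top ((Ideal.eq_top_iff_one _).mpr h1)
  obtain ⟨u, hu'⟩ := (isUnit_rayClass_iff hm2).mpr hx
  have hval : principalSymbol v m (u : RayClass K m) = -1 := by
    rw [hu', principalSymbol_rayClass hm hu, idealSymbol_span hm hu hx, ← hy1]
    exact quadSymbol_congr (by simpa using hxy v hm)
  have hsum : ∑ w : (RayClass K m)ˣ, principalSymbol v m w = - ∑ w : (RayClass K m)ˣ, principalSymbol v m w := by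
    rw [← Finset.sum_neg_distrib]
    conv_lhs => rw [← Equiv.sum_comp (Equiv.mulLeft u)]
    refine Finset.sum_congr rfl fun w _ ↦ ?_
    rw [Equiv.coe_mulLeft, Units.val_mul, principalSymbol_mul hm hu (by simp [hval]), hval, neg_one_mul]
  rw [rayMean, self_eq_neg.mp hsum, mul_zero]

end Modulus

end PrincipalSymbol

noncomputable section CommonPrime

open scoped Classical

variable {K : Type*} [Field K] [NumberField K]

omit [NumberField K] in
theorem not_isSquare_of_prime_dvd {p g : 𝓞 K} (hp : Prime p) (h : p ∣ g) (h2 : ¬ p ^ 2 ∣ g) : ¬ IsSquare (g : K) := by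
  rintro ⟨x, hx⟩
  have hint : IsIntegral ℤ x := .of_pow two_pos (by rw [sq, ← hx]; exact g.isIntegral_coe)
  obtain ⟨y, rfl⟩ := (IsIntegralClosure.isIntegral_iff (A := 𝓞 K)).mp hint
  have hg : g = y ^ 2 := RingOfIntegers.ext (by
    rw [hx, ← sq]
    exact (map_pow (algebraMap (𝓞 K) K) y 2).symm)
  exact h2 (hg ▸ pow_dvd_pow_of_dvd (hp.dvd_of_dvd_pow (hg ▸ h)) 2)

theorem HasDensity.re_nonneg_of_finite {f : HeightOneSpectrum (𝓞 K) → ℂ} {δ : ℂ} (h : HasDensity f δ)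
    (hf : {v | (f v).re < 0}.Finite) : 0 ≤ δ.re := by
  refine (h.congr_of_finite (g := fun v ↦ if (f v).re < 0 then 0 else f v) (hf.subset fun v hv ↦ ?_)).re_nonneg
    fun v ↦ ?_
  · by_contra h
    exact hv (if_neg h).symm
  · split_ifs with h
    · exact le_rfl
    · exact not_lt.mp h

section Bessel

variable {ι : Type*} {s : Finset ι} {A : HeightOneSpectrum (𝓞 K) → ℂ} {X G : ι → HeightOneSpectrum (𝓞 K) → ℂ}
  {η : ℂ} {σ δ : ι → ℂ}

theorem HasDensity.bessel (hA : HasDensity A η) (hA2 : ∀ v, A v = 0 ∨ A v = 1)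
    (hX : ∀ i v, X i v = 1 ∨ X i v = -1)
    (hXX : ∀ i ∈ s, ∀ j ∈ s, HasDensity (fun v ↦ X i v * X j v) (if i = j then 1 else 0))
    (hAX : ∀ i ∈ s, HasDensity (fun v ↦ A v * X i v) (σ i)) (t : ℝ) :
    2 * t * ∑ i ∈ s, (σ i).re ≤ η.re + t ^ 2 * s.card := by
  have h1 := (hA.sub ((HasDensity.sum hAX).const_mul (2 * t))).add
    ((HasDensity.sum fun i hi ↦ HasDensity.sum (hXX i hi)).const_mul (t ^ 2))
  have h2 := h1.re_nonneg fun v ↦ by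
    have : A v - 2 * t * ∑ i ∈ s, A v * X i v + t ^ 2 * ∑ i ∈ s, ∑ j ∈ s, X i v * X j v =
        (A v - t * ∑ i ∈ s, X i v) ^ 2 := by
      rw [← Finset.sum_mul_sum, ← Finset.mul_sum]
      rcases hA2 v with h | h <;> rw [h] <;> ring
    rw [this]
    have hreal : (A v - t * ∑ i ∈ s, X i v).im = 0 := by
      have hAv : (A v).im = 0 := by rcases hA2 v with h | h <;> simp [h]
      have hXv : (∑ i ∈ s, X i v).im = 0 := by
        rw [Complex.im_sum]
        exact Finset.sum_eq_zero fun i _ ↦ by rcases hX i v with h | h <;> simp [h]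
      simp [hAv, hXv]
    rw [sq, Complex.mul_re, hreal]
    nlinarith [sq_nonneg (A v - t * ∑ i ∈ s, X i v).re]
  have h3 : ∑ i ∈ s, ∑ j ∈ s, (if i = j then (1 : ℂ) else 0) = s.card := by simp
  rw [h3] at h2
  norm_num [← Complex.ofReal_pow, Complex.re_sum] at h2
  linarith

theorem exists_common_prime (hA : HasDensity A η) (hA2 : ∀ v, A v = 0 ∨ A v = 1) (hη : 0 < η.re)
    (hX : ∀ i v, X i v = 1 ∨ X i v = -1)
    (hXX : ∀ i ∈ s, ∀ j ∈ s, HasDensity (fun v ↦ X i v * X j v) (if i = j then 1 else 0))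
    (hAX : ∀ i ∈ s, HasDensity (fun v ↦ A v * X i v) (σ i))
    (hG : ∀ i ∈ s, HasDensity (G i) 0) (hGX : ∀ i ∈ s, HasDensity (fun v ↦ G i v * X i v) (δ i))
    (hδ : ∀ i ∈ s, 0 ≤ (δ i).re) (hs : 8 * η.re + 1 < s.card * η.re)
    {E : Set (HeightOneSpectrum (𝓞 K))} (hE : E.Finite)
    (hAG : ∀ i ∈ s, ∀ v ∉ E, G i v = A v ∨ G i v = - A v) :
    ∃ v ∉ E, A v = 1 ∧ ∃ i ∈ s, ∃ j ∈ s, i ≠ j ∧ (G i v = -1 ∧ X i v = -1) ∧ (G j v = -1 ∧ X j v = -1) := by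
  by_contra! hcon
  have h1 := (hA.sub (HasDensity.sum fun i hi ↦ (((hA.sub (hG i hi)).sub (hAX i hi)).add (hGX i hi)).const_mul 4⁻¹))
  have h2 := h1.re_nonneg_of_finite (hE.subset fun v hv ↦ by
    by_contra hvE
    refine not_le.mpr (Set.mem_ofPred_eq ▸ hv) ?_
    rcases hA2 v with hAv | hAv
    · have hGv (i) (hi : i ∈ s) : G i v = 0 := by simpa [hAv] using hAG i hi v hvE
      rw [Finset.sum_eq_zero fun i hi ↦ by rw [hAv, hGv i hi]; ring, hAv]
      simp
    · have hterm (i) (hi : i ∈ s) : (4⁻¹ : ℂ) * (A v - G i v - A v * X i v + G i v * X i v) =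
          if G i v = -1 ∧ X i v = -1 then 1 else 0 := by
        have h := hAG i hi v hvE
        rw [hAv] at h ⊢
        rcases h with h | h <;> rcases hX i v with h' | h' <;> rw [h, h'] <;> norm_num
      rw [Finset.sum_congr rfl hterm, hAv]
      by_cases hex : ∃ i ∈ s, G i v = -1 ∧ X i v = -1
      · obtain ⟨i, hi, hiv⟩ := hex
        rw [Finset.sum_eq_single_of_mem i hi fun j hj hji ↦ if_neg fun hjv ↦
          hcon v hvE hAv i hi j hj hji.symm hiv hjv.1 hjv.2, if_pos hiv]
        simp
      · push Not at hex
        rw [Finset.sum_eq_zero fun i hi ↦ if_neg fun h ↦ hex i hi h.1 h.2]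
        simp)
  have h3 := hA.bessel hA2 hX hXX hAX η.re
  have h4 : ∑ i ∈ s, (σ i).re ≤ 1 / 2 + η.re * s.card / 2 := by
    have : 2 * η.re * ∑ i ∈ s, (σ i).re ≤ 2 * η.re * (1 / 2 + η.re * s.card / 2) := by linarith
    exact le_of_mul_le_mul_left this (by linarith)
  have h5 : 0 ≤ ∑ i ∈ s, (δ i).re := Finset.sum_nonneg hδ
  rw [← Finset.mul_sum, Finset.sum_add_distrib, Finset.sum_sub_distrib] at h2
  norm_num [Complex.re_sum] at h2
  linarith

end Bessel

end CommonPrime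

noncomputable section PrimeTriple

open scoped Classical

variable {K : Type*} [Field K] [NumberField K]

/-- `p` generates the odd prime `v ∉ Ω`, is totally positive, congruent to `1` modulo `8` and modulo the primes
of `Ω`, and `2` and all units are squares modulo `v`. -/
structure IsAdmissible (Ω : Finset (HeightOneSpectrum (𝓞 K))) (v : HeightOneSpectrum (𝓞 K)) (p : 𝓞 K) : Prop where
  span_eq : v.asIdeal = Ideal.span {p}
  notMem : v ∉ Ω
  two_notMem : 2 ∉ v.asIdeal
  dvd_sub_one : 8 ∣ p - 1
  sub_one_mem : ∀ π ∈ Ω, p - 1 ∈ π.asIdeal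
  pos : ∀ σ : K →+* ℝ, 0 < σ (p : K)
  two : quadSymbol 2 v = 1
  unit : ∀ u : (𝓞 K)ˣ, quadSymbol (u : 𝓞 K) v = 1

omit [NumberField K] in
theorem unit_notMem (v : HeightOneSpectrum (𝓞 K)) (u : (𝓞 K)ˣ) : (u : 𝓞 K) ∉ v.asIdeal := fun h ↦
  v.isPrime.ne_top (Ideal.eq_top_of_isUnit_mem _ h u.isUnit)

omit [NumberField K] in
theorem quadSymbol_one (v : HeightOneSpectrum (𝓞 K)) : quadSymbol 1 v = 1 :=
  quadSymbol_eq_one_iff.mpr ⟨1, by simp⟩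

theorem quadSymbol_unit_eq_one {v : HeightOneSpectrum (𝓞 K)} {S : Set (𝓞 K)ˣ} (hS : Subgroup.closure S = ⊤)
    (h : ∀ u ∈ S, quadSymbol (u : 𝓞 K) v = 1) (u : (𝓞 K)ˣ) : quadSymbol (u : 𝓞 K) v = 1 := by
  have hu : u ∈ Subgroup.closure S := hS ▸ Subgroup.mem_top u
  induction hu using Subgroup.closure_induction with
  | mem x hx => exact h x hx
  | one => exact quadSymbol_one v
  | mul x y _ _ hx hy => rw [Units.val_mul, quadSymbol_mul (unit_notMem v x) (unit_notMem v y), hx, hy, one_mul]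
  | inv x _ hx =>
    have h := quadSymbol_mul (unit_notMem v x) (unit_notMem v x⁻¹)
    rwa [← Units.val_mul, mul_inv_cancel, Units.val_one, quadSymbol_one, hx, one_mul, eq_comm] at h

variable (K) in
theorem exists_finset_units : ∃ S : Finset (𝓞 K)ˣ, Subgroup.closure (S : Set (𝓞 K)ˣ) = ⊤ := by
  obtain ⟨_, S, -, h⟩ := Group.fg_iff'.mp (Group.fg_iff_monoid_fg.mpr (inferInstance : Monoid.FG (𝓞 K)ˣ))
  exact ⟨S, h⟩

theorem exists_admissible_seq (Ω : Finset (HeightOneSpectrum (𝓞 K))) :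
    ∃ (v : ℕ → HeightOneSpectrum (𝓞 K)) (p : ℕ → 𝓞 K), (∀ n, IsAdmissible Ω (v n) (p n)) ∧
      ∀ k l, k < l → v k ≠ v l ∧ p l - 1 ∈ (v k).asIdeal ∧ quadSymbol (p k) (v l) = 1 := by
  obtain ⟨U, hU⟩ := exists_finset_units K
  obtain ⟨f, hf, hr⟩ := exists_seq_of_forall_finset_exists (α := HeightOneSpectrum (𝓞 K) × 𝓞 K)
    (fun x ↦ IsAdmissible Ω x.1 x.2)
    (fun x y ↦ x.1 ≠ y.1 ∧ y.2 - 1 ∈ x.1.asIdeal ∧ quadSymbol x.2 y.1 = 1) fun s hs ↦ by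
      let S : Finset (HeightOneSpectrum (𝓞 K)) := Ω ∪ s.image Prod.fst
      have hSpos : 0 < ∏ v ∈ S, Ideal.absNorm v.asIdeal := Finset.prod_pos fun v _ ↦
        Nat.pos_of_ne_zero (mt Ideal.absNorm_eq_zero_iff.mp v.ne_bot)
      obtain ⟨v, p, hvE, hv, hp1, hpos, hsq⟩ := exists_totally_positive_prime (K := K)
        (m := 8 * ∏ v ∈ S, Ideal.absNorm v.asIdeal) (by lia)
        (insert 2 (U.image (fun u : (𝓞 K)ˣ ↦ (u : 𝓞 K)) ∪ s.image Prod.snd))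
        (E := S ∪ {v | 2 ∈ v.asIdeal}) (S.finite_toSet.union (finite_setOf_mem_asIdeal two_ne_zero))
      rw [Set.mem_union, not_or] at hvE
      have hmem (w) (hw : w ∈ S) : p - 1 ∈ w.asIdeal := by
        refine w.asIdeal.mem_of_dvd (dvd_trans ?_ hp1) (Ideal.absNorm_mem w.asIdeal)
        exact Nat.cast_dvd_cast (dvd_mul_of_dvd_right (Finset.dvd_prod_of_mem _ hw) _)
      refine ⟨(v, p), ⟨hv, fun h ↦ hvE.1 (Finset.mem_union_left _ h), hvE.2, ?_, fun π hπ ↦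
        hmem π (Finset.mem_union_left _ hπ), hpos, ?_, quadSymbol_unit_eq_one hU fun u hu ↦ ?_⟩, fun x hx ↦
        ⟨fun h ↦ hvE.1 (Finset.mem_union_right _ (Finset.mem_image.mpr ⟨x, hx, h⟩)),
          hmem _ (Finset.mem_union_right _ (Finset.mem_image_of_mem _ hx)), ?_⟩⟩
      · exact dvd_trans (by simp) hp1
      · exact quadSymbol_eq_one_iff.mpr (hsq 2 (Finset.mem_insert_self _ _))
      · exact quadSymbol_eq_one_iff.mpr (hsq u (Finset.mem_insert_of_mem
          (Finset.mem_union_left _ (Finset.mem_image_of_mem _ hu))))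
      · exact quadSymbol_eq_one_iff.mpr (hsq x.2 (Finset.mem_insert_of_mem
          (Finset.mem_union_right _ (Finset.mem_image_of_mem _ hx))))
  exact ⟨fun n ↦ (f n).1, fun n ↦ (f n).2, hf, fun k l h ↦ hr k l h⟩

/-- The indicator function of the principal primes. -/
def principalIndicator (w : HeightOneSpectrum (𝓞 K)) : ℂ := if ∃ x, w.asIdeal = Ideal.span {x} then 1 else 0

section Symbol

variable {v : HeightOneSpectrum (𝓞 K)}

omit [NumberField K] in
theorem prime_of_asIdeal_eq {p : 𝓞 K} (h : v.asIdeal = Ideal.span {p}) : Prime p := by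
  have hp : p ≠ 0 := by
    rintro rfl
    exact v.ne_bot (by simpa using h)
  exact (Ideal.span_singleton_prime hp).mp (h ▸ v.isPrime)

theorem hasDensity_quadSymbol_mul {w : HeightOneSpectrum (𝓞 K)} {p q : 𝓞 K} (hp : v.asIdeal = Ideal.span {p})
    (hq : w.asIdeal = Ideal.span {q}) (hvw : v ≠ w) : HasDensity (fun u ↦ quadSymbol p u * quadSymbol q u) 0 := by
  have hpp := prime_of_asIdeal_eq hp
  have hqp := prime_of_asIdeal_eq hq
  refine (hasDensity_quadSymbol (g := p * q) (not_isSquare_of_prime_dvd hpp (dvd_mul_right p q) fun h ↦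
    hvw (HeightOneSpectrum.ext ?_))).congr_of_finite
    ((finite_setOf_mem_asIdeal (mul_ne_zero hpp.ne_zero hqp.ne_zero)).subset fun u hu ↦ ?_)
  · rw [sq, mul_dvd_mul_iff_left hpp.ne_zero] at h
    rw [hp, hq, Ideal.span_singleton_eq_span_singleton]
    exact hpp.associated_of_dvd hqp h
  · by_contra h
    exact hu (quadSymbol_mul (fun h' ↦ h (u.asIdeal.mul_mem_right _ h')) fun h' ↦ h (u.asIdeal.mul_mem_left _ h'))

variable {m : ℕ} (hm : (m : 𝓞 K) ∈ v.asIdeal) (hu : ∀ u : (𝓞 K)ˣ, quadSymbol (u : 𝓞 K) v = 1) [Fact (2 ≤ m)]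

include hm hu

theorem principalSymbol_eq_or {w : HeightOneSpectrum (𝓞 K)} (hw : (m : 𝓞 K) ∉ w.asIdeal) :
    principalSymbol v m (rayClass m w.asIdeal) = principalIndicator w ∨
      principalSymbol v m (rayClass m w.asIdeal) = - principalIndicator w := by
  rw [principalSymbol_rayClass hm hu, principalIndicator]
  have hcop := isCoprime_asIdeal_span_iff.mpr hw
  split_ifs with h
  · obtain ⟨x, hx⟩ := h
    rw [hx] at hcop ⊢
    rw [idealSymbol_span hm hu hcop]
    exact quadSymbol_eq_or x v
  · exact Or.inl (idealSymbol_eq_zero_iff.mpr fun h' ↦ h h'.2)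

theorem finite_principalSymbol_sq_ne :
    {w : HeightOneSpectrum (𝓞 K) | principalSymbol v m (rayClass m w.asIdeal) ^ 2 ≠ principalIndicator w}.Finite := by
  have hm2 : 2 ≤ m := Fact.out
  refine (finite_setOf_mem_asIdeal (K := K) (x := m) (by exact_mod_cast (by lia))).subset fun w hw ↦ ?_
  by_contra h
  refine hw ?_
  rw [sq_eq_sq_iff_eq_or_eq_neg.mpr (principalSymbol_eq_or hm hu h), principalIndicator]
  split_ifs <;> simp

theorem exists_hasDensity_principalIndicator :
    ∃ η : ℂ, 0 < η.re ∧ HasDensity (principalIndicator (K := K)) η := by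
  refine ⟨_, ?_, (hasDensity_rayMean fun r ↦ principalSymbol v m r ^ 2).congr_of_finite
    (finite_principalSymbol_sq_ne hm hu)⟩
  have h01 (r : RayClass K m) : principalSymbol v m r ^ 2 = 0 ∨ principalSymbol v m r ^ 2 = 1 := by
    rw [principalSymbol, idealSymbol]
    split_ifs
    · exact Or.inr (sq_eq_one_iff.mpr (quadSymbol_eq_or _ v))
    · exact Or.inl (zero_pow two_ne_zero)
  rw [rayMean, ← Complex.ofReal_natCast, ← Complex.ofReal_inv, Complex.re_ofReal_mul, Complex.re_sum]
  refine mul_pos (by simp [Fintype.card_pos]) (Finset.sum_pos' (fun r _ ↦ ?_) ⟨1, Finset.mem_univ _, ?_⟩)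
  · rcases h01 r with h | h <;> simp [h]
  · have h1 : IsCoprime (Ideal.span {(1 : 𝓞 K)}) (Ideal.span {(m : 𝓞 K)}) :=
      isCoprime_span_of_dvd_sub_one (by simp)
    have h := principalSymbol_rayClass hm hu (Ideal.span {1})
    rw [idealSymbol_span hm hu h1, quadSymbol_one, Ideal.span_singleton_one, ← Ideal.one_eq_top, map_one] at h
    simp [h]

theorem exists_hasDensity_principalIndicator_mul {g : 𝓞 K} (hg : ¬ IsSquare (g : K)) :
    ∃ σ : ℂ, HasDensity (fun w ↦ principalIndicator w * quadSymbol g w) σ := by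
  obtain ⟨L, _, _, _, h⟩ := exists_hasDensity_mul_quadSymbol hg fun r ↦ principalSymbol v m r ^ 2
  refine ⟨_, h.congr_of_finite ((finite_principalSymbol_sq_ne hm hu).subset fun w hw h' ↦ hw ?_)⟩
  simp only [h']

end Symbol

theorem exists_prime_triple (Ω : Finset (HeightOneSpectrum (𝓞 K))) :
    ∃ (va vb vc : HeightOneSpectrum (𝓞 K)) (a b c : 𝓞 K), IsAdmissible Ω va a ∧ IsAdmissible Ω vb b ∧
      va ≠ vb ∧ a - 1 ∈ vb.asIdeal ∧ quadSymbol b va = 1 ∧ vc.asIdeal = Ideal.span {c} ∧ vc ∉ Ω ∧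
      2 ∉ vc.asIdeal ∧ va ≠ vc ∧ vb ≠ vc ∧ quadSymbol c va = -1 ∧ quadSymbol c vb = -1 ∧
      quadSymbol a vc = -1 ∧ quadSymbol b vc = -1 := by
  obtain ⟨v, p, hadm, hlt⟩ := exists_admissible_seq Ω
  have hinj : Function.Injective v := fun k l hkl ↦ by
    by_contra h
    rcases lt_or_gt_of_ne h with h | h
    · exact (hlt k l h).1 hkl
    · exact (hlt l k h).1 hkl.symm
  let m (k : ℕ) : ℕ := Ideal.absNorm (v k).asIdeal
  have hm (k) : (m k : 𝓞 K) ∈ (v k).asIdeal := Ideal.absNorm_mem _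
  have hm2 (k) : Fact (2 ≤ m k) := ⟨by exact_mod_cast two_le_absNorm (v k)⟩
  have hns (k) : ¬ IsSquare ((p k : 𝓞 K) : K) := by
    have hp := prime_of_asIdeal_eq (hadm k).span_eq
    refine not_isSquare_of_prime_dvd hp dvd_rfl fun h ↦ hp.not_isUnit ?_
    rw [sq] at h
    exact isUnit_of_dvd_one ((mul_dvd_mul_iff_left hp.ne_zero).mp (by rwa [mul_one]))
  obtain ⟨η, hη, hA⟩ := exists_hasDensity_principalIndicator (hm 0) (hadm 0).unit
  choose σ hσ using fun k ↦ exists_hasDensity_principalIndicator_mul (hm 0) (hadm 0).unit (hns k)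
  choose δ hδ0 hδ using fun k ↦ exists_hasDensity_mul_quadSymbol_nonneg (hns k)
    (fun r s ↦ principalSymbol_mul (hm k) (hadm k).unit (r := r) (s := s))
    (rayMean_principalSymbol (hm k) (hadm k).unit (hadm k).two_notMem)
  obtain ⟨n, hn⟩ := exists_nat_gt ((8 * η.re + 1) / η.re)
  rw [div_lt_iff₀ hη] at hn
  let M : ℕ := 2 * ∏ k ∈ Finset.range n, m k
  have hM0 : (M : 𝓞 K) ≠ 0 := by
    rw [Nat.cast_ne_zero]
    exact mul_ne_zero two_ne_zero (Finset.prod_ne_zero_iff.mpr fun k _ ↦ by have := (hm2 k).out; lia)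
  have hmM (w : HeightOneSpectrum (𝓞 K)) (hw : (M : 𝓞 K) ∉ w.asIdeal) (k) (hk : k ∈ Finset.range n) :
      (m k : 𝓞 K) ∉ w.asIdeal := fun h ↦ hw (w.asIdeal.mem_of_dvd (Nat.cast_dvd_cast
        (dvd_mul_of_dvd_right (Finset.dvd_prod_of_mem _ hk) _)) h)
  obtain ⟨w, hw, hA1, k, hk, l, hl, hkl, ⟨hGk, hXk⟩, ⟨hGl, hXl⟩⟩ := exists_common_prime (s := Finset.range n) hA
    (X := fun k ↦ quadSymbol (p k)) (G := fun k w ↦ principalSymbol (v k) (m k) (rayClass (m k) w.asIdeal))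
    (fun w ↦ by rw [principalIndicator]; split_ifs <;> simp) hη (fun k ↦ quadSymbol_eq_or (p k))
    (fun k _ l _ ↦ by
      split_ifs with h
      · have h1 := hasDensity_rayMean (fun _ : RayClass K (m 0) ↦ 1)
        rw [rayMean_const] at h1
        convert h1 using 2 with w
        rcases quadSymbol_eq_or (p k) w with h' | h' <;> rw [← h, h'] <;> norm_num
      · exact hasDensity_quadSymbol_mul (hadm k).span_eq (hadm l).span_eq (hinj.ne h))
    (fun k _ ↦ hσ k)
    (fun k _ ↦ rayMean_principalSymbol (hm k) (hadm k).unit (hadm k).two_notMem ▸ hasDensity_rayMean _)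
    (fun k _ ↦ hδ k) (fun k _ ↦ hδ0 k) (by rwa [Finset.card_range])
    (E := {w | (M : 𝓞 K) ∈ w.asIdeal} ∪ Ω) ((finite_setOf_mem_asIdeal hM0).union Ω.finite_toSet)
    fun k hk w hw ↦ principalSymbol_eq_or (hm k) (hadm k).unit (hmM w (fun h ↦ hw (Or.inl h)) k hk)
  rw [Set.mem_union, not_or] at hw
  obtain ⟨c, hc⟩ : ∃ c, w.asIdeal = Ideal.span {c} := by
    by_contra h
    exact absurd (hA1.symm.trans (if_neg h)) one_ne_zero
  have hsymb (k) (hk : k ∈ Finset.range n) : principalSymbol (v k) (m k) (rayClass (m k) w.asIdeal) = quadSymbol c (v k) := by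
    have := isCoprime_asIdeal_span_iff.mpr (hmM w hw.1 k hk)
    rw [hc] at this
    rw [principalSymbol_rayClass (hm k) (hadm k).unit, hc, idealSymbol_span (hm k) (hadm k).unit this]
  have hvw (k) (hk : k ∈ Finset.range n) : v k ≠ w := fun h ↦ hmM w hw.1 k hk (h ▸ hm k)
  have h2 : 2 ∉ w.asIdeal := fun h ↦ hw.1 (w.asIdeal.mem_of_dvd (by simp [M]) h)
  rw [hsymb k hk] at hGk
  rw [hsymb l hl] at hGl
  wlog h : k < l generalizing k l
  · exact this l hl k hk hkl.symm hXl hXk hGk hGl (by lia)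
  obtain ⟨-, h3, h4⟩ := hlt k l h
  exact ⟨v l, v k, w, p l, p k, c, hadm l, hadm k, hinj.ne hkl.symm, h3, h4, hc, hw.2, h2, hvw l hl, hvw k hk,
    hGl, hGk, hXl, hXk⟩

end PrimeTriple

noncomputable section LastPrime

open scoped Classical

variable {K : Type*} [Field K] [NumberField K]

theorem eq_of_mem_asIdeal {v w : HeightOneSpectrum (𝓞 K)} {p : 𝓞 K} (hv : v.asIdeal = Ideal.span {p})
    (hw : p ∈ w.asIdeal) : v = w :=
  HeightOneSpectrum.ext (v.isMaximal.eq_of_le w.isPrime.ne_top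
    (by rwa [hv, Ideal.span_singleton_le_iff_mem]))

theorem exists_last_prime (Ω : Finset (HeightOneSpectrum (𝓞 K))) {va vb vc : HeightOneSpectrum (𝓞 K)} {s : 𝓞 K}
    (hab : va ≠ vb) (hac : va ≠ vc) (hbc : vb ≠ vc) (hb2 : 2 ∉ vb.asIdeal) (hs : s ∉ va.asIdeal) :
    ∃ (vd : HeightOneSpectrum (𝓞 K)) (d : 𝓞 K), vd.asIdeal = Ideal.span {d} ∧ vd ∉ Ω ∧ 2 ∉ vd.asIdeal ∧
      va ≠ vd ∧ vb ≠ vd ∧ vc ≠ vd ∧ s * d - 1 ∈ va.asIdeal ∧ quadSymbol d vb = -1 ∧ d - 1 ∈ vc.asIdeal := by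
  obtain ⟨z, hz⟩ : ∃ z, s * z - 1 ∈ va.asIdeal := by
    obtain ⟨z, i, hi, h⟩ := Ideal.IsMaximal.exists_inv va.isMaximal hs
    exact ⟨z, by rw [show s * z - 1 = -i by linear_combination h]; exact va.asIdeal.neg_mem hi⟩
  have hz' : z ∉ va.asIdeal := fun h ↦ va.isPrime.ne_top <| (Ideal.eq_top_iff_one _).mpr <| by
    simpa using va.asIdeal.sub_mem (va.asIdeal.mul_mem_left s h) hz
  obtain ⟨g, hg, hg'⟩ := exists_quadSymbol_eq_neg_one hb2
  let M := 2 * (Ideal.absNorm va.asIdeal * Ideal.absNorm vb.asIdeal * Ideal.absNorm vc.asIdeal)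
  have hpos (v : HeightOneSpectrum (𝓞 K)) : 0 < Ideal.absNorm v.asIdeal :=
    Nat.pos_of_ne_zero (mt Ideal.absNorm_eq_zero_iff.mp v.ne_bot)
  have hM : 0 < M / 2 := by simp [M, hpos]
  have hM2 : 2 ≤ M := by omega
  have : Fact (2 ≤ M) := ⟨hM2⟩
  have hMa : (M : 𝓞 K) ∈ va.asIdeal := by
    simp only [M, Nat.cast_mul]
    exact Ideal.mul_mem_left _ _ (Ideal.mul_mem_right _ _ (Ideal.mul_mem_right _ _ (Ideal.absNorm_mem _)))
  have hMb : (M : 𝓞 K) ∈ vb.asIdeal := by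
    simp only [M, Nat.cast_mul]
    exact Ideal.mul_mem_left _ _ (Ideal.mul_mem_right _ _ (Ideal.mul_mem_left _ _ (Ideal.absNorm_mem _)))
  have hMc : (M : 𝓞 K) ∈ vc.asIdeal := by
    simp only [M, Nat.cast_mul]
    exact Ideal.mul_mem_left _ _ (Ideal.mul_mem_left _ _ (Ideal.absNorm_mem _))
  let y : HeightOneSpectrum (𝓞 K) → 𝓞 K := fun v ↦ if v = va then z else if v = vb then g else 1
  obtain ⟨r, hr, hry⟩ := exists_isCoprime_of_forall_notMem (M := M) (by lia) y fun v ↦ by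
    by_cases h1 : v = va
    · simpa only [y, h1, if_true] using hz'
    by_cases h2 : v = vb
    · simpa only [y, h2, hab.symm, if_true, if_false] using hg
    · simpa only [y, h1, h2, if_false] using (Ideal.ne_top_iff_one _).mp v.isPrime.ne_top
  obtain ⟨vd, d, hdE, hd, hdr⟩ := exists_prime_element hr (E := Ω ∪ {v | (M : 𝓞 K) ∈ v.asIdeal})
    (hasDensity_indicator_of_finite (Ω.finite_toSet.union
      (finite_setOf_mem_asIdeal (by exact_mod_cast (by lia : M ≠ 0)))))
  simp only [Set.mem_union, Finset.mem_coe, Set.mem_ofPred_eq, not_or] at hdE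
  have key {v} (hv : (M : 𝓞 K) ∈ v.asIdeal) : d - y v ∈ v.asIdeal := by
    simpa using v.asIdeal.add_mem (v.asIdeal.mem_of_dvd hdr hv) (hry v hv)
  have hya := key hMa
  have hyb := key hMb
  have hyc := key hMc
  simp only [y, if_true, hab.symm, hac.symm, hbc.symm, if_false] at hya hyb hyc
  refine ⟨vd, d, hd, hdE.1, fun h ↦ hdE.2 ?_, fun h ↦ hdE.2 (h ▸ hMa), fun h ↦ hdE.2 (h ▸ hMb),
    fun h ↦ hdE.2 (h ▸ hMc), ?_, (quadSymbol_congr hyb).trans hg', hyc⟩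
  · rw [show (M : 𝓞 K) = 2 * (M / 2 : ℕ) by rw [← Nat.cast_ofNat, ← Nat.cast_mul]; simp [M]]
    exact Ideal.mul_mem_right _ _ h
  · rw [show s * d - 1 = s * (d - z) + (s * z - 1) by ring]
    exact va.asIdeal.add_mem (Ideal.mul_mem_left _ _ hya) hz

end LastPrime

noncomputable section Completion

theorem isSquare_one_add_four_mul {L : Type*} [NormedField L] [IsUltrametricDist L] [CompleteSpace L] {t : L}
    (ht : ‖t‖ < 1) : IsSquare (1 + 4 * t) := by
  let s := Metric.closedBall (0 : L) ‖t‖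
  have hs {y : L} : y ∈ s ↔ ‖y‖ ≤ ‖t‖ := mem_closedBall_zero_iff
  have hmaps : Set.MapsTo (fun y : L ↦ t - y ^ 2) s s := fun y hy ↦ by
    rw [hs] at hy ⊢
    change ‖t - y ^ 2‖ ≤ _
    rw [sub_eq_add_neg]
    refine (IsUltrametricDist.norm_add_le_max _ _).trans (max_le le_rfl ?_)
    rw [norm_neg, norm_pow]
    nlinarith [norm_nonneg y]
  obtain ⟨y, -, hy, -⟩ := ContractingWith.exists_fixedPoint' (K := ‖t‖₊) (f := fun y : L ↦ t - y ^ 2)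
    (Metric.isClosed_closedBall (x := (0 : L)) (ε := ‖t‖)).isComplete hmaps
    ⟨by exact_mod_cast ht, LipschitzWith.of_dist_le_mul fun y z ↦ by
      have h : ‖(z : L) + y‖ ≤ ‖t‖ := (IsUltrametricDist.norm_add_le_max _ _).trans
        (max_le (hs.mp z.2) (hs.mp y.2))
      change dist (t - (y : L) ^ 2) (t - (z : L) ^ 2) ≤ ‖t‖ * dist (y : L) z
      rw [dist_eq_norm, dist_eq_norm, show t - (y : L) ^ 2 - (t - (z : L) ^ 2) = (z + y) * (z - y) by ring,
        norm_mul, norm_sub_rev (z : L)]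
      gcongr⟩
    (x := 0) (hs.mpr (by simp)) (edist_ne_top _ _)
  have hy : t - y ^ 2 = y := hy
  exact ⟨1 + 2 * y, by linear_combination 4 * hy⟩

variable {K : Type*} [Field K] [NumberField K] {π : HeightOneSpectrum (𝓞 K)}

/-- The embedding of the ring of integers into the completion at `π`, as a ring homomorphism. -/
def adicCompletionHom (π : HeightOneSpectrum (𝓞 K)) : 𝓞 K →+* π.adicCompletion K :=
  (algebraMap K (π.adicCompletion K)).comp (algebraMap (𝓞 K) K)

theorem norm_adicCompletionHom_le_one (x : 𝓞 K) : ‖adicCompletionHom π x‖ ≤ 1 := FinitePlace.norm_le_one K π x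

theorem norm_adicCompletionHom_eq_one_iff {x : 𝓞 K} : ‖adicCompletionHom π x‖ = 1 ↔ x ∉ π.asIdeal :=
  FinitePlace.norm_eq_one_iff_notMem K π x

theorem norm_adicCompletionHom_lt_one_iff {x : 𝓞 K} : ‖adicCompletionHom π x‖ < 1 ↔ x ∈ π.asIdeal :=
  FinitePlace.norm_lt_one_iff_mem K π x

theorem isSquare_adicCompletionHom {x : 𝓞 K} (h2 : 2 ∉ π.asIdeal) (hx : x ∉ π.asIdeal) (h : quadSymbol x π = 1) :
    IsSquare (adicCompletionHom π x) := by
  obtain ⟨z, hz⟩ := quadSymbol_eq_one_iff.mp h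
  have hz' : z ∉ π.asIdeal := fun hmem ↦ hx <| by
    simpa using π.asIdeal.sub_mem (Ideal.pow_mem_of_mem _ hmem 2 two_pos) hz
  have hz1 := norm_adicCompletionHom_eq_one_iff.mpr hz'
  have h21 := norm_adicCompletionHom_eq_one_iff.mpr h2
  rw [map_ofNat] at h21
  have hz0 : adicCompletionHom π z ≠ 0 := norm_ne_zero_iff.mp (by simp [hz1])
  have h20 : (2 : π.adicCompletion K) ≠ 0 := norm_ne_zero_iff.mp (by simp [h21])
  have ht : ‖adicCompletionHom π (x - z ^ 2) / (2 * adicCompletionHom π z) ^ 2‖ < 1 := by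
    rw [norm_div, norm_pow, norm_mul, h21, hz1, one_mul, one_pow, div_one, norm_adicCompletionHom_lt_one_iff,
      ← neg_sub, neg_mem_iff]
    exact hz
  obtain ⟨y, hy⟩ := isSquare_one_add_four_mul ht
  refine ⟨adicCompletionHom π z * y, ?_⟩
  rw [mul_mul_mul_comm, ← hy, map_sub, map_pow]
  field_simp
  ring

theorem isSquare_adicCompletionHom_of_sub_one_mem {x : 𝓞 K} (h2 : 2 ∉ π.asIdeal) (h : x - 1 ∈ π.asIdeal) :
    IsSquare (adicCompletionHom π x) :=
  isSquare_adicCompletionHom h2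
    (fun hx ↦ π.isPrime.ne_top <| (Ideal.eq_top_iff_one _).mpr <| by simpa using π.asIdeal.sub_mem hx h)
    ((quadSymbol_congr h).trans (quadSymbol_one π))

theorem isSquare_adicCompletionHom_of_dvd {x : 𝓞 K} (h2 : 2 ∈ π.asIdeal) (h : 8 ∣ x - 1) :
    IsSquare (adicCompletionHom π x) := by
  obtain ⟨z, hz⟩ := h
  rw [show x = 1 + 4 * (2 * z) by linear_combination hz, map_add, map_one, map_mul, map_ofNat]
  exact isSquare_one_add_four_mul (norm_adicCompletionHom_lt_one_iff.mpr (Ideal.mul_mem_right _ _ h2))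

theorem exists_norm_sub_lt_one {y : π.adicCompletion K} (hy : ‖y‖ ≤ 1) : ∃ n, ‖adicCompletionHom π n - y‖ < 1 := by
  have hb := HeightOneSpectrum.one_lt_absNorm_nnreal π
  obtain ⟨k, hk⟩ := (HeightOneSpectrum.denseRange_algebraMap (K := K) π).exists_dist_lt y one_pos
  rw [dist_comm, dist_eq_norm] at hk
  have hk1 : ‖FinitePlace.embedding π k‖ ≤ 1 := by
    rw [← sub_add_cancel (FinitePlace.embedding π k) y]
    exact (IsUltrametricDist.norm_add_le_max _ _).trans (max_le hk.le hy)
  rw [FinitePlace.norm_embedding', NNReal.coe_le_one, WithZeroMulInt.toNNReal_le_one_iff hb] at hk1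
  obtain ⟨n, hn⟩ := π.exists_valuation_sub_lt_of_integer hk1 1
  have hn' : ‖FinitePlace.embedding π (algebraMap (𝓞 K) K n - k)‖ < 1 := by
    rw [FinitePlace.norm_embedding', NNReal.coe_lt_one, WithZeroMulInt.toNNReal_lt_one_iff hb]
    exact hn
  rw [map_sub] at hn'
  refine ⟨n, ?_⟩
  rw [← sub_add_sub_cancel _ (algebraMap K (π.adicCompletion K) k)]
  exact (IsUltrametricDist.norm_add_le_max _ _).trans_lt (max_lt hn' hk)

theorem not_isSquare_adicCompletionHom {x : 𝓞 K} (h : quadSymbol x π = -1) : ¬ IsSquare (adicCompletionHom π x) := by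
  rintro ⟨y, hy⟩
  have hy1 : ‖y‖ ≤ 1 := by
    have hx := norm_adicCompletionHom_le_one (π := π) x
    rw [hy, norm_mul] at hx
    nlinarith [norm_nonneg y]
  obtain ⟨n, hn⟩ := exists_norm_sub_lt_one hy1
  have h1 : quadSymbol x π = 1 := quadSymbol_eq_one_iff.mpr ⟨n, by
    rw [← norm_adicCompletionHom_lt_one_iff, map_sub, map_pow, hy,
      show adicCompletionHom π n ^ 2 - y * y = (adicCompletionHom π n - y) * (adicCompletionHom π n + y) by ring,
      norm_mul]
    have h2 : ‖adicCompletionHom π n + y‖ ≤ 1 := (IsUltrametricDist.norm_add_le_max _ _).trans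
      (max_le (norm_adicCompletionHom_le_one n) hy1)
    nlinarith [norm_nonneg (adicCompletionHom π n - y), norm_nonneg (adicCompletionHom π n + y)]⟩
  norm_num [h1] at h

end Completion

noncomputable section Assembly

variable {K : Type*} [Field K] [NumberField K]

theorem IsAdmissible.isSquare {Ω : Finset (HeightOneSpectrum (𝓞 K))} {v : HeightOneSpectrum (𝓞 K)} {p : 𝓞 K}
    (hp : IsAdmissible Ω v p) (hΩ : ∀ π ∈ Ω, (2 : 𝓞 K) ∉ π.asIdeal) {π : HeightOneSpectrum (𝓞 K)}
    (hπ : π ∈ Ω ∨ 2 ∈ π.asIdeal) : IsSquare (intToAdicCompletion π p) := by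
  rcases hπ with hπ | hπ
  · refine isSquare_adicCompletionHom_of_sub_one_mem (hΩ π hπ) (hp.sub_one_mem π hπ)
  · exact isSquare_adicCompletionHom_of_dvd hπ hp.dvd_sub_one

theorem IsAdmissible.isSquare_two {Ω : Finset (HeightOneSpectrum (𝓞 K))} {v : HeightOneSpectrum (𝓞 K)} {p : 𝓞 K}
    (hp : IsAdmissible Ω v p) : IsSquare (2 : v.adicCompletion K) := by
  rw [← map_ofNat (adicCompletionHom v)]
  exact isSquare_adicCompletionHom hp.two_notMem hp.two_notMem hp.two

theorem IsAdmissible.isSquare_neg_one {Ω : Finset (HeightOneSpectrum (𝓞 K))} {v : HeightOneSpectrum (𝓞 K)}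
    {p : 𝓞 K} (hp : IsAdmissible Ω v p) : IsSquare (-1 : v.adicCompletion K) := by
  simpa using isSquare_adicCompletionHom hp.two_notMem (unit_notMem v (-1)) (hp.unit (-1))

/-- If `c` is not a square modulo the admissible prime `(a)` but `b` is, and `b * c ^ 2 * d ≡ 1` modulo `a`, then
`b * c * d` is not `-2` modulo `a`. -/
theorem IsAdmissible.not_dvd_add_two {Ω : Finset (HeightOneSpectrum (𝓞 K))} {v : HeightOneSpectrum (𝓞 K)}
    {a b c d : 𝓞 K} (ha : IsAdmissible Ω v a) (hcv : c ∉ v.asIdeal) (hc : quadSymbol c v = -1)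
    (h : b * c ^ 2 * d - 1 ∈ v.asIdeal) : ¬ a ∣ b * c * d + 2 := fun hdvd ↦ by
  have hmem : b * c * d + 2 ∈ v.asIdeal := by rwa [ha.span_eq, Ideal.mem_span_singleton]
  have h1 : (-1 : (𝓞 K)ˣ) * 2 * c - 1 ∈ v.asIdeal := by
    rw [show ((-1 : (𝓞 K)ˣ) : 𝓞 K) * 2 * c - 1 = (b * c ^ 2 * d - 1) - c * (b * c * d + 2) by push_cast; ring]
    exact v.asIdeal.sub_mem h (Ideal.mul_mem_left _ _ hmem)
  have h2 := quadSymbol_congr h1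
  have hu2 : ((-1 : (𝓞 K)ˣ) : 𝓞 K) * 2 ∉ v.asIdeal := v.isPrime.mul_notMem (unit_notMem v _) ha.two_notMem
  rw [quadSymbol_mul hu2 hcv, quadSymbol_mul (unit_notMem v _) ha.two_notMem, ha.unit, ha.two, hc,
    quadSymbol_one] at h2
  norm_num at h2

/-- If `b * c ^ 2 * d ≡ 1` and `b` is a square modulo `v`, then so is `d`. -/
theorem quadSymbol_eq_one_of_mul_sq_mul {v : HeightOneSpectrum (𝓞 K)} {b c d : 𝓞 K} (hb : quadSymbol b v = 1)
    (h : b * c ^ 2 * d - 1 ∈ v.asIdeal) : quadSymbol d v = 1 := by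
  have hmem : b * c ^ 2 * d ∉ v.asIdeal := fun hm ↦ v.isPrime.ne_top <| (Ideal.eq_top_iff_one _).mpr <| by
    simpa using v.asIdeal.sub_mem hm h
  have hbc : b * c ^ 2 ∉ v.asIdeal := fun hm ↦ hmem (Ideal.mul_mem_right _ _ hm)
  have hd : d ∉ v.asIdeal := fun hm ↦ hmem (Ideal.mul_mem_left _ _ hm)
  have hb' : b ∉ v.asIdeal := fun hm ↦ hbc (Ideal.mul_mem_right _ _ hm)
  have hc' : c ^ 2 ∉ v.asIdeal := fun hm ↦ hbc (Ideal.mul_mem_left _ _ hm)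
  have h1 := quadSymbol_congr h
  rwa [quadSymbol_mul hbc hd, quadSymbol_mul hb' hc', hb, quadSymbol_one,
    quadSymbol_eq_one_iff.mpr ⟨c, by simp⟩, one_mul, one_mul] at h1

end Assembly

/-- Existence of the arithmetic parameters `a, b, c, d`
(Proposition 2.1 of Huang–Liang). -/
theorem stmt0 (K : Type*) [Field K] [NumberField K]
    (Ω : Finset (HeightOneSpectrum (𝓞 K)))
    (hΩ : ∀ π ∈ Ω, (2 : 𝓞 K) ∉ π.asIdeal) :
    ∃ (a b c d : 𝓞 K) (va vb vc vd : HeightOneSpectrum (𝓞 K)),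
      va.asIdeal = Ideal.span {a} ∧ vb.asIdeal = Ideal.span {b} ∧
      vc.asIdeal = Ideal.span {c} ∧ vd.asIdeal = Ideal.span {d} ∧
      -- (i) the four prime ideals are pairwise distinct, none divides (2),
      -- none corresponds to a place of Ω⁰
      (va ≠ vb ∧ va ≠ vc ∧ va ≠ vd ∧ vb ≠ vc ∧ vb ≠ vd ∧ vc ≠ vd) ∧
      ((2 : 𝓞 K) ∉ va.asIdeal ∧ (2 : 𝓞 K) ∉ vb.asIdeal ∧
        (2 : 𝓞 K) ∉ vc.asIdeal ∧ (2 : 𝓞 K) ∉ vd.asIdeal) ∧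
      (va ∉ Ω ∧ vb ∉ Ω ∧ vc ∉ Ω ∧ vd ∉ Ω) ∧
      -- (ii) a, b are squares in K_π for π ∈ Ω⁰ or π ∣ 2, and positive at real places
      (∀ π : HeightOneSpectrum (𝓞 K), (π ∈ Ω ∨ (2 : 𝓞 K) ∈ π.asIdeal) →
        IsSquare (intToAdicCompletion π a) ∧ IsSquare (intToAdicCompletion π b)) ∧
      (∀ σ : K →+* ℝ, 0 < σ (algebraMap (𝓞 K) K a) ∧ 0 < σ (algebraMap (𝓞 K) K b)) ∧
      -- (iii) 2 and -1 are squares in K_(a) and K_(b)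
      (IsSquare ((2 : va.adicCompletion K)) ∧ IsSquare ((-1 : va.adicCompletion K)) ∧
        IsSquare ((2 : vb.adicCompletion K)) ∧ IsSquare ((-1 : vb.adicCompletion K))) ∧
      -- (iv)
      (b ∣ a - 1 ∧ a ∣ b * c ^ 2 * d - 1) ∧
      -- (v)
      (¬ IsSquare (intToAdicCompletion va c) ∧ ¬ IsSquare (intToAdicCompletion vb c) ∧
        ¬ IsSquare (intToAdicCompletion vb d) ∧ IsSquare (intToAdicCompletion vc d)) ∧
      -- (vi)
      (IsSquare (intToAdicCompletion vb a) ∧ ¬ IsSquare (intToAdicCompletion vc a) ∧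
        IsSquare (intToAdicCompletion va b) ∧ ¬ IsSquare (intToAdicCompletion vc b) ∧
        IsSquare (intToAdicCompletion va d)) ∧
      -- (vii)
      ¬ a ∣ b * c * d + 2 := by
  obtain ⟨va, vb, vc, a, b, c, ha, hb, hab, hab1, hba, hc, hcΩ, hc2, hac, hbc, hca, hcb, hac', hbc'⟩ :=
    exists_prime_triple Ω
  have hb_va : b ∉ va.asIdeal := fun h ↦ hab (eq_of_mem_asIdeal hb.span_eq h).symm
  have hc_va : c ∉ va.asIdeal := fun h ↦ hac (eq_of_mem_asIdeal hc h).symm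
  obtain ⟨vd, d, hd, hdΩ, hd2, had, hbd, hcd, hda, hdb, hdc⟩ := exists_last_prime Ω hab hac hbc hb.two_notMem
    (va.isPrime.mul_notMem hb_va (mt (va.isPrime.mem_of_pow_mem 2) hc_va))
  have hd_va : d ∉ va.asIdeal := fun h ↦ had (eq_of_mem_asIdeal hd h).symm
  refine ⟨a, b, c, d, va, vb, vc, vd, ha.span_eq, hb.span_eq, hc, hd, ⟨hab, hac, had, hbc, hbd, hcd⟩,
    ⟨ha.two_notMem, hb.two_notMem, hc2, hd2⟩, ⟨ha.notMem, hb.notMem, hcΩ, hdΩ⟩,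
    fun π hπ ↦ ⟨ha.isSquare hΩ hπ, hb.isSquare hΩ hπ⟩, fun σ ↦ ⟨ha.pos σ, hb.pos σ⟩,
    ⟨ha.isSquare_two, ha.isSquare_neg_one, hb.isSquare_two, hb.isSquare_neg_one⟩, ⟨?_, ?_⟩,
    ⟨not_isSquare_adicCompletionHom hca, not_isSquare_adicCompletionHom hcb, not_isSquare_adicCompletionHom hdb,
      isSquare_adicCompletionHom_of_sub_one_mem hc2 hdc⟩,
    ⟨isSquare_adicCompletionHom_of_sub_one_mem hb.two_notMem hab1, not_isSquare_adicCompletionHom hac',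
      isSquare_adicCompletionHom ha.two_notMem hb_va hba, not_isSquare_adicCompletionHom hbc',
      isSquare_adicCompletionHom ha.two_notMem hd_va (quadSymbol_eq_one_of_mul_sq_mul hba hda)⟩,
    ha.not_dvd_add_two hc_va hca hda⟩
  · rwa [← Ideal.mem_span_singleton, ← hb.span_eq]
  · rwa [← Ideal.mem_span_singleton, ← ha.span_eq]
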